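/- Let K = ℚ(√−11) with ring of integers 𝒪_K = ℤ[(1+√−11)/2], and let λ = (1+√−11)/2 ∈ 𝒪_K, which has norm 3. There exist symmetric Hermitian modular forms g₄, g₆, g₆', g₈, g₉, g₁₀, g₁₁, g₁₂ for 𝒪_K of weights 4, 6, 6, 8, 9, 10, 11, 12 such that for every symmetric Hermitian modular form F for 𝒪_K there is a polynomial P ∈ ℂ[X₁,…,X₈] with (F − P(g₄, g₆, g₆', g₈, g₉, g₁₀, g₁₁, g₁₂)) ∘ φ_λ ≡ 0, i.e., F − P(g₄,…,g₁₂) vanishes on the Heegner divisor ℋ₃. -/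

import Mathlib

noncomputable section

open Matrix Filter Topology
open scoped ComplexOrder

attribute [local instance] Matrix.normedAddCommGroup Matrix.normedSpace

/-- The algebraic number (1 + √(-d))/2 = (1 + i·√d)/2 , viewed in ℂ. -/
def omg (d : ℕ) : ℂ := (1 + Complex.I * (Real.sqrt d : ℝ)) / 2

/-- The ring of integers ℤ[(1+√(-d))/2] of ℚ(√(-d)) (for d ≡ 3 mod 4), as a subset of ℂ. -/
def ringInts (d : ℕ) : Set ℂ := {z | ∃ a b : ℤ, z = (a : ℂ) + (b : ℂ) * omg d}

/-- The Hermitian upper half-space of degree two: 2×2 complex matrices τ such that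
(τ - conj(τ)ᵀ)/(2i) is positive definite. -/
def HH2 : Set (Matrix (Fin 2) (Fin 2) ℂ) :=
  {τ | (Matrix.of fun i j => (τ i j - (starRingEnd ℂ) (τ j i)) / (2 * Complex.I)).PosDef}

/-- The matrix J = [[0, -I₂],[I₂, 0]]. -/
def Jmat : Matrix (Fin 4) (Fin 4) ℂ :=
  !![0,0,-1,0; 0,0,0,-1; 1,0,0,0; 0,1,0,0]

/-- Upper-left 2×2 block. -/
def blkA (M : Matrix (Fin 4) (Fin 4) ℂ) : Matrix (Fin 2) (Fin 2) ℂ :=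
  !![M 0 0, M 0 1; M 1 0, M 1 1]
/-- Upper-right 2×2 block. -/
def blkB (M : Matrix (Fin 4) (Fin 4) ℂ) : Matrix (Fin 2) (Fin 2) ℂ :=
  !![M 0 2, M 0 3; M 1 2, M 1 3]
/-- Lower-left 2×2 block. -/
def blkC (M : Matrix (Fin 4) (Fin 4) ℂ) : Matrix (Fin 2) (Fin 2) ℂ :=
  !![M 2 0, M 2 1; M 3 0, M 3 1]
/-- Lower-right 2×2 block. -/
def blkD (M : Matrix (Fin 4) (Fin 4) ℂ) : Matrix (Fin 2) (Fin 2) ℂ :=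
  !![M 2 2, M 2 3; M 3 2, M 3 3]

/-- Membership in SU_{2,2}(𝒪_K): entries in 𝒪_K, determinant 1, and Mᵀ·J·conj(M) = J. -/
def inSU (d : ℕ) (M : Matrix (Fin 4) (Fin 4) ℂ) : Prop :=
  (∀ i j, M i j ∈ ringInts d) ∧ M.det = 1 ∧
    Mᵀ * Jmat * M.map (starRingEnd ℂ) = Jmat

/-- Möbius action M·τ = (aτ+b)(cτ+d)⁻¹. -/
def moebius (M : Matrix (Fin 4) (Fin 4) ℂ) (τ : Matrix (Fin 2) (Fin 2) ℂ) :
    Matrix (Fin 2) (Fin 2) ℂ :=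
  (blkA M * τ + blkB M) * (blkC M * τ + blkD M)⁻¹

/-- A Hermitian modular form of weight k for 𝒪_K, K = ℚ(√(-d)): a holomorphic function on
𝐇₂ satisfying F(M·τ) = det(cτ+d)^k·F(τ) for all M ∈ SU_{2,2}(𝒪_K). -/
def IsHMF (d k : ℕ) (F : Matrix (Fin 2) (Fin 2) ℂ → ℂ) : Prop :=
  DifferentiableOn ℂ F HH2 ∧
    ∀ M, inSU d M → ∀ τ ∈ HH2,
      F (moebius M τ) = (blkC M * τ + blkD M).det ^ k * F τ

/-- A symmetric Hermitian modular form: F(τᵀ) = (-1)^k F(τ). -/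
def IsSymHMF (d k : ℕ) (F : Matrix (Fin 2) (Fin 2) ℂ → ℂ) : Prop :=
  IsHMF d k F ∧ ∀ τ ∈ HH2, F τᵀ = (-1) ^ k * F τ

/-- A skew-symmetric Hermitian modular form: F(τᵀ) = -(-1)^k F(τ). -/
def IsSkewHMF (d k : ℕ) (F : Matrix (Fin 2) (Fin 2) ℂ → ℂ) : Prop :=
  IsHMF d k F ∧ ∀ τ ∈ HH2, F τᵀ = -((-1) ^ k * F τ)

/-- The embedding φ_λ of the Siegel upper half-space into 𝐇₂ given by
[[τ, z],[z, w]] ↦ [[τ, conj(λ)z],[λz, ℓw]] with ℓ = λ·conj(λ). -/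
def phiLam (lam : ℂ) (τ : Matrix (Fin 2) (Fin 2) ℂ) : Matrix (Fin 2) (Fin 2) ℂ :=
  !![τ 0 0, (starRingEnd ℂ) lam * τ 0 1;
     lam * τ 0 1, (lam * (starRingEnd ℂ) lam) * τ 1 1]

theorem mem_HH2_iff (Z : Matrix (Fin 2) (Fin 2) ℂ) :
    Z ∈ HH2 ↔ 0 < (Z 0 0).im ∧
      Complex.normSq (Z 0 1 - (starRingEnd ℂ) (Z 1 0)) < 4 * ((Z 0 0).im * (Z 1 1).im) := by
  have e00 : (Z 0 0 - (starRingEnd ℂ) (Z 0 0)) / (2 * Complex.I) = ((Z 0 0).im : ℂ) := by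
    rw [Complex.sub_conj]; field_simp; push_cast; ring
  have e11 : (Z 1 1 - (starRingEnd ℂ) (Z 1 1)) / (2 * Complex.I) = ((Z 1 1).im : ℂ) := by
    rw [Complex.sub_conj]; field_simp; push_cast; ring
  have hc : ∀ a b : ℂ, (starRingEnd ℂ) ((a - (starRingEnd ℂ) b) / (2 * Complex.I)) =
      (b - (starRingEnd ℂ) a) / (2 * Complex.I) := by
    intro a b
    simp only [map_div₀, map_sub, map_mul, Complex.conj_I, Complex.conj_conj, map_ofNat]
    field_simp; ring
  have hn : (Z 0 1 - (starRingEnd ℂ) (Z 1 0)) / (2 * Complex.I) *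
      ((Z 1 0 - (starRingEnd ℂ) (Z 0 1)) / (2 * Complex.I)) =
      ((Complex.normSq (Z 0 1 - (starRingEnd ℂ) (Z 1 0)) / 4 : ℝ) : ℂ) := by
    have h2 := hc (Z 0 1) (Z 1 0)
    rw [← h2, Complex.mul_conj, Complex.normSq_div]
    norm_num [Complex.normSq_apply]
  unfold HH2
  rw [Set.mem_ofPred_eq]
  constructor
  · intro h
    have h0 := h.diag_pos (i := 0)
    have h1 := h.det_pos
    simp only [Matrix.of_apply] at h0
    rw [Matrix.det_fin_two] at h1
    simp only [Matrix.of_apply] at h1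
    rw [e00] at h0
    rw [e00, e11, hn] at h1
    have h0' : 0 < (Z 0 0).im := by exact_mod_cast h0
    have h1' : 0 < (Z 0 0).im * (Z 1 1).im -
      Complex.normSq (Z 0 1 - (starRingEnd ℂ) (Z 1 0)) / 4 := by exact_mod_cast h1
    exact ⟨h0', by linarith⟩
  · rintro ⟨h0, h1⟩
    rw [Matrix.posDef_iff_dotProduct_mulVec]
    refine ⟨?_, ?_⟩
    · ext i j
      simp only [Matrix.conjTranspose_apply, Matrix.of_apply]
      exact hc _ _
    · intro x hx
      set v := (Z 0 0).im
      set w := (Z 1 1).im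
      set c := (Z 0 1 - (starRingEnd ℂ) (Z 1 0)) / (2 * Complex.I) with hcdef
      have hcn : Complex.normSq c = Complex.normSq (Z 0 1 - (starRingEnd ℂ) (Z 1 0)) / 4 := by
        rw [hcdef, Complex.normSq_div]; norm_num [Complex.normSq_apply]
      have key : star x ⬝ᵥ (Matrix.of fun i j =>
          (Z i j - (starRingEnd ℂ) (Z j i)) / (2 * Complex.I)) *ᵥ x =
          ((Complex.normSq (v * x 0 + c * x 1) / v +
            (v * w - Complex.normSq c) / v * Complex.normSq (x 1) : ℝ) : ℂ) := by
        simp only [dotProduct, mulVec, Fin.sum_univ_two, Matrix.of_apply, Pi.star_apply,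
          e00, e11]
        have hc1 : (Z 1 0 - (starRingEnd ℂ) (Z 0 1)) / (2 * Complex.I) = (starRingEnd ℂ) c := by
          rw [hcdef, hc]
        rw [hc1, ← hcdef]
        push_cast
        rw [← Complex.mul_conj, ← Complex.mul_conj, ← Complex.mul_conj]
        have hv : (v : ℂ) ≠ 0 := by exact_mod_cast h0.ne'
        simp only [map_add, map_mul, Complex.conj_ofReal, RCLike.star_def]
        field_simp
        ring
      rw [key]
      have hpos : 0 < v * w - Complex.normSq c := by rw [hcn]; linarith
      have : 0 < (Complex.normSq (v * x 0 + c * x 1) / v +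
            (v * w - Complex.normSq c) / v * Complex.normSq (x 1) : ℝ) := by
        by_cases hx1 : x 1 = 0
        · have hx0 : x 0 ≠ 0 := by
            intro h; apply hx; ext i; fin_cases i <;> simp [h, hx1]
          have : 0 < Complex.normSq (v * x 0 + c * x 1) := by
            rw [Complex.normSq_pos, hx1]; simp [h0.ne', hx0]
          have h4 := div_pos this h0
          rw [hx1] at h4 ⊢
          simpa only [map_zero, mul_zero, add_zero] using h4
        · have : 0 < Complex.normSq (x 1) := Complex.normSq_pos.2 hx1
          have := Complex.normSq_nonneg (v * x 0 + c * x 1)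
          positivity
      exact_mod_cast this

theorem isOpen_HH2 : IsOpen HH2 := by
  have : HH2 = {Z : Matrix (Fin 2) (Fin 2) ℂ | 0 < (Z 0 0).im} ∩
      {Z | Complex.normSq (Z 0 1 - (starRingEnd ℂ) (Z 1 0)) < 4 * ((Z 0 0).im * (Z 1 1).im)} := by
    ext Z; exact mem_HH2_iff Z
  rw [this]
  have hc : ∀ i j : Fin 2, Continuous fun Z : Matrix (Fin 2) (Fin 2) ℂ => Z i j :=
    fun i j => (continuous_apply j).comp (continuous_apply i)
  refine IsOpen.inter (isOpen_lt continuous_const (Complex.continuous_im.comp (hc 0 0)))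
    (isOpen_lt ?_ ?_)
  · exact Complex.continuous_normSq.comp ((hc 0 1).sub (Complex.continuous_conj.comp (hc 1 0)))
  · exact continuous_const.mul ((Complex.continuous_im.comp (hc 0 0)).mul
      (Complex.continuous_im.comp (hc 1 1)))

theorem transpose_mem_HH2 {Z : Matrix (Fin 2) (Fin 2) ℂ} (h : Z ∈ HH2) : Zᵀ ∈ HH2 := by
  rw [mem_HH2_iff] at *
  refine ⟨h.1, ?_⟩
  have : Complex.normSq (Zᵀ 0 1 - (starRingEnd ℂ) (Zᵀ 1 0)) =
      Complex.normSq (Z 0 1 - (starRingEnd ℂ) (Z 1 0)) := by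
    rw [← Complex.normSq_conj]
    simp only [Matrix.transpose_apply, map_sub, Complex.conj_conj]
    rw [← Complex.normSq_neg, neg_sub]
  rw [this]; exact h.2

theorem omg_re : (omg 11).re = 1 / 2 := by
  simp [omg]

theorem omg_im : (omg 11).im = √11 / 2 := by
  simp [omg]

theorem omg_sq : omg 11 * omg 11 = omg 11 - 3 := by
  have h : ((√11 : ℝ) : ℂ) * ((√11 : ℝ) : ℂ) = 11 := by
    rw [← Complex.ofReal_mul, Real.mul_self_sqrt (by norm_num)]; norm_num
  simp only [omg, Nat.cast_ofNat]
  linear_combination (-1 / 4 : ℂ) * h + (((√11 : ℝ) : ℂ) * ((√11 : ℝ) : ℂ) / 4) * Complex.I_mul_I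

theorem conj_omg : (starRingEnd ℂ) (omg 11) = 1 - omg 11 := by
  apply Complex.ext
  · rw [Complex.conj_re, Complex.sub_re, omg_re]; norm_num
  · rw [Complex.conj_im, Complex.sub_im]; simp

/-- The ring of integers of `ℚ(√-11)` as a subring of `ℂ`. -/
def OK11 : Subring ℂ where
  carrier := ringInts 11
  mul_mem' := by
    rintro _ _ ⟨a, b, rfl⟩ ⟨c, d, rfl⟩
    refine ⟨a * c - 3 * b * d, a * d + b * c + b * d, ?_⟩
    push_cast
    linear_combination (b * d : ℂ) * omg_sq
  one_mem' := ⟨1, 0, by simp⟩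
  add_mem' := by
    rintro _ _ ⟨a, b, rfl⟩ ⟨c, d, rfl⟩
    exact ⟨a + c, b + d, by push_cast; ring⟩
  zero_mem' := ⟨0, 0, by simp⟩
  neg_mem' := by
    rintro _ ⟨a, b, rfl⟩
    exact ⟨-a, -b, by push_cast; ring⟩

theorem mem_OK11 {z : ℂ} : z ∈ OK11 ↔ z ∈ ringInts 11 := Iff.rfl

theorem conj_mem_OK11 {z : ℂ} (h : z ∈ OK11) : (starRingEnd ℂ) z ∈ OK11 := by
  obtain ⟨a, b, rfl⟩ := h
  refine ⟨a + b, -b, ?_⟩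
  simp only [map_add, map_mul, map_intCast, conj_omg]
  push_cast; ring

theorem normSq_OK11 (a b : ℤ) : Complex.normSq ((a : ℂ) + b * omg 11) =
    ((a ^ 2 + a * b + 3 * b ^ 2 : ℤ) : ℝ) := by
  have h : √11 * √11 = 11 := Real.mul_self_sqrt (by norm_num)
  rw [Complex.normSq_apply]
  simp only [Complex.add_re, Complex.mul_re, Complex.add_im, Complex.mul_im, Complex.intCast_re,
    Complex.intCast_im, omg_re, omg_im]
  push_cast
  linear_combination (b ^ 2 / 4 : ℝ) * h

theorem exists_nat_normSq {z : ℂ} (h : z ∈ OK11) : ∃ n : ℕ, Complex.normSq z = n := by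
  obtain ⟨a, b, rfl⟩ := h
  rw [normSq_OK11]
  have : 0 ≤ a ^ 2 + a * b + 3 * b ^ 2 := by nlinarith [sq_nonneg (2 * a + b), sq_nonneg b]
  obtain ⟨n, hn⟩ := Int.eq_ofNat_of_zero_le this
  exact ⟨n, by rw [hn]; simp⟩

theorem exists_int_of_real {z : ℂ} (h : z ∈ OK11) (hz : z.im = 0) : ∃ n : ℤ, z = n := by
  obtain ⟨a, b, rfl⟩ := h
  have h3 : (b : ℝ) * (√11 / 2) = 0 := by
    simpa [omg_re, omg_im] using hz
  have h11 : √11 / 2 ≠ 0 := by positivity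
  have : (b : ℝ) = 0 := by simpa [h11] using h3
  have hb : b = 0 := by exact_mod_cast this
  exact ⟨a, by simp [hb]⟩

theorem eq_one_or_neg_one_of_unit {x y : ℂ} (hx : x ∈ OK11) (hy : y ∈ OK11) (h : x * y = 1) :
    x = 1 ∨ x = -1 := by
  obtain ⟨n, hn⟩ := exists_nat_normSq hx
  obtain ⟨m, hm⟩ := exists_nat_normSq hy
  have h1 : Complex.normSq x * Complex.normSq y = 1 := by rw [← map_mul, h, map_one]
  rw [hn, hm] at h1
  have h2 : n * m = 1 := by exact_mod_cast h1
  have h3 : n = 1 := Nat.eq_one_of_mul_eq_one_right h2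
  obtain ⟨a, b, rfl⟩ := hx
  rw [normSq_OK11, h3] at hn
  have h4 : a ^ 2 + a * b + 3 * b ^ 2 = 1 := by exact_mod_cast hn
  have hb : b = 0 := by
    have : b ^ 2 < 1 := by nlinarith [sq_nonneg (2 * a + b)]
    have h5 : b ^ 2 = 0 := by have := sq_nonneg b; omega
    exact pow_eq_zero_iff (two_ne_zero) |>.1 h5
  subst hb
  have : (a - 1) * (a + 1) = 0 := by linarith
  rcases mul_eq_zero.1 this with h6 | h6
  · left; have : a = 1 := by linarith
    simp [this]
  · right; have : a = -1 := by linarith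
    simp [this]

theorem exists_near_OK11 (z : ℂ) : ∃ q ∈ OK11, Complex.normSq (z - q) < 1 := by
  set b := round (z.im / (√11 / 2)) with hb
  set a := round (z.re - b / 2) with ha
  refine ⟨a + b * omg 11, ⟨a, b, rfl⟩, ?_⟩
  have h : √11 * √11 = 11 := Real.mul_self_sqrt (by norm_num)
  have hp : 0 < √11 := by positivity
  have h1 := abs_sub_round (z.im / (√11 / 2))
  have h2 := abs_sub_round (z.re - b / 2)
  rw [← hb] at h1
  rw [← ha] at h2
  rw [Complex.normSq_apply]
  simp only [Complex.sub_re, Complex.sub_im, Complex.add_re, Complex.mul_re, Complex.add_im,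
    Complex.mul_im, Complex.intCast_re, Complex.intCast_im, omg_re, omg_im]
  have e1 : z.re - (a + (b * (1 / 2) - 0 * (√11 / 2))) = z.re - b / 2 - a := by ring
  have e2 : z.im - (0 + (b * (√11 / 2) + 0 * (1 / 2))) =
    (z.im / (√11 / 2) - b) * (√11 / 2) := by field_simp; ring
  rw [e1, e2]
  have h3 : (z.re - b / 2 - a) * (z.re - b / 2 - a) ≤ 1 / 4 := by
    have := abs_le.1 h2; nlinarith
  have h4 : (z.im / (√11 / 2) - b) * (z.im / (√11 / 2) - b) ≤ 1 / 4 := by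
    have := abs_le.1 h1; nlinarith
  nlinarith

/-- Translation by a matrix. -/
def trMat (p q r s : ℂ) : Matrix (Fin 4) (Fin 4) ℂ :=
  !![1,0,p,q; 0,1,r,s; 0,0,1,0; 0,0,0,1]
/-- Lower unipotent Levi element. -/
def loMat (a : ℂ) : Matrix (Fin 4) (Fin 4) ℂ :=
  !![1,0,0,0; a,1,0,0; 0,0,1,-(starRingEnd ℂ) a; 0,0,0,1]
/-- The Weyl element of the Levi factor. -/
def wMat : Matrix (Fin 4) (Fin 4) ℂ :=
  !![0,1,0,0; -1,0,0,0; 0,0,0,1; 0,0,-1,0]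
/-- Partial inversion in the first coordinate. -/
def invMat : Matrix (Fin 4) (Fin 4) ℂ :=
  !![0,0,-1,0; 0,1,0,0; 1,0,0,0; 0,0,0,1]

/-- The generating set of the Hermitian modular group. -/
inductive IsGen : Matrix (Fin 4) (Fin 4) ℂ → Prop
  | tr (p s : ℤ) (q : ℂ) (hq : q ∈ OK11) : IsGen (trMat p q ((starRingEnd ℂ) q) s)
  | lo (a : ℂ) (ha : a ∈ OK11) : IsGen (loMat a)
  | w : IsGen wMat
  | inv : IsGen invMat

/-- The monoid generated by the generators. -/
def genMon : Submonoid (Matrix (Fin 4) (Fin 4) ℂ) := Submonoid.closure {M | IsGen M}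

theorem IsGen.mem {M} (h : IsGen M) : M ∈ genMon := Submonoid.subset_closure h

theorem inSU_mul {M N : Matrix (Fin 4) (Fin 4) ℂ} (hM : inSU 11 M) (hN : inSU 11 N) :
    inSU 11 (M * N) := by
  refine ⟨fun i j => ?_, by rw [det_mul, hM.2.1, hN.2.1, one_mul], ?_⟩
  · rw [← mem_OK11, Matrix.mul_apply]
    exact Subring.sum_mem _ fun k _ => OK11.mul_mem (hM.1 i k) (hN.1 k j)
  · rw [Matrix.transpose_mul, Matrix.map_mul]
    calc Nᵀ * Mᵀ * Jmat * (M.map (starRingEnd ℂ) * N.map (starRingEnd ℂ))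
        = Nᵀ * (Mᵀ * Jmat * M.map (starRingEnd ℂ)) * N.map (starRingEnd ℂ) := by
          simp only [Matrix.mul_assoc]
      _ = Jmat := by rw [hM.2.2, hN.2.2]

theorem int_mem_OK11 (n : ℤ) : (n : ℂ) ∈ OK11 := intCast_mem OK11 n

theorem IsGen.inSU {M} (h : IsGen M) : inSU 11 M := by
  have h0 := OK11.zero_mem
  have h1 := OK11.one_mem
  have h2 := OK11.neg_mem h1
  cases h with
  | tr p s q hq =>
    refine ⟨?_, ?_, ?_⟩
    · have := conj_mem_OK11 hq
      have hp := int_mem_OK11 p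
      have hs := int_mem_OK11 s
      intro i j; rw [← mem_OK11]
      fin_cases i <;> fin_cases j <;> simp [trMat, *]
    · simp [trMat, Matrix.det_succ_row_zero, Fin.sum_univ_succ, Fin.succAbove]
    · ext i j; fin_cases i <;> fin_cases j <;>
        simp [trMat, Jmat, Matrix.mul_apply, Fin.sum_univ_four]
  | lo a ha =>
    refine ⟨?_, ?_, ?_⟩
    · have := conj_mem_OK11 ha
      intro i j; rw [← mem_OK11]
      fin_cases i <;> fin_cases j <;> simp [loMat, *]
    · simp [loMat, Matrix.det_succ_row_zero, Fin.sum_univ_succ, Fin.succAbove]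
    · ext i j; fin_cases i <;> fin_cases j <;>
        simp [loMat, Jmat, Matrix.mul_apply, Fin.sum_univ_four]
  | w =>
    refine ⟨?_, ?_, ?_⟩
    · intro i j; rw [← mem_OK11]
      fin_cases i <;> fin_cases j <;> simp [wMat, *]
    · simp [wMat, Matrix.det_succ_row_zero, Fin.sum_univ_succ, Fin.succAbove]
    · ext i j; fin_cases i <;> fin_cases j <;>
        simp [wMat, Jmat, Matrix.mul_apply, Fin.sum_univ_four]
  | inv =>
    refine ⟨?_, ?_, ?_⟩
    · intro i j; rw [← mem_OK11]
      fin_cases i <;> fin_cases j <;> simp [invMat, *]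
    · simp [invMat, Matrix.det_succ_row_zero, Fin.sum_univ_succ, Fin.succAbove]
    · ext i j; fin_cases i <;> fin_cases j <;>
        simp [invMat, Jmat, Matrix.mul_apply, Fin.sum_univ_four]

theorem IsGen.exists_inv {g} (h : IsGen g) : ∃ g' ∈ genMon, g' * g = 1 := by
  cases h with
  | tr p s q hq =>
    refine ⟨_, (IsGen.tr (-p) (-s) (-q) (OK11.neg_mem hq)).mem, ?_⟩
    ext i j; fin_cases i <;> fin_cases j <;>
        simp [trMat, Matrix.mul_apply, Fin.sum_univ_four]
  | lo a ha =>
    refine ⟨_, (IsGen.lo (-a) (OK11.neg_mem ha)).mem, ?_⟩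
    ext i j; fin_cases i <;> fin_cases j <;>
        simp [loMat, Matrix.mul_apply, Fin.sum_univ_four]
  | w =>
    refine ⟨wMat ^ 3, genMon.pow_mem IsGen.w.mem 3, ?_⟩
    have : wMat * wMat = -1 := by
      ext i j; fin_cases i <;> fin_cases j <;>
        simp [wMat, Matrix.mul_apply, Fin.sum_univ_four]
    rw [← pow_succ, show 3 + 1 = 2 * 2 by norm_num, pow_mul, pow_two wMat, this]; simp
  | inv =>
    refine ⟨invMat ^ 3, genMon.pow_mem IsGen.inv.mem 3, ?_⟩
    have : invMat * invMat = Matrix.diagonal ![-1, 1, -1, 1] := by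
      ext i j; fin_cases i <;> fin_cases j <;>
        simp [invMat, Matrix.mul_apply, Fin.sum_univ_four]
    rw [← pow_succ, show 3 + 1 = 2 * 2 by norm_num, pow_mul, pow_two invMat, this, pow_two,
      Matrix.diagonal_mul_diagonal]
    ext i j; fin_cases i <;> fin_cases j <;> simp

theorem inSU_rel {M : Matrix (Fin 4) (Fin 4) ℂ} (h : inSU 11 M) (i j : Fin 4) :
    -(M 0 i * (starRingEnd ℂ) (M 2 j)) - M 1 i * (starRingEnd ℂ) (M 3 j)
      + M 2 i * (starRingEnd ℂ) (M 0 j) + M 3 i * (starRingEnd ℂ) (M 1 j) = Jmat i j := by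
  rw [← h.2.2]
  simp [Matrix.mul_apply, Fin.sum_univ_four, Jmat]
  ring

/-- The Weyl element moves the partial inversion to the second coordinate. -/
def invMat' : Matrix (Fin 4) (Fin 4) ℂ :=
  !![1,0,0,0; 0,0,0,-1; 0,0,1,0; 0,1,0,0]

/-- Upper unipotent Levi element. -/
def upMat (a : ℂ) : Matrix (Fin 4) (Fin 4) ℂ :=
  !![1,a,0,0; 0,1,0,0; 0,0,1,0; 0,0,-(starRingEnd ℂ) a,1]

theorem wMat_sq : wMat * wMat = -1 := by
  ext i j; fin_cases i <;> fin_cases j <;>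
    simp [wMat, Matrix.mul_apply, Fin.sum_univ_four]

theorem wMat_cube : wMat * (wMat * wMat) = !![0,-1,0,0; 1,0,0,0; 0,0,0,-1; 0,0,1,0] := by
  rw [wMat_sq]
  ext i j; fin_cases i <;> fin_cases j <;> simp [wMat]

theorem invMat'_eq : wMat * invMat * (wMat * (wMat * wMat)) = invMat' := by
  rw [wMat_cube]
  ext i j; fin_cases i <;> fin_cases j <;>
    simp [wMat, invMat, invMat', Matrix.mul_apply, Fin.sum_univ_four]

theorem upMat_eq (a : ℂ) : wMat * loMat (-a) * (wMat * (wMat * wMat)) = upMat a := by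
  rw [wMat_cube]
  ext i j; fin_cases i <;> fin_cases j <;>
    simp [wMat, loMat, upMat, Matrix.mul_apply, Fin.sum_univ_four]

theorem wMat_mem : wMat ∈ genMon := IsGen.w.mem

theorem invMat'_mem : invMat' ∈ genMon := by
  rw [← invMat'_eq]
  exact genMon.mul_mem (genMon.mul_mem wMat_mem IsGen.inv.mem)
    (genMon.mul_mem wMat_mem (genMon.mul_mem wMat_mem wMat_mem))

theorem upMat_mem {a : ℂ} (ha : a ∈ OK11) : upMat a ∈ genMon := by
  rw [← upMat_eq]
  exact genMon.mul_mem (genMon.mul_mem wMat_mem (IsGen.lo _ (OK11.neg_mem ha)).mem)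
    (genMon.mul_mem wMat_mem (genMon.mul_mem wMat_mem wMat_mem))

theorem neg_one_mem : (-1 : Matrix (Fin 4) (Fin 4) ℂ) ∈ genMon := by
  rw [← wMat_sq]; exact genMon.mul_mem wMat_mem wMat_mem

theorem inSU_of_mem {M : Matrix (Fin 4) (Fin 4) ℂ} (h : M ∈ genMon) : inSU 11 M := by
  induction h using Submonoid.closure_induction with
  | mem x hx => exact IsGen.inSU hx
  | one =>
    have := IsGen.inSU (IsGen.tr 0 0 0 OK11.zero_mem)
    have e : trMat ((0 : ℤ) : ℂ) 0 ((starRingEnd ℂ) 0) ((0 : ℤ) : ℂ) = 1 := by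
      ext i j; fin_cases i <;> fin_cases j <;> simp [trMat]
    rwa [e] at this
  | mul x y _ _ hx hy => exact inSU_mul hx hy

theorem exists_inv_of_mem {g : Matrix (Fin 4) (Fin 4) ℂ} (h : g ∈ genMon) :
    ∃ g' ∈ genMon, g' * g = 1 := by
  induction h using Submonoid.closure_induction with
  | mem x hx => exact IsGen.exists_inv hx
  | one => exact ⟨1, genMon.one_mem, by simp⟩
  | mul x y _ _ hx hy =>
    obtain ⟨x', hx', h1⟩ := hx
    obtain ⟨y', hy', h2⟩ := hy
    refine ⟨y' * x', genMon.mul_mem hy' hx', ?_⟩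
    calc y' * x' * (x * y) = y' * (x' * x) * y := by simp only [Matrix.mul_assoc]
      _ = 1 := by rw [h1, Matrix.mul_one, h2]

theorem mem_of_mul_mem {g M : Matrix (Fin 4) (Fin 4) ℂ} (hg : g ∈ genMon)
    (h : g * M ∈ genMon) : M ∈ genMon := by
  obtain ⟨g', hg', h1⟩ := exists_inv_of_mem hg
  have := genMon.mul_mem hg' h
  rwa [← Matrix.mul_assoc, h1, Matrix.one_mul] at this

theorem exists_reduce {x y : ℂ} (hy : y ≠ 0) :
    ∃ q ∈ OK11, Complex.normSq (x - q * y) < Complex.normSq y := by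
  obtain ⟨q, hq, h⟩ := exists_near_OK11 (x / y)
  refine ⟨q, hq, ?_⟩
  have : x - q * y = (x / y - q) * y := by field_simp
  rw [this, map_mul]
  have := Complex.normSq_pos.2 hy
  nlinarith

theorem exists_reduce_real {x y : ℂ} (hy : y ≠ 0) (hr : (x * (starRingEnd ℂ) y).im = 0) :
    ∃ q : ℤ, Complex.normSq (x + q * y) < Complex.normSq y := by
  have hn := Complex.normSq_pos.2 hy
  obtain ⟨t, ht⟩ : ∃ t : ℝ, x = t * y := by
    refine ⟨(x * (starRingEnd ℂ) y).re / Complex.normSq y, ?_⟩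
    have h1 : x * (starRingEnd ℂ) y = ((x * (starRingEnd ℂ) y).re : ℂ) := by
      apply Complex.ext <;> simp [hr]
    have h2 : (Complex.normSq y : ℂ) ≠ 0 := by exact_mod_cast hn.ne'
    push_cast
    rw [← h1, ← Complex.mul_conj]
    have h3 : (starRingEnd ℂ) y ≠ 0 := by simpa using hy
    field_simp
  refine ⟨-round t, ?_⟩
  have : x + ((-round t : ℤ) : ℂ) * y = ((t - round t : ℝ) : ℂ) * y := by
    rw [ht]; push_cast; ring
  rw [this, map_mul, Complex.normSq_ofReal]
  have h := abs_le.1 (abs_sub_round t)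
  have : (t - round t) * (t - round t) < 1 := by nlinarith
  nlinarith

section reduction
variable {M : Matrix (Fin 4) (Fin 4) ℂ}

/-- If the first column is `e₁` and the lower entry of the second column vanishes. -/
theorem mem_of_cols (h : inSU 11 M) (h00 : M 0 0 = 1) (h10 : M 1 0 = 0) (h20 : M 2 0 = 0)
    (h30 : M 3 0 = 0) (h31 : M 3 1 = 0) (h11 : M 1 1 = 1) : M ∈ genMon := by
  have r := fun j => inSU_rel h 0 j
  simp only [h00, h10, h20, h30] at r
  have r1 := r 1
  have r2 := r 2
  have r3 := r 3
  simp [Jmat] at r1 r2 r3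
  have h01 : M 0 1 ∈ OK11 := h.1 0 1
  refine mem_of_mul_mem (upMat_mem (OK11.neg_mem h01)) ?_
  have h' := inSU_mul (inSU_of_mem (upMat_mem (OK11.neg_mem h01))) h
  set N := upMat (-M 0 1) * M with hN
  have n0 : ∀ j, N 0 j = M 0 j - M 0 1 * M 1 j := fun j => by
      rw [hN, Matrix.mul_apply, Fin.sum_univ_four]; simp [upMat]; ring
  have n1 : ∀ j, N 1 j = M 1 j := fun j => by
      rw [hN, Matrix.mul_apply, Fin.sum_univ_four]; simp [upMat]
  have n2 : ∀ j, N 2 j = M 2 j := fun j => by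
      rw [hN, Matrix.mul_apply, Fin.sum_univ_four]; simp [upMat]
  have n3 : ∀ j, N 3 j = M 3 j + (starRingEnd ℂ) (M 0 1) * M 2 j := fun j => by
      rw [hN, Matrix.mul_apply, Fin.sum_univ_four]; simp [upMat]; ring
  clear_value N
  have a00 : N 0 0 = 1 := by rw [n0, h00, h10]; ring
  have a10 : N 1 0 = 0 := by rw [n1, h10]
  have a20 : N 2 0 = 0 := by rw [n2, h20]
  have a30 : N 3 0 = 0 := by rw [n3, h30, h20]; ring
  have a01 : N 0 1 = 0 := by rw [n0, h11]; ring
  have a11 : N 1 1 = 1 := by rw [n1, h11]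
  have a21 : N 2 1 = 0 := by rw [n2, r1]
  have a31 : N 3 1 = 0 := by rw [n3, h31, r1]; ring
  have r2' : M 2 2 = 1 := by simpa using congrArg (starRingEnd ℂ) r2
  have a22 : N 2 2 = 1 := by rw [n2, r2']
  have a23 : N 2 3 = 0 := by rw [n2, r3]
  have s2 := inSU_rel h' 1 2
  have s3 := inSU_rel h' 1 3
  simp [Jmat, a01, a11, a21, a31] at s2 s3
  have s3' : N 3 3 = 1 := by simpa using congrArg (starRingEnd ℂ) s3
  have t22 := inSU_rel h' 2 2
  have t23 := inSU_rel h' 2 3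
  have t33 := inSU_rel h' 3 3
  simp [Jmat, a22, a23, s2, s3'] at t22 t23 t33
  obtain ⟨p, hp⟩ := exists_int_of_real (h'.1 0 2) (by
    have := congrArg Complex.im t22
    simp at this; linarith)
  obtain ⟨s, hs⟩ := exists_int_of_real (h'.1 1 3) (by
    have := congrArg Complex.im t33
    simp at this; linarith)
  have a12 : N 1 2 = (starRingEnd ℂ) (N 0 3) := by
    linear_combination -t23
  have : N = trMat p (N 0 3) ((starRingEnd ℂ) (N 0 3)) s := by
    clear hN
    ext i j; fin_cases i <;> fin_cases j <;>
      simp [trMat, a00, a10, a20, a30, a01, a11, a21, a31, a22, a23, s2, s3', hp, hs, a12]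
  rw [this]
  exact (IsGen.tr p s (N 0 3) (h'.1 0 3)).mem

theorem mem_of_first_col (h : inSU 11 M) (h00 : M 0 0 = 1) (h10 : M 1 0 = 0) (h20 : M 2 0 = 0)
    (h30 : M 3 0 = 0) : M ∈ genMon := by
  obtain ⟨n, hn⟩ := exists_nat_normSq (h.1 3 1)
  induction n using Nat.strong_induction_on generalizing M with
  | _ n ih =>
  by_cases h31 : M 3 1 = 0
  · have r1 := inSU_rel h 0 1
    simp [h00, h10, h20, h30, Jmat] at r1
    have r2 := inSU_rel h 0 3
    simp [h00, h10, h20, h30, Jmat] at r2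
    have r3 := inSU_rel h 1 3
    simp [h31, r1, r2, Jmat] at r3
    rcases eq_one_or_neg_one_of_unit (h.1 1 1) (conj_mem_OK11 (h.1 3 3)) r3 with h11 | h11
    · exact mem_of_cols h h00 h10 h20 h30 h31 h11
    · refine mem_of_mul_mem (genMon.mul_mem invMat'_mem invMat'_mem) ?_
      have h' := inSU_mul (inSU_of_mem (genMon.mul_mem invMat'_mem invMat'_mem)) h
      have e : invMat' * invMat' = Matrix.diagonal ![1, -1, 1, -1] := by
        ext i j; fin_cases i <;> fin_cases j <;>
          simp [invMat', Matrix.mul_apply, Fin.sum_univ_four]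
      rw [e] at h' ⊢
      apply mem_of_cols h' <;> rw [Matrix.diagonal_mul] <;> simp [*]
  · have hreal : (M 1 1 * (starRingEnd ℂ) (M 3 1)).im = 0 := by
      have r1 := inSU_rel h 0 1
      simp [h00, h10, h20, h30, Jmat] at r1
      have r3 := inSU_rel h 1 1
      simp [r1, Jmat] at r3
      have := congrArg Complex.im r3
      simp at this ⊢; linarith
    obtain ⟨q, hq⟩ := exists_reduce_real h31 hreal
    have hg := genMon.mul_mem invMat'_mem (IsGen.tr 0 q 0 OK11.zero_mem).mem
    refine mem_of_mul_mem hg ?_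
    have h' := inSU_mul (inSU_of_mem hg) h
    set N := (invMat' * trMat ((0 : ℤ) : ℂ) 0 ((starRingEnd ℂ) 0) (q : ℂ)) * M with hN
    have n0 : ∀ j, N 0 j = M 0 j := fun j => by
      rw [hN, Matrix.mul_apply, Fin.sum_univ_four]; simp [invMat', trMat]
    have n1 : ∀ j, N 1 j = - M 3 j := fun j => by
      rw [hN, Matrix.mul_apply, Fin.sum_univ_four]; simp [invMat', trMat]
    have n2 : ∀ j, N 2 j = M 2 j := fun j => by
      rw [hN, Matrix.mul_apply, Fin.sum_univ_four]; simp [invMat', trMat]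
    have n3 : ∀ j, N 3 j = M 1 j + q * M 3 j := fun j => by
      rw [hN, Matrix.mul_apply, Fin.sum_univ_four]; simp [invMat', trMat]
    clear_value N
    obtain ⟨m, hm⟩ := exists_nat_normSq (h'.1 3 1)
    refine ih m ?_ h' (by rw [n0, h00]) (by rw [n1, h30, neg_zero]) (by rw [n2, h20])
      (by rw [n3, h10, h30]; ring) hm
    rw [← n3, hm, hn] at hq
    exact_mod_cast hq

theorem mem_of_c_zero (h : inSU 11 M) (h20 : M 2 0 = 0) (h30 : M 3 0 = 0) : M ∈ genMon := by
  obtain ⟨n, hn⟩ := exists_nat_normSq (h.1 0 0)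
  induction n using Nat.strong_induction_on generalizing M with
  | _ n ih =>
  by_cases h00 : M 0 0 = 0
  · have r2 := inSU_rel h 0 2
    simp [h00, h20, h30, Jmat] at r2
    have hunit := eq_one_or_neg_one_of_unit (h.1 1 0) (conj_mem_OK11 (h.1 3 2)) r2
    have key : ∀ M : Matrix (Fin 4) (Fin 4) ℂ, inSU 11 M → M 0 0 = 0 → M 1 0 = 1 → M 2 0 = 0 →
        M 3 0 = 0 → M ∈ genMon := by
      intro M h h00 h10 h20 h30
      refine mem_of_mul_mem wMat_mem ?_
      have h' := inSU_mul (inSU_of_mem wMat_mem) h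
      apply mem_of_first_col h' <;> simp [wMat, Matrix.mul_apply, Fin.sum_univ_four, *]
    rcases hunit with h10 | h10
    · exact key M h h00 h10 h20 h30
    · refine mem_of_mul_mem neg_one_mem ?_
      have h' := inSU_mul (inSU_of_mem neg_one_mem) h
      apply key _ h' <;> simp [*]
  · obtain ⟨q, hq, hlt⟩ := exists_reduce (x := M 1 0) h00
    have hg := genMon.mul_mem wMat_mem (IsGen.lo _ (OK11.neg_mem hq)).mem
    refine mem_of_mul_mem hg ?_
    have h' := inSU_mul (inSU_of_mem hg) h
    set N := (wMat * loMat (-q)) * M with hN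
    have n0 : N 0 0 = M 1 0 - q * M 0 0 := by
      rw [hN, Matrix.mul_apply, Fin.sum_univ_four]; simp [wMat, loMat]; ring
    have n2 : N 2 0 = 0 := by
      rw [hN, Matrix.mul_apply, Fin.sum_univ_four]; simp [wMat, loMat, h20, h30]
    have n3 : N 3 0 = 0 := by
      rw [hN, Matrix.mul_apply, Fin.sum_univ_four]; simp [wMat, loMat, h20, h30]
    clear_value N
    obtain ⟨m, hm⟩ := exists_nat_normSq (h'.1 0 0)
    refine ih m ?_ h' n2 n3 hm
    rw [← n0, hm, hn] at hlt
    exact_mod_cast hlt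

theorem mem_of_c_second_zero (h : inSU 11 M) (h30 : M 3 0 = 0) : M ∈ genMon := by
  obtain ⟨n, hn⟩ := exists_nat_normSq (h.1 2 0)
  induction n using Nat.strong_induction_on generalizing M with
  | _ n ih =>
  by_cases h20 : M 2 0 = 0
  · exact mem_of_c_zero h h20 h30
  · have hreal : (M 0 0 * (starRingEnd ℂ) (M 2 0)).im = 0 := by
      have r3 := inSU_rel h 0 0
      simp [h30, Jmat] at r3
      have := congrArg Complex.im r3
      simp at this ⊢; linarith
    obtain ⟨q, hq⟩ := exists_reduce_real h20 hreal
    have hg := genMon.mul_mem IsGen.inv.mem (IsGen.tr q 0 0 OK11.zero_mem).mem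
    refine mem_of_mul_mem hg ?_
    have h' := inSU_mul (inSU_of_mem hg) h
    set N := (invMat * trMat (q : ℂ) 0 ((starRingEnd ℂ) 0) ((0 : ℤ) : ℂ)) * M with hN
    have n2 : N 2 0 = M 0 0 + q * M 2 0 := by
      rw [hN, Matrix.mul_apply, Fin.sum_univ_four]; simp [invMat, trMat]
    have n3 : N 3 0 = 0 := by
      rw [hN, Matrix.mul_apply, Fin.sum_univ_four]; simp [invMat, trMat, h30]
    clear_value N
    obtain ⟨m, hm⟩ := exists_nat_normSq (h'.1 2 0)
    refine ih m ?_ h' n3 hm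
    rw [← n2, hm, hn] at hq
    exact_mod_cast hq

/-- The Hermitian modular group is generated by the generators. -/
theorem mem_genMon (h : inSU 11 M) : M ∈ genMon := by
  obtain ⟨n, hn⟩ := exists_nat_normSq (h.1 3 0)
  induction n using Nat.strong_induction_on generalizing M with
  | _ n ih =>
  by_cases h30 : M 3 0 = 0
  · exact mem_of_c_second_zero h h30
  · obtain ⟨q, hq, hlt⟩ := exists_reduce (x := M 2 0) h30
    have hg := genMon.mul_mem wMat_mem (IsGen.lo _ (conj_mem_OK11 hq)).mem
    refine mem_of_mul_mem hg ?_
    have h' := inSU_mul (inSU_of_mem hg) h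
    set N := (wMat * loMat ((starRingEnd ℂ) q)) * M with hN
    have n3 : N 3 0 = -(M 2 0 - q * M 3 0) := by
      rw [hN, Matrix.mul_apply, Fin.sum_univ_four]; simp [wMat, loMat]; try ring
    clear_value N
    obtain ⟨m, hm⟩ := exists_nat_normSq (h'.1 3 0)
    refine ih m ?_ h' hm
    rw [← Complex.normSq_neg, ← n3, hm, hn] at hlt
    exact_mod_cast hlt

end reduction

theorem eta_two (Z : Matrix (Fin 2) (Fin 2) ℂ) : ∃ t z₁ z₂ w, Z = !![t, z₁; z₂, w] :=
  ⟨_, _, _, _, Matrix.eta_fin_two Z⟩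

theorem blkA_mul (M N : Matrix (Fin 4) (Fin 4) ℂ) :
    blkA (M * N) = blkA M * blkA N + blkB M * blkC N := by
  ext i j; fin_cases i <;> fin_cases j <;>
    simp [blkA, blkB, blkC, Matrix.mul_apply, Fin.sum_univ_four] <;> ring

theorem blkB_mul (M N : Matrix (Fin 4) (Fin 4) ℂ) :
    blkB (M * N) = blkA M * blkB N + blkB M * blkD N := by
  ext i j; fin_cases i <;> fin_cases j <;>
    simp [blkA, blkB, blkD, Matrix.mul_apply, Fin.sum_univ_four] <;> ring

theorem blkC_mul (M N : Matrix (Fin 4) (Fin 4) ℂ) :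
    blkC (M * N) = blkC M * blkA N + blkD M * blkC N := by
  ext i j; fin_cases i <;> fin_cases j <;>
    simp [blkA, blkD, blkC, Matrix.mul_apply, Fin.sum_univ_four] <;> ring

theorem blkD_mul (M N : Matrix (Fin 4) (Fin 4) ℂ) :
    blkD (M * N) = blkC M * blkB N + blkD M * blkD N := by
  ext i j; fin_cases i <;> fin_cases j <;>
    simp [blkD, blkB, blkC, Matrix.mul_apply, Fin.sum_univ_four] <;> ring

/-- `F` transforms with weight `k` under `M`. -/
def Transforms (F : Matrix (Fin 2) (Fin 2) ℂ → ℂ) (k : ℕ) (M : Matrix (Fin 4) (Fin 4) ℂ) : Prop :=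
  ∀ Z ∈ HH2, (blkC M * Z + blkD M).det ≠ 0 ∧ moebius M Z ∈ HH2 ∧
    F (moebius M Z) = (blkC M * Z + blkD M).det ^ k * F Z

theorem Transforms.mul {F : Matrix (Fin 2) (Fin 2) ℂ → ℂ} {k : ℕ}
    {M N : Matrix (Fin 4) (Fin 4) ℂ} (hM : Transforms F k M) (hN : Transforms F k N) :
    Transforms F k (M * N) := by
  intro Z hZ
  obtain ⟨h1, h2, h3⟩ := hN Z hZ
  obtain ⟨h4, h5, h6⟩ := hM _ h2
  have hu : IsUnit (blkC N * Z + blkD N).det := isUnit_iff_ne_zero.2 h1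
  have key : moebius N Z * (blkC N * Z + blkD N) = blkA N * Z + blkB N := by
    rw [moebius, Matrix.mul_assoc, Matrix.nonsing_inv_mul _ hu, Matrix.mul_one]
  have e1 : blkC (M * N) * Z + blkD (M * N) =
      (blkC M * moebius N Z + blkD M) * (blkC N * Z + blkD N) := by
    rw [Matrix.add_mul, Matrix.mul_assoc, key, blkC_mul, blkD_mul]
    simp only [Matrix.mul_add, Matrix.add_mul, Matrix.mul_assoc]
    abel
  have e2 : blkA (M * N) * Z + blkB (M * N) =
      (blkA M * moebius N Z + blkB M) * (blkC N * Z + blkD N) := by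
    rw [Matrix.add_mul, Matrix.mul_assoc, key, blkA_mul, blkB_mul]
    simp only [Matrix.mul_add, Matrix.add_mul, Matrix.mul_assoc]
    abel
  have e3 : moebius (M * N) Z = moebius M (moebius N Z) := by
    rw [moebius, e1, e2, Matrix.mul_inv_rev, Matrix.mul_assoc,
      Matrix.mul_nonsing_inv_cancel_left _ _ hu, ← moebius.eq_1 M]
  rw [e3, e1, Matrix.det_mul]
  exact ⟨mul_ne_zero h4 h1, h5, by rw [h6, h3]; ring⟩

theorem moebius_trMat (p q r s t z₁ z₂ w : ℂ) :
    moebius (trMat p q r s) !![t, z₁; z₂, w] = !![t + p, z₁ + q; z₂ + r, w + s] := by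
  have : blkC (trMat p q r s) = 0 := by
    ext i j; fin_cases i <;> fin_cases j <;> simp [blkC, trMat]
  have h2 : blkD (trMat p q r s) = 1 := by
    ext i j; fin_cases i <;> fin_cases j <;> simp [blkD, trMat]
  rw [moebius, this, h2]
  simp [blkA, blkB, trMat]

theorem factor_trMat (p q r s : ℂ) (Z : Matrix (Fin 2) (Fin 2) ℂ) :
    (blkC (trMat p q r s) * Z + blkD (trMat p q r s)).det = 1 := by
  obtain ⟨t, z₁, z₂, w, rfl⟩ := eta_two Z
  simp [blkC, blkD, trMat, Matrix.det_fin_two]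

theorem factor_loMat (a : ℂ) (Z : Matrix (Fin 2) (Fin 2) ℂ) :
    (blkC (loMat a) * Z + blkD (loMat a)).det = 1 := by
  obtain ⟨t, z₁, z₂, w, rfl⟩ := eta_two Z
  simp [blkC, blkD, loMat, Matrix.det_fin_two]

theorem factor_wMat (Z : Matrix (Fin 2) (Fin 2) ℂ) :
    (blkC wMat * Z + blkD wMat).det = 1 := by
  obtain ⟨t, z₁, z₂, w, rfl⟩ := eta_two Z
  simp [blkC, blkD, wMat, Matrix.det_fin_two]

theorem factor_invMat (t z₁ z₂ w : ℂ) :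
    (blkC invMat * !![t, z₁; z₂, w] + blkD invMat).det = t := by
  simp [blkC, blkD, invMat, Matrix.det_fin_two]

theorem moebius_eq_of_mul {M : Matrix (Fin 4) (Fin 4) ℂ} {Z W : Matrix (Fin 2) (Fin 2) ℂ}
    (hd : (blkC M * Z + blkD M).det ≠ 0)
    (h : blkA M * Z + blkB M = W * (blkC M * Z + blkD M)) : moebius M Z = W := by
  rw [moebius, h, Matrix.mul_assoc, Matrix.mul_nonsing_inv _ (isUnit_iff_ne_zero.2 hd),
    Matrix.mul_one]

theorem moebius_loMat (a t z₁ z₂ w : ℂ) :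
    moebius (loMat a) !![t, z₁; z₂, w] = !![t, (starRingEnd ℂ) a * t + z₁; a * t + z₂,
      a * (starRingEnd ℂ) a * t + (starRingEnd ℂ) a * z₂ + a * z₁ + w] := by
  apply moebius_eq_of_mul
  · rw [factor_loMat]; simp
  · ext i j; fin_cases i <;> fin_cases j <;> simp [blkA, blkB, blkC, blkD, loMat] <;> ring

theorem moebius_wMat (t z₁ z₂ w : ℂ) :
    moebius wMat !![t, z₁; z₂, w] = !![w, -z₂; -z₁, t] := by
  apply moebius_eq_of_mul
  · rw [factor_wMat]; simp
  · ext i j; fin_cases i <;> fin_cases j <;> simp [blkA, blkB, blkC, blkD, wMat]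

theorem moebius_invMat {t : ℂ} (z₁ z₂ w : ℂ) (ht : t ≠ 0) :
    moebius invMat !![t, z₁; z₂, w] = !![-1 / t, z₁ / t; z₂ / t, w - z₁ * z₂ / t] := by
  apply moebius_eq_of_mul
  · rwa [factor_invMat]
  · ext i j; fin_cases i <;> fin_cases j <;>
      simp [blkA, blkB, blkC, blkD, invMat] <;> field_simp <;> ring

theorem mem_HH2_mk {t z₁ z₂ w : ℂ} : !![t, z₁; z₂, w] ∈ HH2 ↔
    0 < t.im ∧ Complex.normSq (z₁ - (starRingEnd ℂ) z₂) < 4 * (t.im * w.im) := by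
  rw [mem_HH2_iff]; simp

theorem ne_zero_of_im_pos {t : ℂ} (h : 0 < t.im) : t ≠ 0 := by
  rintro rfl; simp at h

theorem mem_HH2_tr {t z₁ z₂ w : ℂ} (h : !![t, z₁; z₂, w] ∈ HH2) (p s : ℤ) (q : ℂ) :
    !![t + p, z₁ + q; z₂ + (starRingEnd ℂ) q, w + s] ∈ HH2 := by
  rw [mem_HH2_mk] at *
  simpa using h

theorem mem_HH2_lo {t z₁ z₂ w : ℂ} (h : !![t, z₁; z₂, w] ∈ HH2) (a : ℂ) :
    !![t, (starRingEnd ℂ) a * t + z₁; a * t + z₂,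
      a * (starRingEnd ℂ) a * t + (starRingEnd ℂ) a * z₂ + a * z₁ + w] ∈ HH2 := by
  rw [mem_HH2_mk] at *
  refine ⟨h.1, ?_⟩
  have := h.2
  simp [Complex.normSq_apply] at *
  nlinarith

theorem im_pos_of_mem {t z₁ z₂ w : ℂ} (h : !![t, z₁; z₂, w] ∈ HH2) : 0 < t.im ∧ 0 < w.im := by
  rw [mem_HH2_mk] at h
  refine ⟨h.1, ?_⟩
  have := Complex.normSq_nonneg (z₁ - (starRingEnd ℂ) z₂)
  by_contra hc
  nlinarith [h.1, h.2, mul_nonneg h.1.le (sub_nonneg.2 (not_lt.1 hc))]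

theorem mem_HH2_w {t z₁ z₂ w : ℂ} (h : !![t, z₁; z₂, w] ∈ HH2) : !![w, -z₂; -z₁, t] ∈ HH2 := by
  have h2 := (im_pos_of_mem h).2
  rw [mem_HH2_mk] at *
  refine ⟨h2, ?_⟩
  have := h.2
  simp [Complex.normSq_apply] at *
  nlinarith

theorem mem_HH2_inv {t z₁ z₂ w : ℂ} (h : !![t, z₁; z₂, w] ∈ HH2) :
    !![-1 / t, z₁ / t; z₂ / t, w - z₁ * z₂ / t] ∈ HH2 := by
  rw [mem_HH2_mk] at *
  have ht := ne_zero_of_im_pos h.1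
  have hn : 0 < Complex.normSq t := Complex.normSq_pos.2 ht
  have e1 : (-1 / t).im = t.im / Complex.normSq t := by
    rw [Complex.div_im]; simp; ring
  refine ⟨by rw [e1]; exact div_pos h.1 hn, ?_⟩
  rw [e1]
  have e2 : z₁ / t - (starRingEnd ℂ) (z₂ / t) =
      (z₁ * (starRingEnd ℂ) t - t * (starRingEnd ℂ) z₂) / (t * (starRingEnd ℂ) t) := by
    have : (starRingEnd ℂ) t ≠ 0 := by simpa using ht
    rw [map_div₀]; field_simp
  have e3 : (z₁ * z₂ / t).im = ((z₁ * z₂).im * t.re - (z₁ * z₂).re * t.im) / Complex.normSq t := by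
    rw [Complex.div_im]; ring
  rw [e2, map_div₀, map_mul, Complex.normSq_conj, Complex.sub_im, e3,
    show 4 * (t.im / Complex.normSq t * (w.im - ((z₁ * z₂).im * t.re - (z₁ * z₂).re * t.im) /
      Complex.normSq t)) = (4 * (t.im * (w.im * Complex.normSq t -
      ((z₁ * z₂).im * t.re - (z₁ * z₂).re * t.im)))) / (Complex.normSq t * Complex.normSq t) by
      field_simp]
  apply div_lt_div_of_pos_right _ (by positivity)
  have := mul_lt_mul_of_pos_right h.2 hn
  simp [Complex.normSq_apply] at *
  nlinarith

theorem isHMF_of_laws {F : Matrix (Fin 2) (Fin 2) ℂ → ℂ} {k : ℕ} (hF : DifferentiableOn ℂ F HH2)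
    (htr : ∀ p s : ℤ, ∀ q ∈ OK11, ∀ t z₁ z₂ w, !![t, z₁; z₂, w] ∈ HH2 →
      F !![t + p, z₁ + q; z₂ + (starRingEnd ℂ) q, w + s] = F !![t, z₁; z₂, w])
    (hlo : ∀ a ∈ OK11, ∀ t z₁ z₂ w, !![t, z₁; z₂, w] ∈ HH2 →
      F !![t, (starRingEnd ℂ) a * t + z₁; a * t + z₂,
        a * (starRingEnd ℂ) a * t + (starRingEnd ℂ) a * z₂ + a * z₁ + w] = F !![t, z₁; z₂, w])
    (hw : ∀ t z₁ z₂ w, !![t, z₁; z₂, w] ∈ HH2 → F !![w, -z₂; -z₁, t] = F !![t, z₁; z₂, w])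
    (hinv : ∀ t z₁ z₂ w, !![t, z₁; z₂, w] ∈ HH2 →
      F !![-1 / t, z₁ / t; z₂ / t, w - z₁ * z₂ / t] = t ^ k * F !![t, z₁; z₂, w]) :
    IsHMF 11 k F := by
  have key : ∀ M ∈ genMon, Transforms F k M := by
    intro M hM
    induction hM using Submonoid.closure_induction with
    | one =>
      intro Z hZ
      have hC : blkC 1 = 0 := by ext i j; fin_cases i <;> fin_cases j <;> simp [blkC]
      have hB : blkB 1 = 0 := by ext i j; fin_cases i <;> fin_cases j <;> simp [blkB]
      have hD : blkD 1 = 1 := by ext i j; fin_cases i <;> fin_cases j <;> simp [blkD]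
      have hA : blkA 1 = 1 := by ext i j; fin_cases i <;> fin_cases j <;> simp [blkA]
      simp [moebius, hC, hD, hA, hB, hZ]
    | mul x y _ _ hx hy => exact hx.mul hy
    | mem x hx =>
      intro Z hZ
      obtain ⟨t, z₁, z₂, w, rfl⟩ := eta_two Z
      cases hx with
      | tr p s q hq =>
        rw [moebius_trMat, factor_trMat, htr p s q hq _ _ _ _ hZ]
        exact ⟨one_ne_zero, mem_HH2_tr hZ p s q, by simp⟩
      | lo a ha =>
        rw [moebius_loMat, factor_loMat, hlo a ha _ _ _ _ hZ]
        exact ⟨one_ne_zero, mem_HH2_lo hZ a, by simp⟩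
      | w =>
        rw [moebius_wMat, factor_wMat, hw _ _ _ _ hZ]
        exact ⟨one_ne_zero, mem_HH2_w hZ, by simp⟩
      | inv =>
        have ht := ne_zero_of_im_pos (im_pos_of_mem hZ).1
        rw [moebius_invMat _ _ _ ht, factor_invMat, hinv _ _ _ _ hZ]
        exact ⟨ht, mem_HH2_inv hZ, rfl⟩
  exact ⟨hF, fun M hM Z hZ => (key M (mem_genMon hM) Z hZ).2.2⟩

section laws
variable {F : Matrix (Fin 2) (Fin 2) ℂ → ℂ} {k : ℕ} (hF : IsHMF 11 k F) {t z₁ z₂ w : ℂ}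
  (hZ : !![t, z₁; z₂, w] ∈ HH2)
include hF hZ

theorem IsHMF.tr (p s : ℤ) {q : ℂ} (hq : q ∈ OK11) :
    F !![t + p, z₁ + q; z₂ + (starRingEnd ℂ) q, w + s] = F !![t, z₁; z₂, w] := by
  have := hF.2 _ (IsGen.tr p s q hq).inSU _ hZ
  rwa [moebius_trMat, factor_trMat, one_pow, one_mul] at this

theorem IsHMF.lo {a : ℂ} (ha : a ∈ OK11) :
    F !![t, (starRingEnd ℂ) a * t + z₁; a * t + z₂,
      a * (starRingEnd ℂ) a * t + (starRingEnd ℂ) a * z₂ + a * z₁ + w] = F !![t, z₁; z₂, w] := by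
  have := hF.2 _ (IsGen.lo a ha).inSU _ hZ
  rwa [moebius_loMat, factor_loMat, one_pow, one_mul] at this

theorem IsHMF.weyl : F !![w, -z₂; -z₁, t] = F !![t, z₁; z₂, w] := by
  have := hF.2 _ IsGen.w.inSU _ hZ
  rwa [moebius_wMat, factor_wMat, one_pow, one_mul] at this

theorem IsHMF.inv :
    F !![-1 / t, z₁ / t; z₂ / t, w - z₁ * z₂ / t] = t ^ k * F !![t, z₁; z₂, w] := by
  have := hF.2 _ IsGen.inv.inSU _ hZ
  rwa [moebius_invMat _ _ _ (ne_zero_of_im_pos (im_pos_of_mem hZ).1), factor_invMat] at this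

end laws

/-- The normalized exponential `exp (2πi x)`. -/
def ee (x : ℂ) : ℂ := Complex.exp (2 * Real.pi * Complex.I * x)

theorem ee_add (x y : ℂ) : ee (x + y) = ee x * ee y := by
  rw [ee, mul_add, Complex.exp_add]; rfl

theorem ee_zero : ee 0 = 1 := by simp [ee]

theorem ee_int (n : ℤ) : ee n = 1 := by
  rw [ee, Complex.exp_eq_one_iff]; exact ⟨n, by ring⟩

theorem ee_one : ee 1 = 1 := by simpa using ee_int 1

theorem ee_ne_zero (x : ℂ) : ee x ≠ 0 := Complex.exp_ne_zero _

theorem ee_mul_ee_neg (x : ℂ) : ee x * ee (-x) = 1 := by rw [← ee_add, add_neg_cancel, ee_zero]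

theorem norm_ee (x : ℂ) : ‖ee x‖ = Real.exp (-(2 * Real.pi * x.im)) := by
  rw [ee, Complex.norm_exp]; simp

theorem ee_neg (x : ℂ) : ee (-x) = (ee x)⁻¹ := by
  exact eq_inv_of_mul_eq_one_right (ee_mul_ee_neg x)

theorem ee_add_int (x : ℂ) (n : ℤ) : ee (x + n) = ee x := by rw [ee_add, ee_int, mul_one]

theorem differentiable_ee : Differentiable ℂ ee := by unfold ee; fun_prop

theorem continuous_ee : Continuous ee := differentiable_ee.continuous

theorem ee_nat_mul (n : ℕ) (x : ℂ) : ee (n * x) = ee x ^ n := by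
  rw [ee, ee, ← Complex.exp_nat_mul]; congr 1; ring

section oneVariable

theorem exists_int_shift (W : ℂ) : ∃ n : ℤ, (W + n).re ∈ Set.Icc (0 : ℝ) 1 :=
  ⟨-⌊W.re⌋, by
    have h1 := Int.floor_le W.re
    have h2 := (Int.lt_floor_add_one W.re).le
    simp only [Complex.add_re, Complex.intCast_re, Int.cast_neg, Complex.neg_re, Set.mem_Icc]
    constructor <;> linarith⟩

theorem periodic_int {h : ℂ → ℂ} {S : Set ℝ} (hp : ∀ W : ℂ, W.im ∈ S → h (W + 1) = h W) (n : ℤ)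
    (W : ℂ) (hW : W.im ∈ S) : h (W + n) = h W := by
  induction n using Int.induction_on with
  | zero => simp
  | succ i ih =>
    have h1 := hp (W + (i : ℤ)) (by simpa using hW)
    rw [← ih, ← h1]; push_cast; ring_nf
  | pred i ih =>
    rw [← ih, ← hp _ (by simpa using hW)]; push_cast; ring_nf

/-- The compact rectangle of complex numbers with real part in `[0,1]` and imaginary part in
`[a,b]`. -/
theorem isCompact_rect (a b : ℝ) :
    IsCompact {W : ℂ | W.re ∈ Set.Icc (0 : ℝ) 1 ∧ W.im ∈ Set.Icc a b} :=
  (isCompact_Icc.reProdIm isCompact_Icc : IsCompact (Set.Icc (0 : ℝ) 1 ×ℂ Set.Icc a b))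

theorem bounded_on_strip {h : ℂ → ℂ} {a b : ℝ} (hc : ContinuousOn h {W | W.im ∈ Set.Icc a b})
    (hp : ∀ W : ℂ, W.im ∈ Set.Icc a b → h (W + 1) = h W) :
    ∃ C, ∀ W : ℂ, W.im ∈ Set.Icc a b → ‖h W‖ ≤ C := by
  obtain ⟨C, hC⟩ := (isCompact_rect a b).exists_bound_of_continuousOn
    (hc.mono fun W hW => hW.2)
  refine ⟨C, fun W hW => ?_⟩
  obtain ⟨n, hn⟩ := exists_int_shift W
  rw [← periodic_int hp n W hW]
  exact hC _ ⟨hn, by simpa using hW⟩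

theorem isOpen_im_gt (a : ℝ) : IsOpen {W : ℂ | a < W.im} :=
  isOpen_Ioi.preimage Complex.continuous_im

theorem strip_max {h : ℂ → ℂ} {a' a b b' C : ℝ} (ha : a' < a) (hb : b < b')
    (hd : DifferentiableOn ℂ h {W | W.im ∈ Set.Ioo a' b'})
    (hp : ∀ W : ℂ, W.im ∈ Set.Ioo a' b' → h (W + 1) = h W)
    (h1 : ∀ W : ℂ, W.im = a → ‖h W‖ ≤ C) (h2 : ∀ W : ℂ, W.im = b → ‖h W‖ ≤ C)
    {W : ℂ} (hW : W.im ∈ Set.Icc a b) : ‖h W‖ ≤ C := by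
  rcases eq_or_lt_of_le (hW.1.trans hW.2) with hab | hab
  · exact h1 W (le_antisymm (by linarith [hW.2]) hW.1)
  have hsub : {W : ℂ | W.im ∈ Set.Icc a b} ⊆ {W | W.im ∈ Set.Ioo a' b'} :=
    fun W hW => ⟨ha.trans_le hW.1, hW.2.trans_lt hb⟩
  obtain ⟨M, hM⟩ := bounded_on_strip (hd.continuousOn.mono hsub) (fun W hW => hp W (hsub hW))
  refine PhragmenLindelof.horizontal_strip (a := a) (b := b) ?_ ?_ h1 h2 hW.1 hW.2
  · refine DifferentiableOn.diffContOnCl (hd.mono ?_)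
    refine subset_trans ?_ hsub
    refine closure_minimal (fun W hW => ⟨hW.1.le, hW.2.le⟩)
      (isClosed_Icc.preimage Complex.continuous_im)
  · refine ⟨0, by have := Real.pi_pos; exact div_pos this (by linarith), 0, ?_⟩
    refine Asymptotics.IsBigO.of_bound M ?_
    refine eventually_inf_principal.2 (Eventually.of_forall fun W hW => ?_)
    simpa using hM W ⟨hW.1.le, hW.2.le⟩

theorem halfPlane_max {h : ℂ → ℂ} {a b C : ℝ} (hab : a < b)
    (hd : DifferentiableOn ℂ h {W | a < W.im})
    (hp : ∀ W : ℂ, a < W.im → h (W + 1) = h W)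
    (hbd : ∃ C' B, ∀ W : ℂ, B ≤ W.im → ‖h W‖ ≤ C')
    (h1 : ∀ W : ℂ, W.im = b → ‖h W‖ ≤ C) {W : ℂ} (hW : b ≤ W.im) : ‖h W‖ ≤ C := by
  obtain ⟨C', B, hB⟩ := hbd
  have hsub : {W : ℂ | W.im ∈ Set.Icc b B} ⊆ {W | a < W.im} := fun W hW => hab.trans_le hW.1
  obtain ⟨M, hM⟩ := bounded_on_strip (hd.continuousOn.mono hsub) (fun W hW => hp W (hsub hW))
  have hall : ∀ W : ℂ, b ≤ W.im → ‖h W‖ ≤ max M C' := by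
    intro W hW
    rcases le_total W.im B with h | h
    · exact (hM W ⟨hW, h⟩).trans (le_max_left _ _)
    · exact (hB W h).trans (le_max_right _ _)
  have him : ∀ z : ℂ, (Complex.I * z + Complex.I * b).im = z.re + b := fun z => by simp
  have key := PhragmenLindelof.right_half_plane_of_bounded_on_real (C := C)
    (f := fun z => h (Complex.I * z + Complex.I * b))
    (z := -Complex.I * W - b) ?_ ?_ ?_ ?_ ?_
  · have e : Complex.I * (-Complex.I * W - b) + Complex.I * b = W := by
      linear_combination (-W) * Complex.I_mul_I
    simpa only [e] using key
  · refine DifferentiableOn.diffContOnCl ?_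
    refine hd.comp (by fun_prop) ?_
    intro z hz
    have hs : {z : ℂ | 0 < z.re} ⊆ {z : ℂ | 0 ≤ z.re} := by
      intro z hz
      rw [Set.mem_ofPred_eq] at *
      exact hz.le
    have : z ∈ {z : ℂ | 0 ≤ z.re} := closure_minimal hs
      (isClosed_Ici.preimage Complex.continuous_re) hz
    have h0 : 0 ≤ z.re := this
    change a < _
    rw [him]; linarith
  · refine ⟨0, by norm_num, 0, Asymptotics.IsBigO.of_bound (max M C') ?_⟩
    refine eventually_inf_principal.2 (Eventually.of_forall fun z hz => ?_)
    have h0 : 0 < z.re := hz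
    simpa using hall _ (by rw [him]; linarith)
  · refine ⟨max M C', eventually_map.2 ?_⟩
    filter_upwards [eventually_ge_atTop 0] with x hx
    exact hall _ (by rw [him]; simpa using hx)
  · intro x
    exact h1 _ (by rw [him]; simp)
  · simpa using hW

open UpperHalfPlane in
theorem exists_lim {h : ℂ → ℂ} {a : ℝ} (hd : DifferentiableOn ℂ h {W | a < W.im})
    (hp : ∀ W : ℂ, a < W.im → h (W + 1) = h W)
    (hbd : ∃ C' B, ∀ W : ℂ, B ≤ W.im → ‖h W‖ ≤ C') :
    ∃ l, Tendsto h (comap Complex.im atTop) (𝓝 l) ∧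
      (l = 0 → ∃ C' B, ∀ W : ℂ, B ≤ W.im → ‖h W * ee (-W)‖ ≤ C') := by
  obtain ⟨C', B, hB⟩ := hbd
  set g : ℂ → ℂ := fun W => if a < W.im then h W else 0 with hg
  have hev : ∀ᶠ W in comap Complex.im atTop, a < W.im :=
    (eventually_gt_atTop a).comap Complex.im
  have hgh : g =ᶠ[comap Complex.im atTop] h := by
    filter_upwards [hev] with W hW; simp [hg, hW]
  have hper : Function.Periodic g ((1 : ℝ) : ℂ) := by
    intro W
    by_cases hW : a < W.im
    · simp [hg, hW, hp W hW]
    · simp [hg, hW]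
  have hdiff : ∀ᶠ W in comap Complex.im atTop, DifferentiableAt ℂ g W := by
    filter_upwards [hev] with W hW
    have h1 : DifferentiableAt ℂ h W := hd.differentiableAt ((isOpen_im_gt a).mem_nhds hW)
    refine h1.congr_of_eventuallyEq ?_
    filter_upwards [(isOpen_im_gt a).mem_nhds hW] with V hV
    have : a < V.im := hV
    simp [hg, this]
  have hbdd : BoundedAtFilter (comap Complex.im atTop) g := by
    refine Asymptotics.IsBigO.of_bound (max C' 0) ?_
    filter_upwards [(eventually_ge_atTop B).comap Complex.im, hgh] with W hW hW'
    rw [hW']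
    simpa using Or.inl (hB W hW)
  refine ⟨_, (Function.Periodic.tendsto_at_I_inf one_pos hper hdiff hbdd).congr' hgh, fun h0 => ?_⟩
  have := Function.Periodic.exp_decay_sub_of_bounded_at_inf one_pos hper hdiff hbdd
  rw [h0] at this
  obtain ⟨C, hC⟩ := this.bound
  have hC := hC.and hev
  rw [eventually_comap] at hC
  obtain ⟨B', hB'⟩ := eventually_atTop.1 hC
  refine ⟨C, B', fun W hW => ?_⟩
  obtain ⟨h1, h2⟩ := hB' _ hW W rfl
  simp only [hg, h2, if_true, sub_zero, div_one, Real.norm_eq_abs, Real.abs_exp] at h1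
  rw [norm_mul, norm_ee]
  calc ‖h W‖ * Real.exp (-(2 * Real.pi * (-W).im))
      ≤ (C * Real.exp (-2 * Real.pi * W.im)) * Real.exp (-(2 * Real.pi * (-W).im)) := by gcongr
    _ = C := by rw [mul_assoc, ← Real.exp_add]; simp

/-- A pointwise limit of locally bounded holomorphic functions is holomorphic. -/
theorem differentiableOn_of_tendsto {F : ℕ → ℂ → ℂ} {g : ℂ → ℂ} {U : Set ℂ} (hU : IsOpen U)
    (hF : ∀ n, DifferentiableOn ℂ (F n) U) (hlim : ∀ z ∈ U, Tendsto (fun n => F n z) atTop (𝓝 (g z)))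
    (hbd : ∀ K ⊆ U, IsCompact K → ∃ C, ∀ n, ∀ z ∈ K, ‖F n z‖ ≤ C) : DifferentiableOn ℂ g U := by
  intro c hc
  obtain ⟨R, hR, hsub⟩ := Metric.nhds_basis_closedBall.mem_iff.1 (hU.mem_nhds hc)
  obtain ⟨C, hC⟩ := hbd _ hsub (isCompact_closedBall c R)
  have hsph : ∀ θ : ℝ, circleMap c R θ ∈ Metric.closedBall c R :=
    fun θ => circleMap_mem_closedBall c hR.le θ
  have hmeas : Measurable fun θ : ℝ => g (circleMap c R θ) := by
    refine measurable_of_tendsto_metrizable (f := fun n θ => F n (circleMap c R θ)) (fun n => ?_)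
      (tendsto_pi_nhds.2 fun θ => hlim _ (hsub (hsph θ)))
    refine Continuous.measurable ?_
    exact ((hF n).continuousOn.mono hsub).comp_continuous (continuous_circleMap c R) hsph
  have hgb : ∀ z ∈ Metric.closedBall c R, ‖g z‖ ≤ C := fun z hz =>
    le_of_tendsto (hlim z (hsub hz)).norm (Eventually.of_forall fun n => hC n z hz)
  have hint : CircleIntegrable g c R := by
    refine ⟨?_, ?_⟩ <;>
    · refine MeasureTheory.Measure.integrableOn_of_bounded (M := C) measure_Ioc_lt_top.ne
        hmeas.aestronglyMeasurable (Eventually.of_forall fun θ => hgb _ (hsph θ))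
  lift R to NNReal using hR.le
  have hps := hasFPowerSeriesOn_cauchy_integral hint (by exact_mod_cast hR)
  have han : DifferentiableAt ℂ
      (fun w => (2 * Real.pi * Complex.I : ℂ)⁻¹ • ∮ z in C(c, R), (z - w)⁻¹ • g z) c :=
    hps.hasFPowerSeriesAt.analyticAt.differentiableAt
  refine (han.congr_of_eventuallyEq ?_).differentiableWithinAt
  have hR' : (0 : ℝ) < R := hR
  filter_upwards [Metric.ball_mem_nhds c hR'] with w hw
  have h1 : ∀ n, (2 * Real.pi * Complex.I : ℂ)⁻¹ • ∮ z in C(c, R), (z - w)⁻¹ • F n z = F n w :=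
    fun n => DiffContOnCl.two_pi_i_inv_smul_circleIntegral_sub_inv_smul
      (DifferentiableOn.diffContOnCl ((hF n).mono (Metric.closure_ball_subset_closedBall.trans hsub))) hw
  refine tendsto_nhds_unique (hlim w (hsub (Metric.ball_subset_closedBall hw))) ?_
  simp_rw [← h1]
  refine Tendsto.const_smul ?_ _
  unfold circleIntegral
  have hdist : 0 < (R : ℝ) - dist w c := sub_pos.2 hw
  have hlow : ∀ θ, (R : ℝ) - dist w c ≤ ‖circleMap c R θ - w‖ := fun θ => by
    have h3 : ‖circleMap c R θ - c‖ = R := by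
      rw [circleMap_sub_center, norm_circleMap_zero, abs_of_pos hR']
    have h4 : ‖circleMap c R θ - c‖ ≤ ‖circleMap c R θ - w‖ + ‖w - c‖ :=
      norm_sub_le_norm_sub_add_norm_sub _ _ _
    rw [dist_eq_norm]; linarith
  refine intervalIntegral.tendsto_integral_filter_of_dominated_convergence
    (fun _ => R * (((R : ℝ) - dist w c)⁻¹ * C)) ?_ ?_ ?_ ?_
  · refine Eventually.of_forall fun n => Continuous.aestronglyMeasurable ?_
    have e1 : Continuous (deriv (circleMap c R)) := by
      have e : deriv (circleMap c R) = fun θ => circleMap 0 R θ * Complex.I :=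
        funext fun θ => deriv_circleMap c R θ
      rw [e]; fun_prop
    have e2 : Continuous fun θ => (circleMap c R θ - w)⁻¹ := by
      refine Continuous.inv₀ (by fun_prop) fun θ h0 => ?_
      have := hlow θ
      rw [h0, norm_zero] at this; linarith
    have e3 : Continuous fun θ => F n (circleMap c R θ) :=
      ((hF n).continuousOn.mono hsub).comp_continuous (continuous_circleMap c R) hsph
    exact e1.smul (e2.smul e3)
  · refine Eventually.of_forall fun n => Eventually.of_forall fun θ _ => ?_
    rw [norm_smul, norm_smul, norm_inv]
    have e : ‖deriv (circleMap c R) θ‖ = R := by simp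
    rw [e]
    gcongr
    · exact hlow θ
    · exact hC n _ (hsph θ)
  · simp
  · refine Eventually.of_forall fun θ _ => ?_
    exact ((hlim _ (hsub (hsph θ))).const_smul _).const_smul _

end oneVariable

section thetaProduct

/-- The Euler-type product `∏ (1 - q ^ (n + 1) x)`. -/
def qprod (q x : ℂ) : ℂ := ∏' n : ℕ, (1 - q ^ (n + 1) * x)

theorem summable_qpow {q : ℂ} (hq : ‖q‖ < 1) (x : ℂ) :
    Summable fun n : ℕ => ‖-(q ^ (n + 1) * x)‖ := by
  simp only [norm_neg, norm_mul, norm_pow]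
  exact ((summable_nat_add_iff 1).2 (summable_geometric_of_lt_one (norm_nonneg _) hq)).mul_right _

theorem multipliable_qprod {q : ℂ} (hq : ‖q‖ < 1) (x : ℂ) :
    Multipliable fun n : ℕ => 1 - q ^ (n + 1) * x := by
  simpa [sub_eq_add_neg] using multipliable_one_add_of_summable (summable_qpow hq x)

theorem qprod_eq_mul {q : ℂ} (hq : ‖q‖ < 1) (x : ℂ) :
    qprod q x = (1 - q * x) * qprod q (q * x) := by
  have h := (multipliable_qprod hq (q * x))
  have e : (fun n : ℕ => 1 - q ^ (n + 1) * (q * x)) = fun n : ℕ => 1 - q ^ (n + 1 + 1) * x := by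
    funext n; ring
  rw [qprod, tprod_eq_zero_mul' (by rwa [e] at h), qprod, e]; simp

theorem differentiable_qprod {q : ℂ} (hq : ‖q‖ < 1) : Differentiable ℂ (qprod q) := by
  rw [← differentiableOn_univ]
  have h : HasProdLocallyUniformlyOn (fun (n : ℕ) x => 1 + -(q ^ (n + 1) * x)) 
      (fun x => ∏' n : ℕ, (1 + -(q ^ (n + 1) * x))) Set.univ := by
    refine hasProdLocallyUniformlyOn_of_forall_compact isOpen_univ fun K _ hK => ?_
    obtain ⟨C, hC⟩ := hK.isBounded.exists_norm_le
    refine (((summable_nat_add_iff 1).2 (summable_geometric_of_lt_one (norm_nonneg _)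
      hq)).mul_right C).hasProdUniformlyOn_nat_one_add hK (.of_forall fun n x hx => ?_)
      (fun n => by fun_prop)
    rw [norm_neg, norm_mul, norm_pow]
    gcongr
    exact hC x hx
  have := h.differentiableOn (.of_forall fun s => by
    simpa [Finset.prod_fn] using DifferentiableOn.finsetProd (fun _ _ => by fun_prop)) isOpen_univ
  refine this.congr fun x _ => ?_
  simp only [qprod, sub_eq_add_neg]

theorem exists_of_qprod_eq_zero {q : ℂ} (hq : ‖q‖ < 1) {x : ℂ} (h : qprod q x = 0) :
    ∃ n : ℕ, q ^ (n + 1) * x = 1 := by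
  by_contra! hn
  refine tprod_one_add_ne_zero_of_summable (f := fun n : ℕ => -(q ^ (n + 1) * x)) (fun i => ?_)
    (summable_qpow hq x) (by simpa [qprod, sub_eq_add_neg] using h)
  rw [← sub_eq_add_neg, sub_ne_zero]
  exact (hn i).symm

theorem norm_ee_lt_one {τ : ℂ} (hτ : 0 < τ.im) : ‖ee τ‖ < 1 := by
  rw [norm_ee, Real.exp_lt_one_iff]; have := Real.pi_pos; simp; positivity

theorem ee_eq_one {x : ℂ} (h : ee x = 1) : ∃ n : ℤ, x = n := by
  obtain ⟨n, hn⟩ := Complex.exp_eq_one_iff.1 h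
  refine ⟨n, mul_left_cancel₀ Complex.two_pi_I_ne_zero ?_⟩
  rw [hn]; ring

/-- A theta function of `z` vanishing exactly at the lattice `ℤ + ℤτ`. -/
def thetaProd (τ z : ℂ) : ℂ := (1 - ee z) * qprod (ee τ) (ee z) * qprod (ee τ) (ee (-z))

variable {τ : ℂ}

theorem thetaProd_add_one (z : ℂ) : thetaProd τ (z + 1) = thetaProd τ z := by
  have h1 : ee (z + 1) = ee z := by rw [ee_add, ee_one, mul_one]
  have h2 : ee (-(z + 1)) = ee (-z) := by rw [ee_neg, ee_neg, h1]
  rw [thetaProd, thetaProd, h1, h2]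

theorem thetaProd_add_self (hτ : 0 < τ.im) (z : ℂ) :
    thetaProd τ (z + τ) = -ee (-z) * thetaProd τ z := by
  have hq := norm_ee_lt_one hτ
  have h1 : ee (z + τ) = ee τ * ee z := by rw [ee_add, mul_comm]
  have h2 : ee (-z) = ee τ * ee (-(z + τ)) := by rw [← ee_add]; congr 1; ring
  have h3 := qprod_eq_mul hq (ee z)
  have h4 := qprod_eq_mul hq (ee (-(z + τ)))
  have h5 := ee_mul_ee_neg z
  rw [← h1] at h3
  rw [← h2] at h4
  rw [thetaProd, thetaProd, h4, h3]
  linear_combination (-(1 - ee (z + τ)) * qprod (ee τ) (ee (z + τ)) * qprod (ee τ) (ee (-z))) * h5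

theorem differentiable_thetaProd (hτ : 0 < τ.im) : Differentiable ℂ (thetaProd τ) := by
  have h1 := differentiable_qprod (norm_ee_lt_one hτ)
  have h2 := differentiable_ee
  unfold thetaProd
  exact ((h2.const_sub 1).mul (h1.comp h2)).mul (h1.comp (h2.comp differentiable_neg))

theorem exists_of_thetaProd_eq_zero (hτ : 0 < τ.im) {z : ℂ} (h : thetaProd τ z = 0) :
    ∃ m n : ℤ, z = m + n * τ := by
  have hq := norm_ee_lt_one hτ
  rcases mul_eq_zero.1 h with h | h
  · rcases mul_eq_zero.1 h with h | h
    · obtain ⟨n, hn⟩ := ee_eq_one (sub_eq_zero.1 h).symm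
      exact ⟨n, 0, by simpa using hn⟩
    · obtain ⟨n, hn⟩ := exists_of_qprod_eq_zero hq h
      rw [← ee_nat_mul, ← ee_add] at hn
      obtain ⟨k, hk⟩ := ee_eq_one hn
      exact ⟨k, -(n + 1), by push_cast at hk ⊢; linear_combination hk⟩
  · obtain ⟨n, hn⟩ := exists_of_qprod_eq_zero hq h
    rw [← ee_nat_mul, ← ee_add] at hn
    obtain ⟨k, hk⟩ := ee_eq_one hn
    exact ⟨-k, n + 1, by push_cast at hk ⊢; linear_combination -hk⟩

theorem qprod_one_ne_zero (hτ : 0 < τ.im) : qprod (ee τ) 1 ≠ 0 := by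
  intro h
  obtain ⟨n, hn⟩ := exists_of_qprod_eq_zero (norm_ee_lt_one hτ) h
  rw [mul_one] at hn
  have h1 : ‖ee τ ^ (n + 1)‖ < 1 := by
    rw [norm_pow]; exact pow_lt_one₀ (norm_nonneg _) (norm_ee_lt_one hτ) (by simp)
  rw [hn] at h1; simp at h1

theorem tendsto_thetaProd_div (hτ : 0 < τ.im) :
    ∃ c ≠ 0, Tendsto (fun z => thetaProd τ z / z) (𝓝[≠] 0) (𝓝 c) := by
  have h1 : HasDerivAt ee (2 * Real.pi * Complex.I) 0 := by
    have h := ((hasDerivAt_id (0 : ℂ)).const_mul (2 * Real.pi * Complex.I)).cexp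
    simp only [id, mul_zero, Complex.exp_zero, mul_one, one_mul] at h
    exact h
  have hP := differentiable_qprod (norm_ee_lt_one hτ)
  set R : ℂ → ℂ := fun z => qprod (ee τ) (ee z) * qprod (ee τ) (ee (-z)) with hR
  have hRd : Continuous R := by
    have h2 := continuous_ee
    have h3 := hP.continuous
    rw [hR]; fun_prop
  refine ⟨-(2 * Real.pi * Complex.I) * R 0, mul_ne_zero (neg_ne_zero.2 Complex.two_pi_I_ne_zero) ?_, ?_⟩
  · have := qprod_one_ne_zero hτ
    simp [hR, ee_zero, this]
  have h2 := (hasDerivAt_iff_tendsto_slope.1 h1).neg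
  refine (h2.mul (hRd.continuousAt.tendsto.mono_left nhdsWithin_le_nhds)).congr' ?_
  filter_upwards [self_mem_nhdsWithin] with z hz
  have hz : z ≠ 0 := hz
  simp only [slope_def_field, ee_zero, hR, thetaProd]
  field_simp
  ring

end thetaProduct

section zeroBound

variable {τ : ℂ}

theorem periodic_lattice {h : ℂ → ℂ} (h1 : ∀ z, h (z + 1) = h z) (h2 : ∀ z, h (z + τ) = h z)
    (m n : ℤ) (z : ℂ) : h (z + (m + n * τ)) = h z := by
  have e1 : Function.Periodic h (m * 1 : ℂ) := Function.Periodic.int_mul (f := h) h1 m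
  have e2 : Function.Periodic h (n * τ : ℂ) := Function.Periodic.int_mul (f := h) h2 n
  rw [← add_assoc, e2, ← mul_one (m : ℂ), e1]

theorem eq_of_doublyPeriodic (hτ : 0 < τ.im) {h : ℂ → ℂ} (hd : Differentiable ℂ h)
    (h1 : ∀ z, h (z + 1) = h z) (h2 : ∀ z, h (z + τ) = h z) (z w : ℂ) : h z = h w := by
  refine hd.apply_eq_apply_of_bounded ?_ z w
  have hK : IsCompact ((fun p : ℝ × ℝ => h (p.1 + p.2 * τ)) '' (Set.Icc 0 1 ×ˢ Set.Icc 0 1)) := by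
    refine (isCompact_Icc.prod isCompact_Icc).image ?_
    have := hd.continuous
    fun_prop
  refine hK.isBounded.subset ?_
  rintro _ ⟨z, rfl⟩
  set y := z.im / τ.im
  set x := (z - y * τ).re
  have hz : z = x + y * τ := by
    have : y * τ.im = z.im := div_mul_cancel₀ _ hτ.ne'
    apply Complex.ext <;> simp [x, this]
  refine ⟨(Int.fract x, Int.fract y), ⟨⟨Int.fract_nonneg _, (Int.fract_lt_one _).le⟩,
    ⟨Int.fract_nonneg _, (Int.fract_lt_one _).le⟩⟩, ?_⟩
  simp only
  rw [← periodic_lattice h1 h2 ⌊x⌋ ⌊y⌋]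
  congr 1
  conv_rhs => rw [hz]
  have ex : ((⌊x⌋ : ℂ)) + (Int.fract x : ℝ) = x := by exact_mod_cast Int.floor_add_fract x
  have ey : ((⌊y⌋ : ℂ)) + (Int.fract y : ℝ) = y := by exact_mod_cast Int.floor_add_fract y
  rw [← ex, ← ey]; ring

theorem theta_eq_zero (hτ : 0 < τ.im) {φ : ℂ → ℂ} {N a : ℕ} (hd : Differentiable ℂ φ)
    (h1 : ∀ z, φ (z + 1) = φ z) (h2 : ∀ z, φ (z + τ) = ee (-(2 * N * z + a * τ)) * φ z)
    (h0 : Tendsto (fun z => φ z / z ^ (2 * N)) (𝓝[≠] 0) (𝓝 0)) (z : ℂ) : φ z = 0 := by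
  obtain ⟨c, hc, hT⟩ := tendsto_thetaProd_div hτ
  have hTd := differentiable_thetaProd hτ
  set h : ℂ → ℂ := fun z => φ z / thetaProd τ z ^ (2 * N) * ee (a * z) with hh
  have hφ0 : φ 0 = 0 := by
    have e1 : Tendsto φ (𝓝[≠] 0) (𝓝 (φ 0)) :=
      hd.continuous.continuousAt.tendsto.mono_left nhdsWithin_le_nhds
    have e2 : Tendsto (fun z : ℂ => z ^ (2 * N)) (𝓝[≠] 0) (𝓝 (0 ^ (2 * N))) :=
      ((continuous_pow (2 * N)).continuousAt (x := (0:ℂ))).tendsto.mono_left nhdsWithin_le_nhds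
    refine tendsto_nhds_unique e1 ?_
    have := h0.mul e2
    rw [zero_mul] at this
    refine this.congr' ?_
    filter_upwards [self_mem_nhdsWithin] with z hz
    have hz : z ≠ 0 := hz
    field_simp
  have hp1 : ∀ z, h (z + 1) = h z := fun z => by
    have : ee (a * (z + 1)) = ee (a * z) := by
      rw [mul_add, mul_one]; exact_mod_cast ee_add_int (a * z) a
    simp only [hh, h1, thetaProd_add_one, this]
  have hp2 : ∀ z, h (z + τ) = h z := fun z => by
    have e1 : ee (-(2 * N * z + a * τ)) = ee (-z) ^ (2 * N) * ee (-(a * τ)) := by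
      rw [← ee_nat_mul, ← ee_add]; congr 1; push_cast; ring
    have e2 : ee (-(a * τ)) * ee (a * (z + τ)) = ee (a * z) := by
      rw [← ee_add]; congr 1; ring
    simp only [hh, h2, thetaProd_add_self hτ, mul_pow, Even.neg_pow (even_two_mul N), e1]
    rw [← e2, mul_assoc (_ ^ _), mul_div_mul_left _ _ (pow_ne_zero _ (ee_ne_zero _))]
    ring
  have hcont : Tendsto h (𝓝[≠] 0) (𝓝 0) := by
    have e1 : Tendsto (fun z => ee (a * z)) (𝓝[≠] 0) (𝓝 (ee (a * 0))) := by
      have := continuous_ee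
      have e : Continuous fun z : ℂ => ee (a * z) := by fun_prop
      exact e.continuousAt.tendsto.mono_left nhdsWithin_le_nhds
    have := (h0.div (hT.pow (2 * N)) (pow_ne_zero _ hc)).mul e1
    rw [zero_div, zero_mul] at this
    refine this.congr' ?_
    filter_upwards [self_mem_nhdsWithin] with z hz
    have hz : z ≠ 0 := hz
    simp only [Pi.div_apply, hh, div_pow]
    rw [div_div_div_cancel_right₀ (pow_ne_zero _ hz)]
  have hoff : ∀ z, thetaProd τ z ≠ 0 → DifferentiableAt ℂ h z := fun z hz =>
    ((hd z).div ((hTd z).pow _) (pow_ne_zero _ hz)).mul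
      ((differentiable_ee _).comp z (by fun_prop))
  have hne : ∀ᶠ z in 𝓝[≠] (0 : ℂ), thetaProd τ z ≠ 0 := by
    filter_upwards [hT.eventually_ne hc] with z hz h0
    simp [h0] at hz
  have hh0 : h 0 = 0 := by simp [hh, hφ0]
  have hat0 : DifferentiableAt ℂ h 0 := by
    refine (Complex.analyticAt_of_differentiable_on_punctured_nhds_of_continuousAt
      (hne.mono hoff) ?_).differentiableAt
    rw [continuousAt_iff_punctured_nhds, hh0]
    exact hcont
  have hdiff : Differentiable ℂ h := by
    intro z
    by_cases hz : thetaProd τ z = 0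
    · obtain ⟨m, n, rfl⟩ := exists_of_thetaProd_eq_zero hτ hz
      have e : h = fun z => h (z - (m + n * τ)) := by
        funext z
        rw [← periodic_lattice hp1 hp2 m n (z - _), sub_add_cancel]
      rw [e]
      refine DifferentiableAt.comp (g := h) (m + n * τ : ℂ) ?_ (by fun_prop)
      rwa [sub_self]
    · exact hoff z hz
  have hzero : ∀ z, h z = 0 := fun z => by rw [eq_of_doublyPeriodic hτ hdiff hp1 hp2 z 0, hh0]
  have han : AnalyticOnNhd ℂ φ Set.univ := fun z _ => hd.analyticAt z
  have hev : ∀ᶠ z in 𝓝[≠] (0 : ℂ), φ z = 0 := by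
    filter_upwards [hne] with z hz
    have := hzero z
    simpa [hh, ee_ne_zero, hz] using this
  exact congrFun (han.eq_of_frequently_eq analyticOnNhd_const hev.frequently) z

theorem mul_eq_zero_entire {f g : ℂ → ℂ} (hf : Differentiable ℂ f) (hg : Differentiable ℂ g)
    (h : ∀ z, f z * g z = 0) : (∀ z, f z = 0) ∨ ∀ z, g z = 0 := by
  have := AnalyticOnNhd.eq_zero_or_eq_zero_of_mul_eq_zero (U := Set.univ) (f := f) (g := g)
    (fun z _ => hf.analyticAt z) (fun z _ => hg.analyticAt z) (fun z _ => h z)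
    isPreconnected_univ
  simpa using this

theorem theta_odd_eq_zero (hτ : 0 < τ.im) {φ : ℂ → ℂ} {m : ℕ} (hd : Differentiable ℂ φ)
    (h1 : ∀ z, φ (z + 1) = φ z) (h2 : ∀ z, φ (z + τ) = ee (-(m * (6 * z + 3 * τ))) * φ z)
    (hodd : ∀ z, φ (-z) = -φ z) {ν : ℕ} (hν : ν + 3 = 6 * m)
    (h0 : Tendsto (fun z => φ z / z ^ ν) (𝓝[≠] 0) (𝓝 0)) (z : ℂ) : φ z = 0 := by
  have hself : ∀ x : ℂ, x = -x → x = 0 := fun x hx => by linear_combination hx / 2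
  have ha : φ (1 / 2) = 0 := hself _ (by
    rw [← hodd, ← h1 (-(1 / 2))]; norm_num)
  have hb : φ (τ / 2) = 0 := hself _ (by
    rw [← hodd]
    have := h2 (-(τ / 2))
    rw [show -(τ / 2) + τ = τ / 2 by ring, show (6 * -(τ / 2) + 3 * τ) = 0 by ring, mul_zero,
      neg_zero, ee_zero, one_mul] at this
    exact this)
  have hc : φ ((1 + τ) / 2) = 0 := hself _ (by
    rw [← hodd]
    have := h2 (-((1 + τ) / 2) + 1)
    rw [show -((1 + τ) / 2) + 1 + τ = (1 + τ) / 2 by ring, h1,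
      show -(m * (6 * (-((1 + τ) / 2) + 1) + 3 * τ)) = ((-(3 * m) : ℤ) : ℂ) by push_cast; ring,
      ee_int, one_mul] at this
    exact this)
  set G : ℂ → ℂ := fun Z => φ (Z / 2) * (φ (Z / 2 + 1 / 2) * (φ (Z / 2 + τ / 2) *
    φ (Z / 2 + (1 + τ) / 2))) with hG
  have hGd : Differentiable ℂ G := by
    have : ∀ c : ℂ, Differentiable ℂ fun Z : ℂ => φ (Z / 2 + c) := fun c =>
      hd.comp (by fun_prop)
    have h' : Differentiable ℂ fun Z : ℂ => φ (Z / 2) := hd.comp (by fun_prop)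
    exact h'.mul ((this _).mul ((this _).mul (this _)))
  have hzero := theta_eq_zero hτ (N := 3 * m) (a := 6 * m) hGd ?_ ?_ ?_
  · have hsh : ∀ c : ℂ, (∀ z, φ (z / 2 + c) = 0) → φ z = 0 := fun c hc => by
      have := hc (2 * (z - c))
      rwa [show 2 * (z - c) / 2 + c = z by ring] at this
    have hdc : ∀ c : ℂ, Differentiable ℂ fun Z : ℂ => φ (Z / 2 + c) := fun c =>
      hd.comp (by fun_prop)
    have hd0 : Differentiable ℂ fun Z : ℂ => φ (Z / 2) := hd.comp (by fun_prop)
    rcases mul_eq_zero_entire hd0 ((hdc _).mul ((hdc _).mul (hdc _))) hzero with h | h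
    · exact hsh 0 (by simpa using h)
    rcases mul_eq_zero_entire (hdc _) ((hdc _).mul (hdc _)) h with h | h
    · exact hsh _ h
    rcases mul_eq_zero_entire (hdc _) (hdc _) h with h | h
    · exact hsh _ h
    · exact hsh _ h
  · intro Z
    have e1 : φ ((Z + 1) / 2) = φ (Z / 2 + 1 / 2) := by congr 1; ring
    have e2 : φ ((Z + 1) / 2 + 1 / 2) = φ (Z / 2) := by rw [← h1 (Z / 2)]; congr 1; ring
    have e3 : φ ((Z + 1) / 2 + τ / 2) = φ (Z / 2 + (1 + τ) / 2) := by congr 1; ring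
    have e4 : φ ((Z + 1) / 2 + (1 + τ) / 2) = φ (Z / 2 + τ / 2) := by
      rw [← h1 (Z / 2 + τ / 2)]; congr 1; ring
    simp only [hG, e1, e2, e3, e4]; ring
  · intro Z
    have e1 : φ ((Z + τ) / 2) = φ (Z / 2 + τ / 2) := by congr 1; ring
    have e2 : φ ((Z + τ) / 2 + 1 / 2) = φ (Z / 2 + (1 + τ) / 2) := by congr 1; ring
    have e3 : φ ((Z + τ) / 2 + τ / 2) = ee (-(m * (6 * (Z / 2) + 3 * τ))) * φ (Z / 2) := by
      rw [← h2]; congr 1; ring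
    have e4 : φ ((Z + τ) / 2 + (1 + τ) / 2) =
        ee (-(m * (6 * (Z / 2 + 1 / 2) + 3 * τ))) * φ (Z / 2 + 1 / 2) := by
      rw [← h2]; congr 1; ring
    have e5 : ee (-(2 * (3 * m : ℕ) * Z + (6 * m : ℕ) * τ)) =
        ee (-(m * (6 * (Z / 2) + 3 * τ))) * ee (-(m * (6 * (Z / 2 + 1 / 2) + 3 * τ))) := by
      rw [← ee_add, ← ee_add_int _ (-(3 * m))]; congr 1; push_cast; ring
    simp only [hG, e1, e2, e3, e4, e5]; ring
  · have hhalf : Tendsto (fun Z : ℂ => Z / 2) (𝓝[≠] 0) (𝓝[≠] 0) := by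
      refine tendsto_nhdsWithin_iff.2 ⟨?_, ?_⟩
      · have : Continuous fun Z : ℂ => Z / 2 := by fun_prop
        have := (this.continuousAt (x := 0)).tendsto
        rw [zero_div] at this
        exact this.mono_left nhdsWithin_le_nhds
      · filter_upwards [self_mem_nhdsWithin] with Z hZ
        have hZ : Z ≠ 0 := hZ
        simp [hZ]
    have hsl : ∀ c, φ c = 0 → Tendsto (fun Z => φ (Z / 2 + c) / (Z / 2)) (𝓝[≠] 0)
        (𝓝 (deriv φ c)) := fun c hc => by
      have e := hasDerivAt_iff_tendsto_slope_zero.1 (hd c).hasDerivAt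
      refine (e.comp hhalf).congr fun Z => ?_
      simp only [Function.comp, hc, sub_zero, smul_eq_mul, add_comm c]
      rw [div_eq_inv_mul _ (Z / 2)]
    have := (h0.comp hhalf).mul ((hsl _ ha).mul ((hsl _ hb).mul (hsl _ hc)))
    rw [zero_mul] at this
    have := this.mul_const ((1 / 2 : ℂ) ^ (6 * m))
    rw [zero_mul] at this
    refine this.congr' ?_
    filter_upwards [self_mem_nhdsWithin] with Z hZ
    have hZ : Z ≠ 0 := hZ
    simp only [hG, Function.comp]
    rw [show 2 * (3 * m) = ν + 3 by omega, ← hν, div_pow Z, div_pow 1, pow_add Z, pow_add 2]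
    generalize φ (Z / 2 + 1 / 2) = A
    generalize φ (Z / 2 + τ / 2) = B
    generalize φ (Z / 2 + (1 + τ) / 2) = C
    field_simp
    ring
    
end zeroBound

/-- The Siegel-type domain on which restrictions to the Heegner divisor live. -/
def Dom (τ z W : ℂ) : Prop := 0 < τ.im ∧ 3 * z.im ^ 2 < τ.im * W.im

/-- The functional equations satisfied by restrictions of symmetric Hermitian modular forms
of weight `k`. -/
structure Laws (k : ℕ) (f : ℂ → ℂ → ℂ → ℂ) : Prop where
  hol : DifferentiableOn ℂ (fun p : ℂ × ℂ × ℂ => f p.1 p.2.1 p.2.2) {p | Dom p.1 p.2.1 p.2.2}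
  pert : ∀ τ z W, Dom τ z W → f (τ + 1) z W = f τ z W
  perz : ∀ τ z W, Dom τ z W → f τ (z + 1) W = f τ z W
  perw : ∀ τ z W, Dom τ z W → f τ z (W + 1) = f τ z W
  jac : ∀ τ z W, Dom τ z W → f τ (z + τ) (W + 6 * z + 3 * τ) = f τ z W
  inv : ∀ τ z W, Dom τ z W → f (-1 / τ) (z / τ) (W - 3 * z ^ 2 / τ) = τ ^ k * f τ z W
  parity : ∀ τ z W, Dom τ z W → f τ (-z) W = (-1) ^ k * f τ z W
  swap : ∀ τ z W, Dom τ z W → f W z τ = f τ z W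

namespace Dom

variable {τ z W : ℂ}

theorem im_w_pos (h : Dom τ z W) : 0 < W.im := by
  have h1 := h.2
  have h2 : 0 < τ.im * W.im := lt_of_le_of_lt (by positivity) h1
  exact (pos_iff_pos_of_mul_pos h2).1 h.1

theorem swap (h : Dom τ z W) : Dom W z τ := ⟨h.im_w_pos, by rw [mul_comm W.im]; exact h.2⟩

theorem iff_lt (hτ : 0 < τ.im) : Dom τ z W ↔ 3 * z.im ^ 2 / τ.im < W.im := by
  rw [div_lt_iff₀ hτ, mul_comm W.im]; simp [Dom, hτ]

theorem jac (h : Dom τ z W) : Dom τ (z + τ) (W + 6 * z + 3 * τ) := by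
  refine ⟨h.1, ?_⟩
  have h1 : (6 * z : ℂ).im = 6 * z.im := by simp
  have h2 : (3 * τ : ℂ).im = 3 * τ.im := by simp
  simp only [Complex.add_im, h1, h2]
  nlinarith [h.2]

theorem of_im_eq {τ' z' W' : ℂ} (h : Dom τ z W) (h1 : τ'.im = τ.im) (h2 : z'.im = z.im)
    (h3 : W'.im = W.im) : Dom τ' z' W' := by
  unfold Dom; rw [h1, h2, h3]; exact h

end Dom

theorem tendsto_add_comap (c : ℂ) :
    Tendsto (fun W => W + c) (comap Complex.im atTop) (comap Complex.im atTop) := by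
  rw [tendsto_comap_iff]
  have : (Complex.im ∘ fun W : ℂ => W + c) = fun W => W.im + c.im := by funext; simp
  rw [this]
  exact tendsto_atTop_add_const_right _ _ tendsto_comap

theorem eventually_dom {τ : ℂ} (hτ : 0 < τ.im) (z : ℂ) :
    ∀ᶠ W in comap Complex.im atTop, Dom τ z W := by
  filter_upwards [(eventually_gt_atTop (3 * z.im ^ 2 / τ.im)).comap Complex.im] with W hW
  exact (Dom.iff_lt hτ).2 hW

instance : (comap Complex.im (atTop : Filter ℝ)).NeBot :=
  atTop_neBot.comap_of_surj Complex.im_surjective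

/-- The `m`-th Fourier–Jacobi leading coefficient of `f` is `φ`. -/
def HasPhi (f : ℂ → ℂ → ℂ → ℂ) (m : ℕ) (φ : ℂ → ℂ → ℂ) : Prop :=
  ∀ τ z, 0 < τ.im → Tendsto (fun W => f τ z W * ee (-(m * W))) (comap Complex.im atTop) (𝓝 (φ τ z))

/-- `f` is `O(exp(2πi m W))` as `Im W → ∞`. -/
def VanishesTo (f : ℂ → ℂ → ℂ → ℂ) (m : ℕ) : Prop :=
  ∀ τ z, 0 < τ.im → ∃ C B, ∀ W : ℂ, B ≤ W.im → ‖f τ z W * ee (-(m * W))‖ ≤ C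

theorem HasPhi.vanishesTo {f : ℂ → ℂ → ℂ → ℂ} {m : ℕ} {φ : ℂ → ℂ → ℂ} (h : HasPhi f m φ) :
    VanishesTo f m := by
  intro τ z hτ
  obtain ⟨C, hC⟩ := (h τ z hτ).norm.isBoundedUnder_le
  rw [eventually_map, eventually_comap] at hC
  obtain ⟨B, hB⟩ := eventually_atTop.1 hC
  exact ⟨C, B, fun W hW => hB _ hW W rfl⟩

namespace Laws

variable {k : ℕ} {f : ℂ → ℂ → ℂ → ℂ} (hf : Laws k f)
include hf

theorem differentiableOn_w {τ : ℂ} (hτ : 0 < τ.im) (z : ℂ) :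
    DifferentiableOn ℂ (fun W => f τ z W) {W | 3 * z.im ^ 2 / τ.im < W.im} :=
  hf.hol.comp (f := fun W : ℂ => (τ, z, W)) (by fun_prop) fun W hW => (Dom.iff_lt hτ).2 hW

theorem differentiableOn_z (τ W : ℂ) :
    DifferentiableOn ℂ (fun z => f τ z W) {z | Dom τ z W} :=
  hf.hol.comp (f := fun z : ℂ => (τ, z, W)) (by fun_prop) fun z hz => hz

theorem jac_int {τ z W : ℂ} (h : Dom τ z W) (n : ℕ) :
    f τ (z + n * τ) (W + 6 * n * z + 3 * n ^ 2 * τ) = f τ z W ∧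
      Dom τ (z + n * τ) (W + 6 * n * z + 3 * n ^ 2 * τ) := by
  induction n with
  | zero => simp [h]
  | succ n ih =>
    have e1 := hf.jac _ _ _ ih.2
    have e2 := ih.2.jac
    rw [show z + (n + 1 : ℕ) * τ = z + n * τ + τ by push_cast; ring,
      show W + 6 * (n + 1 : ℕ) * z + 3 * (n + 1 : ℕ) ^ 2 * τ =
        W + 6 * n * z + 3 * n ^ 2 * τ + 6 * (z + n * τ) + 3 * τ by push_cast; ring]
    exact ⟨e1.trans ih.1, e2⟩

theorem perz_int {τ z W : ℂ} (h : Dom τ z W) (n : ℤ) : f τ (z + n) W = f τ z W :=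
  periodic_int (h := fun z => f τ z W) (S := {z.im})
    (fun _ hz => hf.perz _ _ _ (h.of_im_eq rfl hz rfl)) n z rfl

theorem perw_int {τ z W : ℂ} (h : Dom τ z W) (n : ℤ) : f τ z (W + n) = f τ z W :=
  periodic_int (h := fun W => f τ z W) (S := {W.im})
    (fun _ hz => hf.perw _ _ _ (h.of_im_eq rfl rfl hz)) n W rfl

theorem pert_int {τ z W : ℂ} (h : Dom τ z W) (n : ℤ) : f (τ + n) z W = f τ z W :=
  periodic_int (h := fun τ => f τ z W) (S := {τ.im})
    (fun _ hz => hf.pert _ _ _ (h.of_im_eq hz rfl rfl)) n τ rfl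

theorem koecher {τ : ℂ} (hτ : 0 < τ.im) : ∃ C, ∀ (n : ℕ) (z W : ℂ), |z.im| ≤ n * τ.im →
    1 + 3 * n ^ 2 * τ.im ≤ W.im → ‖f τ z W‖ ≤ C := by
  have hdom0 : ∀ z W : ℂ, z.im = 0 → W.im = 1 → Dom τ z W := fun z W hz hW => by
    refine ⟨hτ, ?_⟩; rw [hz, hW]; simpa using hτ
  obtain ⟨C, hC⟩ : ∃ C, ∀ z W : ℂ, z.im = 0 → W.im = 1 → ‖f τ z W‖ ≤ C := by
    obtain ⟨C, hC⟩ := ((isCompact_rect 0 0).prod (isCompact_rect 1 1)).exists_bound_of_continuousOn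
      (f := fun p : ℂ × ℂ => f τ p.1 p.2) (by
        refine hf.hol.continuousOn.comp (f := fun p : ℂ × ℂ => (τ, p.1, p.2)) (by fun_prop) ?_
        rintro ⟨z, W⟩ ⟨⟨_, hz⟩, ⟨_, hW⟩⟩
        exact hdom0 z W (le_antisymm hz.2 hz.1) (le_antisymm hW.2 hW.1))
    refine ⟨C, fun z W hz hW => ?_⟩
    obtain ⟨n, hn⟩ := exists_int_shift z
    obtain ⟨n', hn'⟩ := exists_int_shift W
    have h1 := hf.perz_int (hdom0 z W hz hW) n
    have h2 := hf.perw_int (hdom0 (z + n) W (by simpa using hz) hW) n'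
    rw [← h1, ← h2]
    exact hC (z + n, W + n') ⟨⟨hn, by simp [hz]⟩, ⟨hn', by simp [hW]⟩⟩
  have hedge : ∀ (n : ℕ) (z W : ℂ), z.im = n * τ.im → W.im = 1 + 3 * n ^ 2 * τ.im →
      ‖f τ z W‖ ≤ C := by
    intro n z W hz hW
    set z' := z - n * τ
    set W' := W - 6 * n * z' - 3 * n ^ 2 * τ
    have e1 : z'.im = 0 := by simp [z', hz]
    have e2 : W'.im = 1 := by
      have a1 : (6 * n * z' : ℂ).im = 6 * n * z'.im := by
        rw [show (6 * n * z' : ℂ) = ((6 * n : ℝ) : ℂ) * z' by push_cast; ring, Complex.im_ofReal_mul]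
      have a2 : (3 * n ^ 2 * τ : ℂ).im = 3 * n ^ 2 * τ.im := by
        rw [show (3 * n ^ 2 * τ : ℂ) = ((3 * n ^ 2 : ℝ) : ℂ) * τ by push_cast; ring,
          Complex.im_ofReal_mul]
      simp only [W', Complex.sub_im, a1, a2, e1, hW]; ring
    have := (hf.jac_int (hdom0 z' W' e1 e2) n).1
    rw [show z' + n * τ = z by simp [z'], show W' + 6 * n * z' + 3 * n ^ 2 * τ = W by
      simp only [W']; ring] at this
    rw [this]
    exact hC _ _ e1 e2
  have hdomn : ∀ (n : ℕ) (z W : ℂ), |z.im| ≤ n * τ.im → 1 + 3 * n ^ 2 * τ.im ≤ W.im →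
      Dom τ z W := fun n z W hz hW => by
    refine ⟨hτ, ?_⟩
    have h1 : z.im ^ 2 ≤ (n * τ.im) ^ 2 := sq_le_sq' (neg_le_of_abs_le hz) (le_of_abs_le hz)
    have h2 := mul_le_mul_of_nonneg_left hW hτ.le
    nlinarith
  have hline : ∀ (n : ℕ) (z W : ℂ), |z.im| ≤ n * τ.im → W.im = 1 + 3 * n ^ 2 * τ.im →
      ‖f τ z W‖ ≤ C := by
    intro n z W hz hW
    have hpar : ∀ z : ℂ, |z.im| ≤ n * τ.im → ‖f τ (-z) W‖ = ‖f τ z W‖ := fun z hz => by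
      rw [hf.parity _ _ _ (hdomn n z W hz hW.ge)]; simp
    set r := Real.sqrt (n ^ 2 * τ.im ^ 2 + τ.im / 6)
    have hr : n * τ.im < r := by
      apply Real.lt_sqrt_of_sq_lt; nlinarith
    have hrd : ∀ z : ℂ, z.im ∈ Set.Ioo (-r) r → Dom τ z W := fun z hz => by
      refine ⟨hτ, ?_⟩
      have h1 : z.im ^ 2 ≤ r ^ 2 := sq_le_sq' hz.1.le hz.2.le
      rw [Real.sq_sqrt (by positivity)] at h1
      rw [hW]; nlinarith
    refine strip_max (h := fun z => f τ z W) (a' := -r) (a := -(n * τ.im)) (b := n * τ.im) (b' := r)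
      (by linarith) hr ((hf.differentiableOn_z τ W).mono hrd)
      (fun z hz => hf.perz _ _ _ (hrd z hz)) (fun z hz => ?_)
      (fun z hz => hedge n z W hz hW) (abs_le.1 hz)
    have : ‖f τ (-z) W‖ ≤ C := hedge n _ W (by simp [hz]) hW
    rwa [hpar _ (by rw [hz, abs_neg]; exact (abs_of_nonneg (by positivity)).le)] at this
  refine ⟨C, fun n z W hz hW => ?_⟩
  obtain ⟨N, hN⟩ := exists_nat_ge (n + W.im / τ.im)
  have hnN : (n : ℝ) ≤ N := by
    have : 0 ≤ W.im / τ.im := div_nonneg (le_trans (by positivity) hW) hτ.le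
    linarith
  have hWN : W.im ≤ 1 + 3 * N ^ 2 * τ.im := by
    have h1 : W.im / τ.im ≤ N := by linarith [n.cast_nonneg (α := ℝ)]
    rw [div_le_iff₀ hτ] at h1
    have h2 : (N : ℝ) ≤ N ^ 2 := by exact_mod_cast Nat.le_self_pow two_ne_zero N
    nlinarith
  have hd : ∀ V : ℂ, 3 * z.im ^ 2 / τ.im < V.im → Dom τ z V := fun V hV => (Dom.iff_lt hτ).2 hV
  have hlow : 3 * z.im ^ 2 / τ.im < 1 + 3 * n ^ 2 * τ.im := by
    have := (Dom.iff_lt hτ).1 (hdomn n z (((1 + 3 * n ^ 2 * τ.im : ℝ) : ℂ) * Complex.I) hz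
      (by rw [Complex.im_ofReal_mul, Complex.I_im, mul_one]))
    rwa [Complex.im_ofReal_mul, Complex.I_im, mul_one] at this
  refine strip_max (h := fun W => f τ z W) (a' := 3 * z.im ^ 2 / τ.im) (b' := 2 + 3 * N ^ 2 * τ.im)
    hlow (by linarith) ((hf.differentiableOn_w hτ z).mono fun V hV => hV.1)
    (fun V hV => hf.perw _ _ _ (hd V hV.1)) (fun V hV => hline n z V hz hV)
    (fun V hV => hline N z V (hz.trans ?_) hV) ⟨hW, hWN⟩
  gcongr

theorem vanishesTo_zero : VanishesTo f 0 := by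
  intro τ z hτ
  obtain ⟨C, hC⟩ := hf.koecher hτ
  obtain ⟨n, hn⟩ := exists_nat_ge (|z.im| / τ.im)
  refine ⟨C, 1 + 3 * n ^ 2 * τ.im, fun W hW => ?_⟩
  · simpa [ee_zero] using hC n z W ((div_le_iff₀ hτ).1 hn) hW

theorem differentiableOn_w_ee (m : ℕ) {τ : ℂ} (hτ : 0 < τ.im) (z : ℂ) :
    DifferentiableOn ℂ (fun W => f τ z W * ee (-(m * W))) {W | 3 * z.im ^ 2 / τ.im < W.im} :=
  (hf.differentiableOn_w hτ z).mul (differentiable_ee.comp (by fun_prop)).differentiableOn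

omit hf in
theorem ee_per (m : ℕ) (W : ℂ) : ee (-(m * (W + 1))) = ee (-(m * W)) := by
  rw [← ee_add_int (-(m * W)) (-m)]; congr 1; push_cast; ring

theorem exists_phi {m : ℕ} (hv : VanishesTo f m) : ∃ φ, HasPhi f m φ ∧
    ((∀ τ z, 0 < τ.im → φ τ z = 0) → VanishesTo f (m + 1)) := by
  have key : ∀ τ z : ℂ, 0 < τ.im → _ := fun τ z hτ =>
    exists_lim (hf.differentiableOn_w_ee m hτ z) (fun W hW => by
      rw [hf.perw _ _ _ ((Dom.iff_lt hτ).2 hW), ee_per]) (hv τ z hτ)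
  choose l hl using key
  refine ⟨fun τ z => if h : 0 < τ.im then l τ z h else 0, fun τ z hτ => ?_, fun h0 τ z hτ => ?_⟩
  · simpa only [dif_pos hτ] using (hl τ z hτ).1
  · have := h0 τ z hτ
    simp only [dif_pos hτ] at this
    obtain ⟨C, B, hB⟩ := (hl τ z hτ).2 this
    refine ⟨C, B, fun W hW => ?_⟩
    rw [show -((m + 1 : ℕ) * W) = -(m * W) + -W by push_cast; ring, ee_add, ← mul_assoc]
    exact hB W hW

theorem le_of_vanishesTo {m : ℕ} (hv : VanishesTo f m) {τ z : ℂ} {b C : ℝ} (hτ : 0 < τ.im)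
    (hb : 3 * z.im ^ 2 / τ.im < b) (hC : ∀ W : ℂ, W.im = b → ‖f τ z W * ee (-(m * W))‖ ≤ C) {W : ℂ}
    (hW : b ≤ W.im) : ‖f τ z W * ee (-(m * W))‖ ≤ C :=
  halfPlane_max hb (hf.differentiableOn_w_ee m hτ z) (fun W hW => by
      rw [hf.perw _ _ _ ((Dom.iff_lt hτ).2 hW), ee_per]) (hv τ z hτ) hC hW

theorem bound_line (m : ℕ) {K : Set (ℂ × ℂ)} (hK : IsCompact K) {b : ℝ}
    (hb : ∀ p ∈ K, ∀ W : ℂ, W.im = b → Dom p.1 p.2 W) :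
    ∃ C, ∀ p ∈ K, ∀ W : ℂ, W.im = b → ‖f p.1 p.2 W * ee (-(m * W))‖ ≤ C := by
  obtain ⟨C, hC⟩ := (hK.prod (isCompact_rect b b)).exists_bound_of_continuousOn
    (f := fun p : (ℂ × ℂ) × ℂ => f p.1.1 p.1.2 p.2 * ee (-(m * p.2))) (by
      refine ContinuousOn.mul ?_ ?_
      · refine hf.hol.continuousOn.comp (f := fun p : (ℂ × ℂ) × ℂ => (p.1.1, p.1.2, p.2))
          (by fun_prop) ?_
        rintro ⟨p, W⟩ ⟨hp, ⟨_, hW⟩⟩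
        exact hb p hp W (le_antisymm hW.2 hW.1)
      · have := continuous_ee
        fun_prop)
  refine ⟨C, fun p hp W hW => ?_⟩
  obtain ⟨n, hn⟩ := exists_int_shift W
  have h1 := hf.perw_int (hb p hp W hW) n
  have h2 : ee (-(m * (W + n))) = ee (-(m * W)) := by
    rw [← ee_add_int (-(m * W)) (-(m * n))]; congr 1; push_cast; ring
  rw [← h1, ← h2]
  exact hC (p, W + n) ⟨hp, ⟨hn, by simp [hW]⟩⟩

theorem bound_uniform {m : ℕ} (hv : VanishesTo f m) {K : Set (ℂ × ℂ)} (hK : IsCompact K) {b : ℝ}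
    (hb : ∀ p ∈ K, ∀ W : ℂ, W.im = b → Dom p.1 p.2 W) :
    ∃ C, ∀ p ∈ K, ∀ W : ℂ, b ≤ W.im → ‖f p.1 p.2 W * ee (-(m * W))‖ ≤ C := by
  obtain ⟨C, hC⟩ := hf.bound_line m hK hb
  refine ⟨C, fun p hp W hW => ?_⟩
  have hd := hb p hp ((b : ℂ) * Complex.I) (by simp)
  exact hf.le_of_vanishesTo hv hd.1 (by simpa using (Dom.iff_lt hd.1).1 hd) (hC p hp) hW

omit hf in
theorem exists_height {K : Set (ℂ × ℂ)} (hK : IsCompact K) (hpos : ∀ p ∈ K, 0 < p.1.im) :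
    ∃ b : ℝ, ∀ p ∈ K, ∀ W : ℂ, b ≤ W.im → Dom p.1 p.2 W := by
  obtain ⟨C, hC⟩ := hK.exists_bound_of_continuousOn (f := fun p : ℂ × ℂ => 3 * p.2.im ^ 2 / p.1.im)
    (ContinuousOn.div (by fun_prop) (by fun_prop) fun p hp => (hpos p hp).ne')
  refine ⟨C + 1, fun p hp W hW => (Dom.iff_lt (hpos p hp)).2 ?_⟩
  have := (le_abs_self _).trans (hC p hp)
  linarith

theorem phi_bound {m : ℕ} {φ : ℂ → ℂ → ℂ} (hφ : HasPhi f m φ) {K : Set (ℂ × ℂ)} (hK : IsCompact K)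
    (hpos : ∀ p ∈ K, 0 < p.1.im) : ∃ C, ∀ p ∈ K, ‖φ p.1 p.2‖ ≤ C := by
  obtain ⟨b, hb⟩ := exists_height hK hpos
  obtain ⟨C, hC⟩ := hf.bound_uniform hφ.vanishesTo hK (fun p hp W hW => hb p hp W hW.ge)
  refine ⟨C, fun p hp => le_of_tendsto (hφ _ _ (hpos p hp)).norm ?_⟩
  filter_upwards [(eventually_ge_atTop b).comap Complex.im] with W hW
  exact hC p hp W hW

theorem phi_differentiableAt {m : ℕ} {φ : ℂ → ℂ → ℂ} (hφ : HasPhi f m φ) {α β : ℂ → ℂ}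
    (hα : Differentiable ℂ α) (hβ : Differentiable ℂ β) {s : ℂ} (hs : 0 < (α s).im) :
    DifferentiableAt ℂ (fun s => φ (α s) (β s)) s := by
  have hopen : IsOpen {s | 0 < (α s).im} :=
    isOpen_lt continuous_const (Complex.continuous_im.comp hα.continuous)
  obtain ⟨R, hR, hsub⟩ := Metric.nhds_basis_closedBall.mem_iff.1 (hopen.mem_nhds hs)
  have hcαβ : Continuous fun s => (α s, β s) := hα.continuous.prodMk hβ.continuous
  have hK := (isCompact_closedBall s R).image hcαβ
  have hpos : ∀ p ∈ (fun s => (α s, β s)) '' Metric.closedBall s R, 0 < p.1.im := by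
    rintro _ ⟨t, ht, rfl⟩; exact hsub ht
  obtain ⟨b, hb⟩ := exists_height hK hpos
  obtain ⟨C, hC⟩ := hf.bound_uniform hφ.vanishesTo hK (fun p hp W hW => hb p hp W hW.ge)
  set w : ℕ → ℂ := fun n => ((b + n : ℝ) : ℂ) * Complex.I
  have hw : ∀ n, (w n).im = b + n := fun n => by
    simp only [w, Complex.im_ofReal_mul, Complex.I_im, mul_one]
  have hwlim : Tendsto w atTop (comap Complex.im atTop) := by
    rw [tendsto_comap_iff]
    have : Complex.im ∘ w = fun n : ℕ => b + (n : ℝ) := funext hw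
    rw [this]
    exact tendsto_atTop_add_const_left _ _ tendsto_natCast_atTop_atTop
  have hmain : DifferentiableOn ℂ (fun s => φ (α s) (β s)) (Metric.ball s R) := by
    refine differentiableOn_of_tendsto (F := fun n s => f (α s) (β s) (w n) * ee (-(m * w n)))
      Metric.isOpen_ball (fun n => ?_) (fun t ht => ?_) (fun K hKs _ => ?_)
    · refine DifferentiableOn.mul_const ?_ _
      refine hf.hol.comp (f := fun t : ℂ => (α t, β t, w n)) (by fun_prop) fun t ht => ?_
      exact hb (α t, β t) ⟨t, Metric.ball_subset_closedBall ht, rfl⟩ _ (by rw [hw]; simp)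
    · exact (hφ _ _ (hsub (Metric.ball_subset_closedBall ht))).comp hwlim
    · exact ⟨C, fun n t ht => hC (α t, β t) ⟨t, Metric.ball_subset_closedBall (hKs ht), rfl⟩ _
        (by rw [hw]; simp)⟩
  exact hmain.differentiableAt (Metric.isOpen_ball.mem_nhds (Metric.mem_ball_self hR))

end Laws

section entire

variable {φ : ℂ → ℂ} {ν : ℕ} {c : ℂ}

theorem im_neg_one_div_pos {τ : ℂ} (hτ : 0 < τ.im) : 0 < (-1 / τ).im := by
  have h0 : τ ≠ 0 := fun h => by simp [h] at hτ
  rw [neg_div, one_div, Complex.neg_im, Complex.inv_im, neg_div, neg_neg]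
  exact div_pos hτ (Complex.normSq_pos.2 h0)

theorem exists_entire_quotient (hd : Differentiable ℂ φ)
    (hc : Tendsto (fun z => φ z / z ^ ν) (𝓝[≠] 0) (𝓝 c)) :
    ∃ g : ℂ → ℂ, Differentiable ℂ g ∧ g 0 = c ∧ ∀ z ≠ 0, g z = φ z / z ^ ν := by
  classical
  refine ⟨Function.update (fun z => φ z / z ^ ν) 0 c, ?_, by simp, fun z hz => by simp [hz]⟩
  have hoff : ∀ z ≠ 0, DifferentiableAt ℂ (Function.update (fun z => φ z / z ^ ν) 0 c) z := by
    intro z hz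
    refine ((hd z).div (differentiableAt_id.pow ν) (pow_ne_zero _ hz)).congr_of_eventuallyEq ?_
    filter_upwards [isOpen_ne.mem_nhds hz] with w hw
    have hw : w ≠ 0 := hw
    simp [hw]
  intro z
  by_cases hz : z = 0
  · subst hz
    refine (Complex.analyticAt_of_differentiable_on_punctured_nhds_of_continuousAt ?_
      (continuousAt_update_same.2 hc)).differentiableAt
    filter_upwards [self_mem_nhdsWithin] with w hw
    exact hoff w hw
  · exact hoff z hz

theorem exists_next_lead (hd : Differentiable ℂ φ)
    (hc : Tendsto (fun z => φ z / z ^ ν) (𝓝[≠] 0) (𝓝 0)) :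
    ∃ c', Tendsto (fun z => φ z / z ^ (ν + 1)) (𝓝[≠] 0) (𝓝 c') := by
  obtain ⟨g, hg, h0, hgz⟩ := exists_entire_quotient hd hc
  refine ⟨deriv g 0, ?_⟩
  refine (hasDerivAt_iff_tendsto_slope.1 (hg 0).hasDerivAt).congr' ?_
  filter_upwards [self_mem_nhdsWithin] with z hz
  have hz : z ≠ 0 := hz
  rw [slope_def_field, h0, hgz z hz, sub_zero, sub_zero, div_div, pow_succ]

theorem quotient_bound (hd : Differentiable ℂ φ)
    (hc : Tendsto (fun z => φ z / z ^ ν) (𝓝[≠] 0) (𝓝 c)) {C : ℝ}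
    (hC : ∀ z, ‖z‖ = 1 → ‖φ z‖ ≤ C) :
    ‖c‖ ≤ C ∧ ∀ z ≠ 0, ‖z‖ ≤ 1 → ‖φ z / z ^ ν‖ ≤ C := by
  obtain ⟨g, hg, h0, hgz⟩ := exists_entire_quotient hd hc
  have key : ∀ z ∈ Metric.closedBall (0 : ℂ) 1, ‖g z‖ ≤ C := by
    intro z hz
    rw [← closure_ball (0 : ℂ) one_ne_zero] at hz
    refine Complex.norm_le_of_forall_mem_frontier_norm_le Metric.isBounded_ball
      hg.diffContOnCl (fun w hw => ?_) hz
    rw [frontier_ball (0 : ℂ) one_ne_zero, mem_sphere_zero_iff_norm] at hw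
    have hw0 : w ≠ 0 := by rintro rfl; simp at hw
    rw [hgz w hw0, norm_div, norm_pow, hw, one_pow, div_one]
    exact hC w hw
  refine ⟨h0 ▸ key 0 (by simp), fun z hz hz1 => hgz z hz ▸ key z (by simpa using hz1)⟩

end entire

/-- The `(m, ν)`-th leading coefficient of `f` at the one-dimensional cusp is `c`. -/
def HasLead (f : ℂ → ℂ → ℂ → ℂ) (m ν : ℕ) (c : ℂ → ℂ) : Prop :=
  ∃ φ, HasPhi f m φ ∧ ∀ τ, 0 < τ.im → Tendsto (fun z => φ τ z / z ^ ν) (𝓝[≠] 0) (𝓝 (c τ))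

namespace HasLead

variable {f g : ℂ → ℂ → ℂ → ℂ} {m ν m' ν' : ℕ} {c c' : ℂ → ℂ}

theorem mul (hf : HasLead f m ν c) (hg : HasLead g m' ν' c') :
    HasLead (fun τ z W => f τ z W * g τ z W) (m + m') (ν + ν') (fun τ => c τ * c' τ) := by
  obtain ⟨φ, h1, h2⟩ := hf
  obtain ⟨ψ, h3, h4⟩ := hg
  refine ⟨fun τ z => φ τ z * ψ τ z, fun τ z hτ => ?_, fun τ hτ => ?_⟩
  · refine ((h1 τ z hτ).mul (h3 τ z hτ)).congr fun W => ?_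
    rw [show -((m + m' : ℕ) * W) = -(m * W) + -(m' * W) by push_cast; ring, ee_add]; ring
  · refine ((h2 τ hτ).mul (h4 τ hτ)).congr fun z => ?_
    rw [div_mul_div_comm, pow_add]

theorem sub (hf : HasLead f m ν c) (hg : HasLead g m ν c') :
    HasLead (fun τ z W => f τ z W - g τ z W) m ν (fun τ => c τ - c' τ) := by
  obtain ⟨φ, h1, h2⟩ := hf
  obtain ⟨ψ, h3, h4⟩ := hg
  refine ⟨fun τ z => φ τ z - ψ τ z, fun τ z hτ => ?_, fun τ hτ => ?_⟩
  · refine ((h1 τ z hτ).sub (h3 τ z hτ)).congr fun W => ?_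
    ring
  · refine ((h2 τ hτ).sub (h4 τ hτ)).congr fun z => ?_
    ring

theorem add (hf : HasLead f m ν c) (hg : HasLead g m ν c') :
    HasLead (fun τ z W => f τ z W + g τ z W) m ν (fun τ => c τ + c' τ) := by
  obtain ⟨φ, h1, h2⟩ := hf
  obtain ⟨ψ, h3, h4⟩ := hg
  refine ⟨fun τ z => φ τ z + ψ τ z, fun τ z hτ => ?_, fun τ hτ => ?_⟩
  · refine ((h1 τ z hτ).add (h3 τ z hτ)).congr fun W => ?_
    ring
  · refine ((h2 τ hτ).add (h4 τ hτ)).congr fun z => ?_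
    ring

theorem const_mul (a : ℂ) (hf : HasLead f m ν c) :
    HasLead (fun τ z W => a * f τ z W) m ν (fun τ => a * c τ) := by
  obtain ⟨φ, h1, h2⟩ := hf
  refine ⟨fun τ z => a * φ τ z, fun τ z hτ => ?_, fun τ hτ => ?_⟩
  · refine ((h1 τ z hτ).const_mul a).congr fun W => ?_
    ring
  · refine ((h2 τ hτ).const_mul a).congr fun z => ?_
    ring

theorem const (a : ℂ) : HasLead (fun _ _ _ => a) 0 0 (fun _ => a) :=
  ⟨fun _ _ => a, fun τ z hτ => by simp [ee_zero], fun τ hτ => by simp⟩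

theorem congr_lead (hf : HasLead f m ν c) (h : ∀ τ, 0 < τ.im → c τ = c' τ) : HasLead f m ν c' := by
  obtain ⟨φ, h1, h2⟩ := hf
  exact ⟨φ, h1, fun τ hτ => h τ hτ ▸ h2 τ hτ⟩

end HasLead

namespace Laws

variable {k m ν : ℕ} {f : ℂ → ℂ → ℂ → ℂ} {φ : ℂ → ℂ → ℂ} {c : ℂ → ℂ}

section phi

variable (hf : Laws k f) (hφ : HasPhi f m φ) {τ : ℂ} (hτ : 0 < τ.im) (z : ℂ)
include hf hφ hτ

theorem phi_add_one : φ τ (z + 1) = φ τ z := by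
  refine tendsto_nhds_unique (hφ τ (z + 1) hτ) ((hφ τ z hτ).congr' ?_)
  filter_upwards [eventually_dom hτ z] with W hW
  rw [hf.perz _ _ _ hW]

theorem phi_add_one_left : φ (τ + 1) z = φ τ z := by
  refine tendsto_nhds_unique (hφ (τ + 1) z (by simpa using hτ)) ((hφ τ z hτ).congr' ?_)
  filter_upwards [eventually_dom hτ z] with W hW
  rw [hf.pert _ _ _ hW]

theorem phi_neg : φ τ (-z) = (-1) ^ k * φ τ z := by
  refine tendsto_nhds_unique (hφ τ (-z) hτ) (((hφ τ z hτ).const_mul _).congr' ?_)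
  filter_upwards [eventually_dom hτ z] with W hW
  rw [hf.parity _ _ _ hW, mul_assoc]

theorem phi_add_self : φ τ (z + τ) = ee (-(m * (6 * z + 3 * τ))) * φ τ z := by
  have h1 := (hφ τ (z + τ) hτ).comp (tendsto_add_comap (6 * z + 3 * τ))
  refine tendsto_nhds_unique h1 (((hφ τ z hτ).const_mul _).congr' ?_)
  filter_upwards [eventually_dom hτ z] with W hW
  simp only [Function.comp]
  rw [← add_assoc W, hf.jac _ _ _ hW,
    show -(m * (W + 6 * z + 3 * τ)) = -(m * (6 * z + 3 * τ)) + -(m * W) by ring, ee_add]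
  ring

theorem phi_inv : φ (-1 / τ) (z / τ) = τ ^ k * ee (m * (3 * z ^ 2 / τ)) * φ τ z := by
  have h0 : 0 < (-1 / τ).im := by
    exact im_neg_one_div_pos hτ
  have h1 := (hφ (-1 / τ) (z / τ) h0).comp (tendsto_add_comap (-(3 * z ^ 2 / τ)))
  refine tendsto_nhds_unique h1 (((hφ τ z hτ).const_mul _).congr' ?_)
  filter_upwards [eventually_dom hτ z] with W hW
  simp only [Function.comp]
  rw [← sub_eq_add_neg W, hf.inv _ _ _ hW,
    show -(m * (W - 3 * z ^ 2 / τ)) = (m * (3 * z ^ 2 / τ)) + -(m * W) by ring, ee_add]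
  ring

theorem phi_differentiable : Differentiable ℂ (φ τ) := fun z =>
  hf.phi_differentiableAt hφ (α := fun _ => τ) (β := fun s => s) (by fun_prop) (by fun_prop)
    (s := z) hτ

theorem phi_differentiableOn_left : DifferentiableAt ℂ (fun τ => φ τ z) τ :=
  hf.phi_differentiableAt hφ (α := fun s => s) (β := fun _ => z) (by fun_prop) (by fun_prop) hτ

end phi

section lead

variable (hf : Laws k f) (hc : HasLead f m ν c)
include hf hc

theorem lead_add_one {τ : ℂ} (hτ : 0 < τ.im) : c (τ + 1) = c τ := by
  obtain ⟨φ, h1, h2⟩ := hc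
  refine tendsto_nhds_unique (h2 (τ + 1) (by simpa using hτ)) ((h2 τ hτ).congr fun z => ?_)
  rw [hf.phi_add_one_left h1 hτ]

theorem lead_inv {τ : ℂ} (hτ : 0 < τ.im) : c (-1 / τ) = τ ^ (k + ν) * c τ := by
  obtain ⟨φ, h1, h2⟩ := hc
  have hτ0 : τ ≠ 0 := fun h => by simp [h] at hτ
  have h0 : 0 < (-1 / τ).im := by
    exact im_neg_one_div_pos hτ
  have hdiv : Tendsto (fun z : ℂ => z / τ) (𝓝[≠] 0) (𝓝[≠] 0) := by
    refine tendsto_nhdsWithin_iff.2 ⟨?_, ?_⟩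
    · have : Continuous fun z : ℂ => z / τ := by fun_prop
      have := (this.continuousAt (x := 0)).tendsto
      rw [zero_div] at this
      exact this.mono_left nhdsWithin_le_nhds
    · filter_upwards [self_mem_nhdsWithin] with Z hZ
      have hZ : Z ≠ 0 := hZ
      simp [hZ, hτ0]
  have hE : Tendsto (fun z : ℂ => ee (m * (3 * z ^ 2 / τ))) (𝓝[≠] 0) (𝓝 1) := by
    have h3 := continuous_ee
    have : Continuous fun z : ℂ => ee (m * (3 * z ^ 2 / τ)) := by fun_prop
    have := (this.continuousAt (x := 0)).tendsto
    simp only [ne_eq, OfNat.ofNat_ne_zero, not_false_eq_true, zero_pow, mul_zero, zero_div,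
      ee_zero] at this
    exact this.mono_left nhdsWithin_le_nhds
  have h4 := (hE.mul (h2 τ hτ)).const_mul (τ ^ (k + ν))
  rw [one_mul] at h4
  refine tendsto_nhds_unique ((h2 _ h0).comp hdiv) (h4.congr fun z => ?_)
  simp only [Function.comp]
  rw [hf.phi_inv h1 hτ, div_pow, pow_add]
  field_simp

theorem lead_differentiableOn : DifferentiableOn ℂ c {τ | 0 < τ.im} := by
  obtain ⟨φ, h1, h2⟩ := hc
  set w : ℕ → ℂ := fun n => ((1 / ((n : ℝ) + 1) : ℝ) : ℂ)
  have hw0 : ∀ n, w n ≠ 0 := fun n => by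
    simp only [w]; exact_mod_cast (one_div_pos.2 (by positivity : (0 : ℝ) < n + 1)).ne'
  have hw1 : ∀ n, ‖w n‖ ≤ 1 := fun n => by
    simp only [w, Complex.norm_real, Real.norm_eq_abs]
    rw [abs_of_pos (by positivity), div_le_one (by positivity)]
    linarith [n.cast_nonneg (α := ℝ)]
  have hw : Tendsto w atTop (𝓝[≠] 0) := by
    refine tendsto_nhdsWithin_iff.2 ⟨?_, .of_forall hw0⟩
    have := (Complex.continuous_ofReal.tendsto 0).comp tendsto_one_div_add_atTop_nhds_zero_nat
    rw [Complex.ofReal_zero] at this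
    exact this
  refine differentiableOn_of_tendsto (F := fun n τ => φ τ (w n) / w n ^ ν)
    (isOpen_im_gt 0) (fun n τ hτ => ?_) (fun τ hτ => (h2 τ hτ).comp hw) (fun K hKs hK => ?_)
  · exact ((hf.phi_differentiableOn_left h1 hτ _).div_const _).differentiableWithinAt
  · obtain ⟨C, hC⟩ := hf.phi_bound h1 (hK.prod (isCompact_sphere (0 : ℂ) 1))
      fun p hp => hKs hp.1
    refine ⟨C, fun n τ hτ => ?_⟩
    exact (quotient_bound (hf.phi_differentiable h1 (hKs hτ)) (h2 τ (hKs hτ)) fun z hz =>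
      hC (τ, z) ⟨hτ, by simpa using hz⟩).2 _ (hw0 n) (hw1 n)

theorem lead_bound : ∃ C B, ∀ τ : ℂ, B ≤ τ.im → ‖c τ * ee (-(m * τ))‖ ≤ C := by
  obtain ⟨φ, h1, h2⟩ := hc
  have hv := h1.vanishesTo
  have hdom : ∀ τ z W : ℂ, 2 ≤ τ.im → ‖z‖ ≤ 1 → 2 ≤ W.im → Dom τ z W := fun τ z W hτ hz hW => by
    refine ⟨by linarith, ?_⟩
    have : z.im ^ 2 ≤ 1 := by
      rw [sq_le_one_iff_abs_le_one]; exact (Complex.abs_im_le_norm z).trans hz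
    nlinarith
  obtain ⟨C, hC⟩ := hf.bound_line m (b := 2)
    (K := {τ : ℂ | τ.re ∈ Set.Icc (0 : ℝ) 1 ∧ τ.im ∈ Set.Icc 2 2} ×ˢ Metric.closedBall (0 : ℂ) 1)
    ((isCompact_rect 2 2).prod (isCompact_closedBall _ _)) (by
      rintro ⟨τ, z⟩ ⟨⟨_, h3⟩, h4⟩ W hW
      exact hdom _ _ _ h3.1 (by simpa using h4) hW.ge)
  set C' := C * Real.exp (2 * Real.pi * (m * 2)) with hC'
  have hee : ∀ τ : ℂ, τ.im = 2 → ‖ee (-(m * τ))‖ = Real.exp (2 * Real.pi * (m * 2)) := by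
    intro τ hτ
    rw [norm_ee]; congr 1
    simp [hτ]
  have corner : ∀ τ z W : ℂ, τ.im = 2 → ‖z‖ ≤ 1 → W.im = 2 →
      ‖f τ z W * ee (-(m * W)) * ee (-(m * τ))‖ ≤ C' := by
    intro τ z W hτ hz hW
    obtain ⟨n, hn⟩ := exists_int_shift τ
    have := hC (τ + n, z) ⟨⟨hn, by simp [hτ]⟩, by simpa using hz⟩ W hW
    simp only at this
    rw [hf.pert_int (hdom _ _ _ hτ.ge hz hW.ge)] at this
    rw [norm_mul, hee τ hτ, hC']
    gcongr
  have gen : ∀ τ z : ℂ, 2 ≤ τ.im → ‖z‖ ≤ 1 →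
      (∀ W : ℂ, W.im = 2 → ‖f τ z W * ee (-(m * W)) * ee (-(m * τ))‖ ≤ C') →
      ∀ W : ℂ, 2 ≤ W.im → ‖f τ z W * ee (-(m * W)) * ee (-(m * τ))‖ ≤ C' := by
    intro τ z hτ hz h W hW
    have hpos : 0 < ‖ee (-(m * τ))‖ := norm_pos_iff.2 (ee_ne_zero _)
    rw [norm_mul, ← le_div_iff₀ hpos]
    have hτ0 : 0 < τ.im := by linarith
    refine hf.le_of_vanishesTo hv hτ0 ((Dom.iff_lt hτ0 (W := 2 * Complex.I)).1
      (hdom _ _ _ hτ hz (by simp)) |>.trans_eq (by simp)) (fun V hV => ?_) hW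
    rw [le_div_iff₀ hpos, ← norm_mul]
    exact h V hV
  have all : ∀ τ z W : ℂ, 2 ≤ τ.im → ‖z‖ ≤ 1 → 2 ≤ W.im →
      ‖f τ z W * ee (-(m * W)) * ee (-(m * τ))‖ ≤ C' := by
    intro τ z W hτ hz hW
    refine gen τ z hτ hz (fun V hV => ?_) W hW
    have := gen V z hV.ge hz (fun U hU => corner V z U hV hz hU) τ hτ
    rw [hf.swap _ _ _ (hdom τ z V hτ hz hV.ge)] at this
    rwa [mul_right_comm]
  refine ⟨C', 2, fun τ hτ => ?_⟩
  have hτ0 : 0 < τ.im := by linarith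
  have hpos : 0 < ‖ee (-(m * τ))‖ := norm_pos_iff.2 (ee_ne_zero _)
  rw [norm_mul, ← le_div_iff₀ hpos]
  refine (quotient_bound (hf.phi_differentiable h1 hτ0) (h2 τ hτ0) fun z hz => ?_).1
  refine le_of_tendsto (h1 τ z hτ0).norm ?_
  filter_upwards [(eventually_ge_atTop 2).comap Complex.im] with W hW
  rw [le_div_iff₀ hpos, ← norm_mul]
  exact all τ z W hτ hz.le hW

theorem lead_next (h0 : ∀ τ, 0 < τ.im → c τ = 0) : ∃ c', HasLead f m (ν + 1) c' := by
  obtain ⟨φ, h1, h2⟩ := hc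
  have key : ∀ τ : ℂ, 0 < τ.im → ∃ c', Tendsto (fun z => φ τ z / z ^ (ν + 1)) (𝓝[≠] 0) (𝓝 c') :=
    fun τ hτ => exists_next_lead (hf.phi_differentiable h1 hτ) (h0 τ hτ ▸ h2 τ hτ)
  choose c' hc' using key
  refine ⟨fun τ => if h : 0 < τ.im then c' τ h else 0, φ, h1, fun τ hτ => ?_⟩
  simpa only [dif_pos hτ] using hc' τ hτ

omit hc in
theorem lead_of_vanishesTo (hv : VanishesTo f m) : ∃ c, HasLead f m 0 c := by
  obtain ⟨φ, h1, -⟩ := hf.exists_phi hv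
  refine ⟨fun τ => φ τ 0, φ, h1, fun τ hτ => ?_⟩
  have := (hf.phi_differentiable h1 hτ).continuous.continuousAt (x := 0)
  simpa using this.tendsto.mono_left nhdsWithin_le_nhds

omit hf hc in
theorem _root_.HasPhi.unique {φ ψ : ℂ → ℂ → ℂ} (h1 : HasPhi f m φ) (h2 : HasPhi f m ψ) {τ : ℂ}
    (hτ : 0 < τ.im) (z : ℂ) : φ τ z = ψ τ z :=
  tendsto_nhds_unique (h1 τ z hτ) (h2 τ z hτ)

omit hc in
theorem vanishesTo_succ_of_phi (h1 : HasPhi f m φ) (h0 : ∀ τ z, 0 < τ.im → φ τ z = 0) :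
    VanishesTo f (m + 1) := by
  obtain ⟨ψ, h2, h3⟩ := hf.exists_phi h1.vanishesTo
  exact h3 fun τ z hτ => (h2.unique h1 hτ z).trans (h0 τ z hτ)

theorem phi_zero_of_even (hν : ν = 6 * m) (h0 : ∀ τ, 0 < τ.im → c τ = 0) : VanishesTo f (m + 1) := by
  obtain ⟨φ, h1, h2⟩ := hc
  refine hf.vanishesTo_succ_of_phi h1 fun τ z hτ => ?_
  refine theta_eq_zero hτ (N := 3 * m) (a := 3 * m) (hf.phi_differentiable h1 hτ)
    (hf.phi_add_one h1 hτ) (fun z => ?_) ?_ z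
  · rw [hf.phi_add_self h1 hτ]; congr 2; push_cast; ring
  · have := h2 τ hτ
    rw [h0 τ hτ, hν] at this
    rwa [show 2 * (3 * m) = 6 * m by ring]

theorem phi_zero_of_odd (hk : Odd k) (hν : ν + 3 = 6 * m) (h0 : ∀ τ, 0 < τ.im → c τ = 0) :
    VanishesTo f (m + 1) := by
  obtain ⟨φ, h1, h2⟩ := hc
  refine hf.vanishesTo_succ_of_phi h1 fun τ z hτ => ?_
  refine theta_odd_eq_zero hτ (m := m) (hf.phi_differentiable h1 hτ)
    (hf.phi_add_one h1 hτ) (hf.phi_add_self h1 hτ) (fun z => ?_) hν (h0 τ hτ ▸ h2 τ hτ) z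
  rw [hf.phi_neg h1 hτ, hk.neg_one_pow]; ring

omit hc in
theorem eq_zero_of_vanishesTo (hv : ∀ m, VanishesTo f m) {τ z W : ℂ} (h : Dom τ z W) :
    f τ z W = 0 := by
  have h1 := (Dom.iff_lt h.1).1 h
  obtain ⟨b, hb1, hb2⟩ := exists_between h1
  obtain ⟨C, hC⟩ := hf.bound_line 0 (K := {(τ, z)}) isCompact_singleton (b := b) (by
    rintro p rfl V hV; exact (Dom.iff_lt h.1).2 (by rw [hV]; exact hb1))
  have hC : ∀ V : ℂ, V.im = b → ‖f τ z V‖ ≤ C := fun V hV => by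
    simpa [ee_zero] using hC (τ, z) rfl V hV
  have key : ∀ m : ℕ, ‖f τ z W‖ ≤ C * Real.exp (-(2 * Real.pi * (W.im - b))) ^ m := by
    intro m
    have h2 := hf.le_of_vanishesTo (hv m) h.1 hb1 (C := C * Real.exp (2 * Real.pi * (m * b)))
      (fun V hV => by
        rw [norm_mul, norm_ee]
        have : -(2 * Real.pi * (-(m * V)).im) = 2 * Real.pi * (m * b) := by simp [hV]
        rw [this]; gcongr; exact hC V hV) hb2.le
    rw [norm_mul, norm_ee, ← le_div_iff₀ (Real.exp_pos _), mul_div_assoc, ← Real.exp_sub] at h2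
    rw [← Real.exp_nat_mul]
    refine h2.trans_eq ?_
    congr 2
    have : (-((m : ℂ) * W)).im = -(m * W.im) := by simp
    rw [this]; ring
  have hr : Real.exp (-(2 * Real.pi * (W.im - b))) < 1 := by
    rw [Real.exp_lt_one_iff]; have := Real.pi_pos; have := sub_pos.2 hb2; simp; positivity
  have hlim := (tendsto_pow_atTop_nhds_zero_of_lt_one (Real.exp_pos _).le hr).const_mul C
  rw [mul_zero] at hlim
  have := ge_of_tendsto' hlim key
  exact norm_le_zero_iff.1 this

end lead
end Laws

section levelOne

open scoped UpperHalfPlane MatrixGroups ModularForm Manifold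

/-- A holomorphic function on the upper half plane that transforms like a modular form of weight
`w` and level one and is `O(q ^ m)` at the cusp. -/
structure LevOne (m w : ℕ) (c : ℂ → ℂ) : Prop where
  hol : DifferentiableOn ℂ c {τ | 0 < τ.im}
  per : ∀ τ, 0 < τ.im → c (τ + 1) = c τ
  inv : ∀ τ, 0 < τ.im → c (-1 / τ) = τ ^ w * c τ
  bdd : ∃ C B, ∀ τ : ℂ, B ≤ τ.im → ‖c τ * ee (-(m * τ))‖ ≤ C

/-- The discriminant as a function of a complex variable. -/
def dlt (τ : ℂ) : ℂ := ModularForm.eta τ ^ 24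

theorem dlt_ne_zero {τ : ℂ} (hτ : 0 < τ.im) : dlt τ ≠ 0 :=
  pow_ne_zero _ (ModularForm.eta_ne_zero hτ)

theorem denom_modular_T (z : ℍ) : UpperHalfPlane.denom ModularGroup.T z = 1 := by
  rw [ModularGroup.denom_apply]
  simp [ModularGroup.T]

theorem slash_S_T {w : ℕ} {c : ℂ → ℂ} (h1 : ∀ τ, 0 < τ.im → c (τ + 1) = c τ)
    (h2 : ∀ τ, 0 < τ.im → c (-1 / τ) = τ ^ w * c τ) (γ : SL(2, ℤ)) :
    (fun τ : ℍ => c τ) ∣[(w : ℤ)] γ = fun τ : ℍ => c τ := by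
  refine SlashInvariantForm.slash_action_generators_SL2Z ?_ ?_ γ
  · ext z
    rw [ModularForm.SL_slash_apply, UpperHalfPlane.modular_S_smul]
    have := h2 z z.2
    have hz := z.ne_zero
    rw [ModularGroup.denom_S]
    have e : (UpperHalfPlane.mk (-(z : ℂ))⁻¹ z.im_inv_neg_coe_pos : ℂ) = -1 / z := by
      change (-(z : ℂ))⁻¹ = _
      rw [inv_neg, neg_div, one_div]
    rw [e, this]
    simp
    field_simp
  · ext z
    rw [ModularForm.SL_slash_apply, UpperHalfPlane.modular_T_smul]
    have := h1 z z.2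
    rw [denom_modular_T, UpperHalfPlane.coe_vadd, add_comm]
    simp [this]

theorem slash_apply_S {w : ℕ} {f : ℍ → ℂ} (h : f ∣[(w : ℤ)] ModularGroup.S = f) (τ : ℍ) :
    f (UpperHalfPlane.mk (-(τ : ℂ))⁻¹ τ.im_inv_neg_coe_pos) = (τ : ℂ) ^ w * f τ := by
  have := congrFun h τ
  rw [ModularForm.SL_slash_apply, UpperHalfPlane.modular_S_smul] at this
  have hz := τ.ne_zero
  rw [← this, ModularGroup.denom_S, mul_left_comm]
  simp [hz]

theorem slash_apply_T {w : ℕ} {f : ℍ → ℂ} (h : f ∣[(w : ℤ)] ModularGroup.T = f) (τ : ℍ) :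
    f ((1 : ℝ) +ᵥ τ) = f τ := by
  have := congrFun h τ
  rw [ModularForm.SL_slash_apply, UpperHalfPlane.modular_T_smul] at this
  rw [← this, denom_modular_T]
  simp

theorem ofComplex_eq {τ : ℂ} (hτ : 0 < τ.im) : UpperHalfPlane.ofComplex τ = ⟨τ, hτ⟩ :=
  UpperHalfPlane.ofComplex_apply_of_im_pos hτ

theorem per_of_slash {w : ℕ} {f : ℍ → ℂ} (h : f ∣[(w : ℤ)] ModularGroup.T = f) {τ : ℂ}
    (hτ : 0 < τ.im) : f (UpperHalfPlane.ofComplex (τ + 1)) = f (UpperHalfPlane.ofComplex τ) := by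
  have h1 : 0 < (τ + 1).im := by simpa using hτ
  rw [ofComplex_eq hτ, ofComplex_eq h1, ← slash_apply_T h ⟨τ, hτ⟩]
  congr 1
  ext
  rw [UpperHalfPlane.coe_vadd]
  change τ + 1 = _ + τ
  simp [add_comm]

theorem inv_of_slash {w : ℕ} {f : ℍ → ℂ} (h : f ∣[(w : ℤ)] ModularGroup.S = f) {τ : ℂ}
    (hτ : 0 < τ.im) :
    f (UpperHalfPlane.ofComplex (-1 / τ)) = τ ^ w * f (UpperHalfPlane.ofComplex τ) := by
  rw [ofComplex_eq hτ, ofComplex_eq (im_neg_one_div_pos hτ)]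
  have := slash_apply_S h ⟨τ, hτ⟩
  rw [← this]
  congr 1
  ext
  change -1 / τ = (-τ)⁻¹
  rw [inv_neg, neg_div, one_div]

theorem dlt_add_one {τ : ℂ} (hτ : 0 < τ.im) : dlt (τ + 1) = dlt τ := by
  have := per_of_slash (w := 12) ModularForm.discriminant_T_invariant hτ
  rwa [ofComplex_eq hτ, ofComplex_eq (by simpa using hτ)] at this

theorem dlt_inv {τ : ℂ} (hτ : 0 < τ.im) : dlt (-1 / τ) = τ ^ 12 * dlt τ := by
  have := inv_of_slash (w := 12) ModularForm.discriminant_S_invariant hτ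
  rwa [ofComplex_eq hτ, ofComplex_eq (im_neg_one_div_pos hτ)] at this

theorem dlt_differentiableOn : DifferentiableOn ℂ dlt {τ | 0 < τ.im} := fun _ hz =>
  ((ModularForm.differentiableAt_eta_of_mem_upperHalfPlaneSet hz).pow 24).differentiableWithinAt

theorem dlt_lower_bound :
    ∃ C B : ℝ, 0 < B ∧ ∀ τ : ℂ, B ≤ τ.im → ‖ee τ‖ ≤ C * ‖dlt τ‖ := by
  obtain ⟨C, hC⟩ := ModularForm.exp_isBigO_discriminant.bound
  rw [UpperHalfPlane.atImInfty_basis.eventually_iff] at hC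
  obtain ⟨B, -, hB⟩ := hC
  refine ⟨C, max B 1, by positivity, fun τ hτ => ?_⟩
  have h0 : 0 < τ.im := lt_of_lt_of_le (by positivity) hτ
  have := hB (x := ⟨τ, h0⟩) (le_trans (le_max_left _ _) hτ)
  rw [norm_ee]
  rw [Real.norm_of_nonneg (Real.exp_pos _).le] at this
  refine le_trans (le_of_eq ?_) this
  congr 1
  simp

namespace LevOne

variable {m w : ℕ} {c c' : ℂ → ℂ}

theorem sub (h : LevOne m w c) (h' : LevOne m w c') : LevOne m w fun τ => c τ - c' τ := by
  refine ⟨h.hol.sub h'.hol, fun τ hτ => by rw [h.per τ hτ, h'.per τ hτ], fun τ hτ => by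
    rw [h.inv τ hτ, h'.inv τ hτ]; ring, ?_⟩
  obtain ⟨C, B, hC⟩ := h.bdd
  obtain ⟨C', B', hC'⟩ := h'.bdd
  refine ⟨C + C', max B B', fun τ hτ => ?_⟩
  rw [sub_mul]
  exact (norm_sub_le _ _).trans (add_le_add (hC τ (le_trans (le_max_left _ _) hτ))
    (hC' τ (le_trans (le_max_right _ _) hτ)))

theorem const_mul (a : ℂ) (h : LevOne m w c) : LevOne m w fun τ => a * c τ := by
  refine ⟨h.hol.const_mul a, fun τ hτ => by rw [h.per τ hτ], fun τ hτ => by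
    rw [h.inv τ hτ]; ring, ?_⟩
  obtain ⟨C, B, hC⟩ := h.bdd
  refine ⟨‖a‖ * C, B, fun τ hτ => ?_⟩
  rw [mul_assoc, norm_mul]
  gcongr
  exact hC τ hτ

theorem mul {m' w' : ℕ} (h : LevOne m w c) (h' : LevOne m' w' c') :
    LevOne (m + m') (w + w') fun τ => c τ * c' τ := by
  refine ⟨h.hol.mul h'.hol, fun τ hτ => by rw [h.per τ hτ, h'.per τ hτ], fun τ hτ => by
    rw [h.inv τ hτ, h'.inv τ hτ]; ring, ?_⟩
  obtain ⟨C, B, hC⟩ := h.bdd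
  obtain ⟨C', B', hC'⟩ := h'.bdd
  refine ⟨C * C', max B B', fun τ hτ => ?_⟩
  have h1 := hC τ (le_trans (le_max_left _ _) hτ)
  have h2 := hC' τ (le_trans (le_max_right _ _) hτ)
  have : c τ * c' τ * ee (-(((m + m' : ℕ) : ℂ) * τ))
      = c τ * ee (-(m * τ)) * (c' τ * ee (-(m' * τ))) := by
    rw [show -(((m + m' : ℕ) : ℂ) * τ) = -(m * τ) + -(m' * τ) by push_cast; ring, ee_add]; ring
  rw [this, norm_mul]
  exact mul_le_mul h1 h2 (norm_nonneg _) ((norm_nonneg _).trans h1)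

theorem one : LevOne 0 0 fun _ => 1 :=
  ⟨differentiableOn_const _, fun _ _ => rfl, fun _ _ => by simp, ⟨1, 0, fun τ _ => by
    simp [ee_zero]⟩⟩

theorem pow (h : LevOne 0 w c) (n : ℕ) : LevOne 0 (n * w) fun τ => c τ ^ n := by
  induction n with
  | zero => simpa using one
  | succ n ih => simpa [pow_succ, add_mul] using ih.mul h

theorem tendsto_zero (h : LevOne (m + 1) w c) : Tendsto c (comap Complex.im atTop) (𝓝 0) := by
  obtain ⟨C, B, hC⟩ := h.bdd
  have h1 : Tendsto (fun τ : ℂ => C * Real.exp (-(2 * Real.pi * τ.im))) (comap Complex.im atTop)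
      (𝓝 0) := by
    have : Tendsto (fun y : ℝ => C * Real.exp (-(2 * Real.pi * y))) atTop (𝓝 (C * 0)) :=
      (Real.tendsto_exp_neg_atTop_nhds_zero.comp
        (tendsto_id.const_mul_atTop (by positivity))).const_mul C
    rw [mul_zero] at this
    exact this.comp tendsto_comap
  refine squeeze_zero_norm' ?_ h1
  filter_upwards [preimage_mem_comap (Ici_mem_atTop (max B 0))] with τ hτ
  have hB : B ≤ τ.im := le_trans (le_max_left _ _) hτ
  have h0 : 0 ≤ τ.im := le_trans (le_max_right _ _) hτ
  have e : c τ = c τ * ee (-(((m + 1 : ℕ) : ℂ) * τ)) * ee (((m + 1 : ℕ) : ℂ) * τ) := by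
    rw [mul_assoc, ← ee_add, neg_add_cancel, ee_zero, mul_one]
  rw [e, norm_mul]
  have h2 := hC τ hB
  refine mul_le_mul h2 ?_ (norm_nonneg _) ((norm_nonneg _).trans h2)
  rw [norm_ee, Real.exp_le_exp]
  have := Real.pi_pos
  have e2 : ((((m + 1 : ℕ) : ℂ)) * τ).im = (m + 1) * τ.im := by
    rw [Complex.mul_im]; simp
  rw [e2]
  have h3 : 0 ≤ m * τ.im := by positivity
  nlinarith [mul_nonneg this.le h3]

theorem mdiff (h : LevOne m w c) : MDiff (fun τ : ℍ => c τ) := by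
  rw [UpperHalfPlane.mdifferentiable_iff]
  refine h.hol.congr fun z hz => ?_
  simp only [Function.comp]
  rw [ofComplex_eq hz]

theorem exists_modularForm (h : LevOne 0 w c) :
    ∃ f : ModularForm 𝒮ℒ w, ∀ τ : ℍ, f τ = c τ := by
  refine ⟨{ toFun := fun τ => c τ, slash_action_eq' := ?_, holo' := h.mdiff,
            bdd_at_cusps' := ?_ }, fun τ => rfl⟩
  · rintro A ⟨A, rfl⟩
    exact slash_S_T h.per h.inv A
  · intro x hx
    rw [Subgroup.IsArithmetic.isCusp_iff_isCusp_SL2Z] at hx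
    rw [OnePoint.isBoundedAt_iff_forall_SL2Z hx]
    intro γ _
    rw [slash_S_T h.per h.inv, UpperHalfPlane.isBoundedAtImInfty_iff]
    obtain ⟨C, B, hC⟩ := h.bdd
    exact ⟨C, B, fun z hz => by simpa [ee_zero] using hC z hz⟩

theorem exists_cuspForm (h : LevOne m w c) (h0 : Tendsto c (comap Complex.im atTop) (𝓝 0)) :
    ∃ f : CuspForm 𝒮ℒ w, ∀ τ : ℍ, f τ = c τ := by
  refine ⟨{ toFun := fun τ => c τ, slash_action_eq' := ?_, holo' := h.mdiff,
            zero_at_cusps' := ?_ }, fun τ => rfl⟩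
  · rintro A ⟨A, rfl⟩
    exact slash_S_T h.per h.inv A
  · intro x hx
    rw [Subgroup.IsArithmetic.isCusp_iff_isCusp_SL2Z] at hx
    rw [OnePoint.isZeroAt_iff_forall_SL2Z hx]
    intro γ _
    change UpperHalfPlane.IsZeroAtImInfty ((fun τ : ℍ => c τ) ∣[(w : ℤ)] γ)
    rw [slash_S_T h.per h.inv]
    exact h0.comp UpperHalfPlane.tendsto_coe_atImInfty

theorem of_modularForm (f : ModularForm 𝒮ℒ w) :
    LevOne 0 w fun τ => f (UpperHalfPlane.ofComplex τ) := by
  have hs : ∀ γ : SL(2, ℤ), (f : ℍ → ℂ) ∣[(w : ℤ)] γ = f := fun γ =>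
    f.slash_action_eq' _ ⟨γ, rfl⟩
  refine ⟨UpperHalfPlane.mdifferentiable_iff.1 f.holo', fun τ hτ => per_of_slash (hs _) hτ,
    fun τ hτ => inv_of_slash (hs _) hτ, ?_⟩
  obtain ⟨C, B, hC⟩ := UpperHalfPlane.isBoundedAtImInfty_iff.1 (ModularFormClass.bdd_at_infty f)
  refine ⟨C, max B 1, fun τ hτ => ?_⟩
  have h0 : 0 < τ.im := lt_of_lt_of_le (by positivity) hτ
  have := hC ⟨τ, h0⟩ (le_trans (le_max_left _ _) hτ)
  rw [ofComplex_eq h0]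
  simpa [ee_zero] using this

theorem eq_zero_of_lt (h : LevOne m w c) (h0 : Tendsto c (comap Complex.im atTop) (𝓝 0))
    (hw : w < 12) {τ : ℂ} (hτ : 0 < τ.im) : c τ = 0 := by
  obtain ⟨f, hf⟩ := h.exists_cuspForm h0
  have := rank_zero_iff_forall_zero.1
    (CuspForm.rank_eq_zero_of_weight_lt_twelve (k := w) (by exact_mod_cast hw)) f
  have h1 := hf ⟨τ, hτ⟩
  rw [this] at h1
  exact h1.symm

theorem cusp_div (h : LevOne m w c) (h0 : Tendsto c (comap Complex.im atTop) (𝓝 0)) {d : ℕ}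
    (hw : w = d + 12) : ∃ g, LevOne 0 d g ∧ ∀ τ, 0 < τ.im → c τ = dlt τ * g τ := by
  obtain ⟨f, hf⟩ := h.exists_cuspForm h0
  have hd : (w : ℤ) - 12 = d := by omega
  have key : ∃ g : ModularForm 𝒮ℒ d, ∀ τ : ℍ, f τ = ModularForm.discriminant τ * g τ := by
    rw [← hd]
    refine ⟨CuspForm.discriminantEquiv f, fun τ => ?_⟩
    rw [CuspForm.discriminantEquiv_apply, mul_div_cancel₀ _ (ModularForm.discriminant_ne_zero τ)]
  obtain ⟨g, hg⟩ := key
  refine ⟨_, of_modularForm g, fun τ hτ => ?_⟩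
  rw [ofComplex_eq hτ]
  have := hg ⟨τ, hτ⟩
  rw [hf] at this
  exact this

theorem div (h : LevOne (m + 1) w c) {d : ℕ} (hw : w = d + 12) :
    LevOne m d fun τ => c τ / dlt τ := by
  refine ⟨h.hol.div dlt_differentiableOn fun τ hτ => dlt_ne_zero hτ, fun τ hτ => by
    rw [h.per τ hτ, dlt_add_one hτ], fun τ hτ => ?_, ?_⟩
  · have h0 : τ ≠ 0 := fun h => by simp [h] at hτ
    have := dlt_ne_zero hτ
    rw [h.inv τ hτ, dlt_inv hτ, hw, pow_add]
    field_simp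
  · obtain ⟨C, B, hC⟩ := h.bdd
    obtain ⟨C', B', hB', hC'⟩ := dlt_lower_bound
    refine ⟨C * C', max B B', fun τ hτ => ?_⟩
    have h1 := hC τ (le_trans (le_max_left _ _) hτ)
    have h2 := hC' τ (le_trans (le_max_right _ _) hτ)
    have hne := dlt_ne_zero (lt_of_lt_of_le hB' (le_trans (le_max_right _ _) hτ))
    have e : c τ / dlt τ * ee (-(m * τ))
        = c τ * ee (-(((m + 1 : ℕ) : ℂ) * τ)) * (ee τ / dlt τ) := by
      rw [show -((m : ℂ) * τ) = -(((m + 1 : ℕ) : ℂ) * τ) + τ by push_cast; ring, ee_add]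
      ring
    rw [e, norm_mul, norm_div]
    refine mul_le_mul h1 ?_ (by positivity) ((norm_nonneg _).trans h1)
    rwa [div_le_iff₀ (norm_pos_iff.2 hne)]

theorem div_pow (h : LevOne m w c) :
    (∀ τ, 0 < τ.im → c τ = 0) ∨
      ∃ d g, w = d + 12 * m ∧ LevOne 0 d g ∧ ∀ τ, 0 < τ.im → c τ = dlt τ ^ m * g τ := by
  induction m generalizing w c with
  | zero => exact .inr ⟨w, c, by simp, h, fun τ _ => by simp⟩
  | succ m ih =>
    by_cases hw : w < 12
    · exact .inl fun τ hτ => h.eq_zero_of_lt h.tendsto_zero hw hτ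
    obtain ⟨d, hd⟩ : ∃ d, w = d + 12 := ⟨w - 12, by omega⟩
    rcases ih (h.div hd) with h1 | ⟨d', g, h1, h2, h3⟩
    · refine .inl fun τ hτ => ?_
      simpa [dlt_ne_zero hτ] using h1 τ hτ
    · refine .inr ⟨d', g, by omega, h2, fun τ hτ => ?_⟩
      rw [pow_succ, mul_right_comm, ← h3 τ hτ, div_mul_cancel₀ _ (dlt_ne_zero hτ)]

theorem eq_zero_of_odd (h : LevOne 0 w c) (hw : Odd w) {τ : ℂ} (hτ : 0 < τ.im) : c τ = 0 := by
  obtain ⟨f, hf⟩ := h.exists_modularForm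
  have h1 := hf ⟨τ, hτ⟩
  rw [ModularForm.levelOne_odd_weight_eq_zero (by exact_mod_cast hw) f] at h1
  exact h1.symm

theorem eq_zero_of_two (h : LevOne 0 2 c) {τ : ℂ} (hτ : 0 < τ.im) : c τ = 0 := by
  obtain ⟨f, hf⟩ := h.exists_modularForm
  have h1 := hf ⟨τ, hτ⟩
  rw [rank_zero_iff_forall_zero.1 ModularForm.levelOne_weight_two_rank_zero f] at h1
  exact h1.symm

theorem exists_tendsto (h : LevOne 0 w c) : ∃ a, Tendsto c (comap Complex.im atTop) (𝓝 a) := by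
  obtain ⟨C, B, hC⟩ := h.bdd
  obtain ⟨l, hl, -⟩ := exists_lim (a := 0) h.hol h.per
    ⟨C, B, fun τ hτ => by simpa [ee_zero] using hC τ hτ⟩
  exact ⟨l, hl⟩

end LevOne
end levelOne

section levelOneInduction

open scoped UpperHalfPlane MatrixGroups ModularForm Manifold

namespace LevOne

theorem exists_smul_eq {w : ℕ} (hr : Module.rank ℂ (ModularForm 𝒮ℒ w) = 1) {A : ℂ → ℂ} {a : ℂ}
    (hA : LevOne 0 w A) (ha : Tendsto A (comap Complex.im atTop) (𝓝 a)) (ha0 : a ≠ 0)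
    (g : ModularForm 𝒮ℒ w) : ∃ e : ℂ, ∀ τ : ℍ, g τ = e * A τ := by
  obtain ⟨f, hf⟩ := hA.exists_modularForm
  have hf0 : f ≠ 0 := by
    rintro rfl
    refine ha0 (tendsto_nhds_unique (ha.comp UpperHalfPlane.tendsto_coe_atImInfty)
      (tendsto_const_nhds.congr fun τ => ?_))
    exact hf τ
  obtain ⟨e, he⟩ := (finrank_eq_one_iff_of_nonzero' f hf0).1
    (Module.rank_eq_one_iff_finrank_eq_one.1 hr) g
  refine ⟨e, fun τ => ?_⟩
  rw [← he, ← hf]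
  rfl

theorem dlt_eq {A B : ℂ → ℂ} {a b : ℂ} (hA : LevOne 0 4 A) (hB : LevOne 0 6 B)
    (ha : Tendsto A (comap Complex.im atTop) (𝓝 a)) (ha0 : a ≠ 0)
    (hb : Tendsto B (comap Complex.im atTop) (𝓝 b)) (hb0 : b ≠ 0) :
    ∃ e e' : ℂ, ∀ τ, 0 < τ.im → dlt τ = e * A τ ^ 3 + e' * B τ ^ 2 := by
  obtain ⟨e, he⟩ := exists_smul_eq ModularForm.levelOne_weight_four_rank_one hA ha ha0
    ModularForm.E₄
  obtain ⟨e', he'⟩ := exists_smul_eq ModularForm.levelOne_weight_six_rank_one hB hb hb0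
    ModularForm.E₆
  refine ⟨e ^ 3 / 1728, -(e' ^ 2 / 1728), fun τ hτ => ?_⟩
  have h := ModularForm.discriminant_eq_E₄_cube_sub_E₆_sq ⟨τ, hτ⟩
  rw [he, he'] at h
  change dlt τ = _ at h
  rw [h]
  ring

theorem induction {A B : ℂ → ℂ} {a b : ℂ} (hA : LevOne 0 4 A) (hB : LevOne 0 6 B)
    (ha : Tendsto A (comap Complex.im atTop) (𝓝 a)) (ha0 : a ≠ 0)
    (hb : Tendsto B (comap Complex.im atTop) (𝓝 b)) (hb0 : b ≠ 0)
    {p : ℕ → (ℂ → ℂ) → Prop}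
    (hcongr : ∀ w c c', p w c → (∀ τ, 0 < τ.im → c τ = c' τ) → p w c')
    (hpA : p 4 A) (hpB : p 6 B) (hone : p 0 fun _ => 1)
    (hmul : ∀ w w' c c', p w c → p w' c' → p (w + w') fun τ => c τ * c' τ)
    (hadd : ∀ w c c', p w c → p w c' → p w fun τ => c τ + c' τ)
    (hconst : ∀ w c, ∀ x : ℂ, p w c → p w fun τ => x * c τ) (hzero : ∀ w, p w fun _ => 0)
    {w : ℕ} {h : ℂ → ℂ} (hh : LevOne 0 w h) : p w h := by
  have hpow : ∀ w c, p w c → ∀ n : ℕ, p (n * w) fun τ => c τ ^ n := fun w c hc n => by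
    induction n with
    | zero => simpa using hone
    | succ n ih => simpa [pow_succ, add_mul] using hmul _ _ _ _ ih hc
  have hdlt : p 12 dlt := by
    obtain ⟨e, e', he⟩ := dlt_eq hA hB ha ha0 hb hb0
    exact hcongr _ _ _ (hadd _ _ _ (hconst _ _ e (hpow _ _ hpA 3))
      (hconst _ _ e' (hpow _ _ hpB 2))) fun τ hτ => (he τ hτ).symm
  induction w using Nat.strong_induction_on generalizing h with
  | _ w ih =>
    rcases Nat.even_or_odd w with hw | hw
    swap
    · exact hcongr _ _ _ (hzero w) fun τ hτ => (hh.eq_zero_of_odd hw hτ).symm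
    by_cases h2 : w = 2
    · subst h2
      exact hcongr _ _ _ (hzero 2) fun τ hτ => (hh.eq_zero_of_two hτ).symm
    obtain ⟨i, j, hij⟩ : ∃ i j, w = i * 4 + j * 6 := by
      obtain ⟨r, rfl⟩ := hw
      rcases Nat.even_or_odd r with ⟨s, rfl⟩ | ⟨s, rfl⟩
      · exact ⟨s, 0, by omega⟩
      · exact ⟨s - 1, 1, by omega⟩
    have hM := (hA.pow i).mul (hB.pow j)
    have hpM := hmul _ _ _ _ (hpow _ _ hpA i) (hpow _ _ hpB j)
    rw [← hij] at hM hpM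
    have hMlim := (ha.pow i).mul (hb.pow j)
    set M : ℂ → ℂ := fun τ => A τ ^ i * B τ ^ j with hMdef
    have hμ : a ^ i * b ^ j ≠ 0 := mul_ne_zero (pow_ne_zero _ ha0) (pow_ne_zero _ hb0)
    obtain ⟨l, hl⟩ := hh.exists_tendsto
    set x := l / (a ^ i * b ^ j) with hx
    have hD := hh.sub (hM.const_mul x)
    have hDlim : Tendsto (fun τ => h τ - x * M τ) (comap Complex.im atTop) (𝓝 0) := by
      have := hl.sub (hMlim.const_mul x)
      rwa [hx, div_mul_cancel₀ _ hμ, sub_self] at this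
    have key : p w fun τ => h τ - x * M τ := by
      by_cases hw12 : w < 12
      · exact hcongr _ _ _ (hzero w) fun τ hτ => (hD.eq_zero_of_lt hDlim hw12 hτ).symm
      · obtain ⟨d, hd⟩ : ∃ d, w = 12 + d := ⟨w - 12, by omega⟩
        obtain ⟨g, hg, hg'⟩ := hD.cusp_div hDlim (d := d) (by omega)
        have := hmul _ _ _ _ hdlt (ih d (by omega) hg)
        rw [← hd] at this
        exact hcongr _ _ _ this fun τ hτ => (hg' τ hτ).symm
    exact hcongr _ _ _ (hadd _ _ _ key (hconst _ _ x hpM)) fun τ _ => by ring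

end LevOne
end levelOneInduction

section ring

namespace Laws

variable {k k' : ℕ} {f g : ℂ → ℂ → ℂ → ℂ}

theorem one : Laws 0 fun _ _ _ => 1 :=
  ⟨differentiableOn_const _, fun _ _ _ _ => rfl, fun _ _ _ _ => rfl, fun _ _ _ _ => rfl,
    fun _ _ _ _ => rfl, fun _ _ _ _ => by simp, fun _ _ _ _ => by simp, fun _ _ _ _ => rfl⟩

theorem zero (k : ℕ) : Laws k fun _ _ _ => 0 :=
  ⟨differentiableOn_const _, fun _ _ _ _ => rfl, fun _ _ _ _ => rfl, fun _ _ _ _ => rfl,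
    fun _ _ _ _ => rfl, fun _ _ _ _ => by simp, fun _ _ _ _ => by simp, fun _ _ _ _ => rfl⟩

theorem mul (hf : Laws k f) (hg : Laws k' g) : Laws (k + k') fun τ z W => f τ z W * g τ z W where
  hol := hf.hol.mul hg.hol
  pert τ z W h := by rw [hf.pert _ _ _ h, hg.pert _ _ _ h]
  perz τ z W h := by rw [hf.perz _ _ _ h, hg.perz _ _ _ h]
  perw τ z W h := by rw [hf.perw _ _ _ h, hg.perw _ _ _ h]
  jac τ z W h := by rw [hf.jac _ _ _ h, hg.jac _ _ _ h]
  inv τ z W h := by rw [hf.inv _ _ _ h, hg.inv _ _ _ h]; ring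
  parity τ z W h := by rw [hf.parity _ _ _ h, hg.parity _ _ _ h]; ring
  swap τ z W h := by rw [hf.swap _ _ _ h, hg.swap _ _ _ h]

theorem add (hf : Laws k f) (hg : Laws k g) : Laws k fun τ z W => f τ z W + g τ z W where
  hol := hf.hol.add hg.hol
  pert τ z W h := by rw [hf.pert _ _ _ h, hg.pert _ _ _ h]
  perz τ z W h := by rw [hf.perz _ _ _ h, hg.perz _ _ _ h]
  perw τ z W h := by rw [hf.perw _ _ _ h, hg.perw _ _ _ h]
  jac τ z W h := by rw [hf.jac _ _ _ h, hg.jac _ _ _ h]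
  inv τ z W h := by rw [hf.inv _ _ _ h, hg.inv _ _ _ h]; ring
  parity τ z W h := by rw [hf.parity _ _ _ h, hg.parity _ _ _ h]; ring
  swap τ z W h := by rw [hf.swap _ _ _ h, hg.swap _ _ _ h]

theorem sub (hf : Laws k f) (hg : Laws k g) : Laws k fun τ z W => f τ z W - g τ z W where
  hol := hf.hol.sub hg.hol
  pert τ z W h := by rw [hf.pert _ _ _ h, hg.pert _ _ _ h]
  perz τ z W h := by rw [hf.perz _ _ _ h, hg.perz _ _ _ h]
  perw τ z W h := by rw [hf.perw _ _ _ h, hg.perw _ _ _ h]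
  jac τ z W h := by rw [hf.jac _ _ _ h, hg.jac _ _ _ h]
  inv τ z W h := by rw [hf.inv _ _ _ h, hg.inv _ _ _ h]; ring
  parity τ z W h := by rw [hf.parity _ _ _ h, hg.parity _ _ _ h]; ring
  swap τ z W h := by rw [hf.swap _ _ _ h, hg.swap _ _ _ h]

theorem const_mul (x : ℂ) (hf : Laws k f) : Laws k fun τ z W => x * f τ z W where
  hol := hf.hol.const_mul x
  pert τ z W h := by rw [hf.pert _ _ _ h]
  perz τ z W h := by rw [hf.perz _ _ _ h]
  perw τ z W h := by rw [hf.perw _ _ _ h]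
  jac τ z W h := by rw [hf.jac _ _ _ h]
  inv τ z W h := by rw [hf.inv _ _ _ h]; ring
  parity τ z W h := by rw [hf.parity _ _ _ h]; ring
  swap τ z W h := by rw [hf.swap _ _ _ h]

theorem levOne {m ν : ℕ} {c : ℂ → ℂ} (hf : Laws k f) (hc : HasLead f m ν c) :
    LevOne m (k + ν) c :=
  ⟨hf.lead_differentiableOn hc, fun _ hτ => hf.lead_add_one hc hτ,
    fun _ hτ => hf.lead_inv hc hτ, hf.lead_bound hc⟩

end Laws

/-- `f` satisfies the laws in weight `k` and is a polynomial in the functions `G i`. -/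
def InRing (G : Fin 8 → ℂ → ℂ → ℂ → ℂ) (k : ℕ) (f : ℂ → ℂ → ℂ → ℂ) : Prop :=
  Laws k f ∧ ∃ P : MvPolynomial (Fin 8) ℂ, ∀ τ z W, Dom τ z W →
    f τ z W = MvPolynomial.eval (fun i => G i τ z W) P

namespace InRing

variable {G : Fin 8 → ℂ → ℂ → ℂ → ℂ} {k k' : ℕ} {f g : ℂ → ℂ → ℂ → ℂ}

theorem one : InRing G 0 fun _ _ _ => 1 := ⟨Laws.one, 1, fun _ _ _ _ => by simp⟩

theorem zero (k : ℕ) : InRing G k fun _ _ _ => 0 := ⟨Laws.zero k, 0, fun _ _ _ _ => by simp⟩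

theorem gen {i : Fin 8} (h : Laws k (G i)) : InRing G k (G i) :=
  ⟨h, MvPolynomial.X i, fun _ _ _ _ => by simp⟩

theorem mul (hf : InRing G k f) (hg : InRing G k' g) :
    InRing G (k + k') fun τ z W => f τ z W * g τ z W := by
  obtain ⟨hf, P, hP⟩ := hf
  obtain ⟨hg, Q, hQ⟩ := hg
  exact ⟨hf.mul hg, P * Q, fun _ _ _ h => by beta_reduce; rw [hP _ _ _ h, hQ _ _ _ h, map_mul]⟩

theorem add (hf : InRing G k f) (hg : InRing G k g) :
    InRing G k fun τ z W => f τ z W + g τ z W := by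
  obtain ⟨hf, P, hP⟩ := hf
  obtain ⟨hg, Q, hQ⟩ := hg
  exact ⟨hf.add hg, P + Q, fun _ _ _ h => by beta_reduce; rw [hP _ _ _ h, hQ _ _ _ h, map_add]⟩

theorem const_mul (x : ℂ) (hf : InRing G k f) : InRing G k fun τ z W => x * f τ z W := by
  obtain ⟨hf, P, hP⟩ := hf
  exact ⟨hf.const_mul x, MvPolynomial.C x * P, fun _ _ _ h => by simp [hP _ _ _ h]⟩

end InRing

/-- Eight functions whose leading coefficients suffice for the reduction process. -/
structure GenSystem (G : Fin 8 → ℂ → ℂ → ℂ → ℂ) : Prop where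
  four : ∃ i A a, Laws 4 (G i) ∧ HasLead (G i) 0 0 A ∧ Tendsto A (comap Complex.im atTop) (𝓝 a) ∧
    a ≠ 0
  six : ∃ i A a, Laws 6 (G i) ∧ HasLead (G i) 0 0 A ∧ Tendsto A (comap Complex.im atTop) (𝓝 a) ∧
    a ≠ 0
  cusp : ∀ ν ∈ ({0, 1, 2, 3, 4, 6} : Finset ℕ), ∃ i, ∃ κ : ℂ, κ ≠ 0 ∧ Laws (12 - ν) (G i) ∧
    HasLead (G i) 1 ν fun τ => κ * dlt τ

namespace GenSystem

variable {G : Fin 8 → ℂ → ℂ → ℂ → ℂ} (hG : GenSystem G)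
include hG

theorem exists_of_levOne {w : ℕ} {h : ℂ → ℂ} (hh : LevOne 0 w h) :
    ∃ g, InRing G w g ∧ HasLead g 0 0 h := by
  obtain ⟨i, A, a, hA, hA', ha, ha0⟩ := hG.four
  obtain ⟨j, B, b, hB, hB', hb, hb0⟩ := hG.six
  let p : ℕ → (ℂ → ℂ) → Prop := fun w h => ∃ g, InRing G w g ∧ HasLead g 0 0 h
  have hcongr : ∀ w c c', p w c → (∀ τ, 0 < τ.im → c τ = c' τ) → p w c' := by
    rintro w c c' ⟨g, h1, h2⟩ h3
    exact ⟨g, h1, h2.congr_lead h3⟩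
  have hpA : p 4 A := ⟨_, .gen hA, hA'⟩
  have hpB : p 6 B := ⟨_, .gen hB, hB'⟩
  have hone : p 0 fun _ => 1 := ⟨_, .one, HasLead.const 1⟩
  have hmul : ∀ w w' c c', p w c → p w' c' → p (w + w') fun τ => c τ * c' τ := by
    rintro w w' c c' ⟨g, h1, h2⟩ ⟨g', h1', h2'⟩
    have h3 := InRing.mul h1 h1'
    have h4 := HasLead.mul h2 h2'
    exact ⟨_, h3, h4⟩
  have hadd : ∀ w c c', p w c → p w c' → p w fun τ => c τ + c' τ := by
    rintro w c c' ⟨g, h1, h2⟩ ⟨g', h1', h2'⟩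
    exact ⟨_, h1.add h1', h2.add h2'⟩
  have hconst : ∀ w c, ∀ x : ℂ, p w c → p w fun τ => x * c τ := by
    rintro w c x ⟨g, h1, h2⟩
    exact ⟨_, h1.const_mul x, h2.const_mul x⟩
  have hzero : ∀ w, p w fun _ => 0 := fun w => ⟨_, .zero w, HasLead.const 0⟩
  exact LevOne.induction (p := p) (hA.levOne hA') (hB.levOne hB') ha ha0 hb hb0 hcongr hpA hpB
    hone hmul hadd hconst hzero hh

theorem exists_cusp_mul {ν m ν' w : ℕ} (hν : ν ∈ ({0, 1, 2, 3, 4, 6} : Finset ℕ))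
    (h : ∃ w g κ, w + ν' = 12 * m ∧ κ ≠ 0 ∧ InRing G w g ∧
      HasLead g m ν' fun τ => κ * dlt τ ^ m) (hw : w + (ν' + ν) = 12 * (m + 1)) :
    ∃ g κ, κ ≠ 0 ∧ InRing G w g ∧
      HasLead g (m + 1) (ν' + ν) fun τ => κ * dlt τ ^ (m + 1) := by
  obtain ⟨i, κ, hκ, h1, h2⟩ := hG.cusp ν hν
  obtain ⟨w', g, κ', hw', hκ', h3, h4⟩ := h
  have hν12 : ν ≤ 6 := by
    simp at hν; omega
  have e : w = w' + (12 - ν) := by omega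
  subst e
  exact ⟨_, κ' * κ, mul_ne_zero hκ' hκ, h3.mul (.gen h1),
    (h4.mul h2).congr_lead fun τ _ => by ring⟩

theorem exists_cusp_even {m ν w : ℕ} (hν : Even ν) (hle : ν ≤ 6 * m) (hw : w + ν = 12 * m) :
    ∃ g κ, κ ≠ 0 ∧ InRing G w g ∧ HasLead g m ν fun τ => κ * dlt τ ^ m := by
  induction m generalizing ν w with
  | zero =>
    obtain rfl : ν = 0 := by omega
    obtain rfl : w = 0 := by omega
    exact ⟨_, 1, one_ne_zero, .one, (HasLead.const 1).congr_lead fun τ _ => by simp⟩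
  | succ m ih =>
    by_cases h6 : 6 ≤ ν
    · obtain ⟨r, rfl⟩ : ∃ r, ν = r + 6 := ⟨ν - 6, by omega⟩
      have hr : Even r := by rw [Nat.even_add] at hν; exact hν.2 (by decide)
      obtain ⟨g, κ, h1, h2, h3⟩ := ih (ν := r) (w := 12 * m - r) hr (by omega) (by omega)
      exact hG.exists_cusp_mul (by decide) ⟨_, g, κ, by omega, h1, h2, h3⟩ hw
    · obtain ⟨g, κ, h1, h2, h3⟩ := ih (ν := 0) (w := 12 * m) (by decide) (by omega) (by omega)
      have := hG.exists_cusp_mul (ν := ν) (w := w) (by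
        have : ν < 6 := by omega
        interval_cases ν <;> first | decide | exact absurd hν (by decide))
        ⟨_, g, κ, by omega, h1, h2, h3⟩ (by omega)
      rwa [zero_add] at this

theorem exists_cusp_odd {m ν w : ℕ} (hν : Odd ν) (hle : ν + 3 ≤ 6 * m) (hw : w + ν = 12 * m) :
    ∃ g κ, κ ≠ 0 ∧ InRing G w g ∧ HasLead g m ν fun τ => κ * dlt τ ^ m := by
  obtain ⟨m, rfl⟩ : ∃ r, m = r + 1 := ⟨m - 1, by omega⟩
  obtain ⟨r, hr⟩ := hν
  by_cases h1 : ν = 1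
  · subst h1
    obtain ⟨g, κ, h1, h2, h3⟩ := hG.exists_cusp_even (m := m) (ν := 0) (w := 12 * m) (by decide)
      (by omega) (by omega)
    have := hG.exists_cusp_mul (ν := 1) (w := w) (by decide) ⟨_, g, κ, by omega, h1, h2, h3⟩
      (by omega)
    rwa [zero_add] at this
  · obtain ⟨g, κ, h1, h2, h3⟩ := hG.exists_cusp_even (m := m) (ν := ν - 3) (w := 12 * m - (ν - 3))
      ⟨r - 1, by omega⟩ (by omega) (by omega)
    have := hG.exists_cusp_mul (ν := 3) (w := w) (by decide) ⟨_, g, κ, by omega, h1, h2, h3⟩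
      (by omega)
    rwa [show ν - 3 + 3 = ν by omega] at this

/-- A leading coefficient can be removed by subtracting a polynomial in the generators. -/
theorem exists_same_lead {k m ν : ℕ} {f : ℂ → ℂ → ℂ → ℂ} {c : ℂ → ℂ} (hf : Laws k f)
    (hc : HasLead f m ν c) (hle : ν ≤ 6 * m) (hodd : Odd k → 1 ≤ m → ν + 3 ≤ 6 * m) :
    ∃ g, InRing G k g ∧ HasLead (fun τ z W => f τ z W - g τ z W) m ν fun _ => 0 := by
  have trivial_case : (∀ τ, 0 < τ.im → c τ = 0) →
      ∃ g, InRing G k g ∧ HasLead (fun τ z W => f τ z W - g τ z W) m ν fun _ => 0 := fun h0 =>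
    ⟨_, .zero k, by simpa using hc.congr_lead h0⟩
  rcases (hf.levOne hc).div_pow with h0 | ⟨d, h, hd, hh, hch⟩
  · exact trivial_case h0
  rcases Nat.even_or_odd d with he | ho
  swap
  · exact trivial_case fun τ hτ => by rw [hch τ hτ, hh.eq_zero_of_odd ho hτ, mul_zero]
  have hpar : Even (k + ν) := by rw [hd]; exact he.add ⟨6 * m, by ring⟩
  have hcusp : ∃ g κ, κ ≠ 0 ∧ InRing G (12 * m - ν) g ∧
      HasLead g m ν fun τ => κ * dlt τ ^ m := by
    rcases Nat.even_or_odd ν with hν | hν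
    · exact hG.exists_cusp_even hν hle (by omega)
    · have hk : Odd k := by
        by_contra hk
        rw [Nat.not_odd_iff_even] at hk
        exact (Nat.not_even_iff_odd.2 (hk.add_odd hν)) hpar
      refine hG.exists_cusp_odd hν (hodd hk ?_) (by omega)
      obtain ⟨r, hr⟩ := hν
      omega
  obtain ⟨g, κ, hκ, h1, h2⟩ := hcusp
  obtain ⟨g', h3, h4⟩ := hG.exists_of_levOne hh
  have h5 := (h1.mul h3).const_mul κ⁻¹
  rw [show 12 * m - ν + d = k by omega] at h5
  refine ⟨_, h5, ?_⟩
  refine (hc.sub ((h2.mul h4).const_mul κ⁻¹)).congr_lead fun τ hτ => ?_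
  rw [hch τ hτ]
  field_simp
  ring

theorem exists_next {k m ν : ℕ} {f : ℂ → ℂ → ℂ → ℂ} {c : ℂ → ℂ} (hf : Laws k f)
    (hc : HasLead f m ν c) (hle : ν ≤ 6 * m) (hodd : Odd k → 1 ≤ m → ν + 3 ≤ 6 * m) :
    ∃ g, InRing G k g ∧ VanishesTo (fun τ z W => f τ z W - g τ z W) (m + 1) := by
  induction hn : 6 * m - ν generalizing ν f c with
  | zero =>
    obtain ⟨g, h1, h2⟩ := hG.exists_same_lead hf hc hle hodd
    exact ⟨g, h1, (hf.sub h1.1).phi_zero_of_even h2 (by omega) fun _ _ => rfl⟩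
  | succ n ih =>
    obtain ⟨g, h1, h2⟩ := hG.exists_same_lead hf hc hle hodd
    by_cases hfin : Odd k ∧ ν + 3 = 6 * m
    · exact ⟨g, h1, (hf.sub h1.1).phi_zero_of_odd h2 hfin.1 hfin.2 fun _ _ => rfl⟩
    obtain ⟨c', h3⟩ := (hf.sub h1.1).lead_next h2 fun _ _ => rfl
    obtain ⟨g', h4, h5⟩ := ih (hf.sub h1.1) h3 (by omega) (fun ho hm => by
      have := hodd ho hm
      have : ν + 3 ≠ 6 * m := fun h => hfin ⟨ho, h⟩
      omega) (by omega)
    exact ⟨_, h1.add h4, by simpa only [sub_sub] using h5⟩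

theorem exists_vanishesTo {k : ℕ} {f : ℂ → ℂ → ℂ → ℂ} (hf : Laws k f) (m : ℕ) :
    ∃ g, InRing G k g ∧ VanishesTo (fun τ z W => f τ z W - g τ z W) m := by
  induction m with
  | zero => exact ⟨_, .zero k, by simpa using hf.vanishesTo_zero⟩
  | succ m ih =>
    obtain ⟨g, h1, h2⟩ := ih
    obtain ⟨c, h3⟩ := (hf.sub h1.1).lead_of_vanishesTo h2
    obtain ⟨g', h4, h5⟩ := hG.exists_next (hf.sub h1.1) h3 (by omega) (fun _ _ => by omega)
    exact ⟨_, h1.add h4, by simpa only [sub_sub] using h5⟩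

omit hG in
theorem vanishesTo_succ_of_large {k m ν : ℕ} {f : ℂ → ℂ → ℂ → ℂ} {c : ℂ → ℂ} (hf : Laws k f)
    (hm : k < 6 * m) (hc : HasLead f m ν c) (hle : ν ≤ 6 * m) : VanishesTo f (m + 1) := by
  have h0 : ∀ ν c, ν ≤ 6 * m → HasLead f m ν c → ∀ τ, 0 < τ.im → c τ = 0 := by
    intro ν c hle hc
    rcases (hf.levOne hc).div_pow with h0 | ⟨d, h, hd, -, -⟩
    · exact h0
    · omega
  induction hn : 6 * m - ν generalizing ν c with
  | zero => exact hf.phi_zero_of_even hc (by omega) (h0 _ _ hle hc)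
  | succ n ih =>
    obtain ⟨c', h3⟩ := hf.lead_next hc (h0 _ _ hle hc)
    exact ih h3 (by omega) (by omega)

omit hG in
theorem _root_.VanishesTo.of_succ {f : ℂ → ℂ → ℂ → ℂ} {m : ℕ} (h : VanishesTo f (m + 1)) :
    VanishesTo f m := by
  intro τ z hτ
  obtain ⟨C, B, hC⟩ := h τ z hτ
  refine ⟨C, max B 0, fun W hW => ?_⟩
  have h1 := hC W ((le_max_left _ _).trans hW)
  have h2 : 0 ≤ W.im := (le_max_right _ _).trans hW
  have e : f τ z W * ee (-(m * W)) = f τ z W * ee (-(((m + 1 : ℕ) : ℂ) * W)) * ee W := by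
    rw [mul_assoc, ← ee_add]; congr 2; push_cast; ring
  rw [e, norm_mul]
  refine le_trans (mul_le_of_le_one_right (norm_nonneg _) ?_) h1
  rw [norm_ee, Real.exp_le_one_iff]
  have := Real.pi_pos
  simp only [Left.neg_nonpos_iff]
  positivity

omit hG in
theorem _root_.Laws.eq_zero_of_vanishesTo_large {k m : ℕ} {f : ℂ → ℂ → ℂ → ℂ} (hf : Laws k f)
    (hm : k < 6 * m) (hv : VanishesTo f m) {τ z W : ℂ} (h : Dom τ z W) : f τ z W = 0 := by
  have up : ∀ j, VanishesTo f (m + j) := fun j => by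
    induction j with
    | zero => exact hv
    | succ j ih =>
      obtain ⟨c, hc⟩ := hf.lead_of_vanishesTo ih
      have hj : k < 6 * (m + j) := by omega
      exact vanishesTo_succ_of_large hf hj hc (Nat.zero_le _)
  have down : ∀ j i, VanishesTo f (i + j) → VanishesTo f i := fun j => by
    induction j with
    | zero => exact fun i h => h
    | succ j ih => exact fun i h => ih i (VanishesTo.of_succ h)
  refine hf.eq_zero_of_vanishesTo (fun i => down m i ?_) h
  rw [add_comm]
  exact up i

theorem exists_polynomial {k : ℕ} {f : ℂ → ℂ → ℂ → ℂ} (hf : Laws k f) :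
    ∃ P : MvPolynomial (Fin 8) ℂ, ∀ τ z W, Dom τ z W →
      f τ z W = MvPolynomial.eval (fun i => G i τ z W) P := by
  obtain ⟨g, ⟨h1, P, hP⟩, h2⟩ := hG.exists_vanishesTo hf (k + 1)
  refine ⟨P, fun τ z W h => ?_⟩
  rw [← hP τ z W h]
  exact sub_eq_zero.1 ((hf.sub h1).eq_zero_of_vanishesTo_large (by omega) h2 h)

end GenSystem
end ring

/-- The restriction of a function on the Hermitian half-space to the divisor attached to `ω`. -/
def restr (F : Matrix (Fin 2) (Fin 2) ℂ → ℂ) (τ z W : ℂ) : ℂ :=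
  F !![τ, (starRingEnd ℂ) (omg 11) * z; omg 11 * z, W]

theorem omg_mul_conj : omg 11 * (starRingEnd ℂ) (omg 11) = 3 := by
  rw [conj_omg]; linear_combination - omg_sq

theorem omg_mem : omg 11 ∈ OK11 := by
  rw [mem_OK11]; exact ⟨0, 1, by simp⟩

theorem mem_HH2_restr {τ z W : ℂ} :
    !![τ, (starRingEnd ℂ) (omg 11) * z; omg 11 * z, W] ∈ HH2 ↔ Dom τ z W := by
  have h : Complex.normSq ((starRingEnd ℂ) (omg 11) * z - (starRingEnd ℂ) (omg 11 * z)) =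
      12 * z.im ^ 2 := by
    have h3 : Complex.normSq (omg 11) = 3 := by
      have := Complex.mul_conj (omg 11)
      rw [omg_mul_conj] at this
      exact_mod_cast this.symm
    rw [map_mul, ← mul_sub, Complex.normSq_mul, Complex.normSq_conj, h3, Complex.sub_conj,
      Complex.normSq_mul]
    simp [Complex.normSq_apply]; ring
  rw [mem_HH2_mk, h, Dom]
  constructor <;> rintro ⟨h1, h2⟩ <;> exact ⟨h1, by linarith⟩

theorem IsSymHMF.laws {k : ℕ} {F : Matrix (Fin 2) (Fin 2) ℂ → ℂ} (hF : IsSymHMF 11 k F) :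
    Laws k (restr F) := by
  have htr : ∀ {τ z W}, Dom τ z W → ∀ (p s b : ℤ),
      restr F (τ + p) (z + b) (W + s) = restr F τ z W := by
    intro τ z W h p s b
    have := hF.1.tr (mem_HH2_restr.2 h) p s (q := (starRingEnd ℂ) (omg 11) * b)
      (OK11.mul_mem (conj_mem_OK11 omg_mem) (int_mem_OK11 b))
    rw [restr, restr, ← this]
    simp [mul_add]
  have hinv : ∀ {τ z W}, Dom τ z W →
      restr F (-1 / τ) (z / τ) (W - 3 * z ^ 2 / τ) = τ ^ k * restr F τ z W := by
    intro τ z W h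
    have := hF.1.inv (mem_HH2_restr.2 h)
    rw [restr, restr, ← this]
    have e : (starRingEnd ℂ) (omg 11) * z * (omg 11 * z) = 3 * z ^ 2 := by
      linear_combination z ^ 2 * omg_mul_conj
    rw [e, mul_div_assoc _ z, mul_div_assoc (omg 11) z]
  have hpar : ∀ {τ z W}, Dom τ z W → restr F τ (-z) W = (-1) ^ k * restr F τ z W := by
    intro τ z W h
    have h0 := ne_zero_of_im_pos h.1
    have hd : Dom (-1 / τ) (z / τ) (W - 3 * z ^ 2 / τ) := by
      have := mem_HH2_inv (mem_HH2_restr.2 h)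
      rwa [show (starRingEnd ℂ) (omg 11) * z * (omg 11 * z) = 3 * z ^ 2 by
        linear_combination z ^ 2 * omg_mul_conj, mul_div_assoc _ z, mul_div_assoc (omg 11) z,
        mem_HH2_restr] at this
    have h1 := hinv hd
    rw [hinv h, ← mul_assoc, ← mul_pow] at h1
    have e1 : -1 / (-1 / τ) = τ := by field_simp
    have e2 : z / τ / (-1 / τ) = -z := by field_simp
    have e3 : W - 3 * z ^ 2 / τ - 3 * (z / τ) ^ 2 / (-1 / τ) = W := by field_simp; ring
    have e4 : -1 / τ * τ = -1 := by field_simp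
    rwa [e1, e2, e3, e4] at h1
  refine ⟨?_, fun τ z W h => ?_, fun τ z W h => ?_, fun τ z W h => ?_, fun τ z W h => ?_,
    fun τ z W h => hinv h, fun τ z W h => hpar h, fun τ z W h => ?_⟩
  · have : Differentiable ℂ fun p : ℂ × ℂ × ℂ =>
        (!![p.1, (starRingEnd ℂ) (omg 11) * p.2.1; omg 11 * p.2.1, p.2.2] :
          Matrix (Fin 2) (Fin 2) ℂ) := by
      refine differentiable_pi.2 fun i => differentiable_pi.2 fun j => ?_
      fin_cases i <;> fin_cases j <;> simp <;> fun_prop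
    exact hF.1.1.comp this.differentiableOn fun p hp => mem_HH2_restr.2 hp
  · simpa using htr h 1 0 0
  · simpa using htr h 0 0 1
  · simpa using htr h 0 1 0
  · have := hF.1.lo (mem_HH2_restr.2 h) omg_mem
    rw [restr, restr, ← this]
    rw [show omg 11 * (starRingEnd ℂ) (omg 11) * τ + (starRingEnd ℂ) (omg 11) * (omg 11 * z) +
      omg 11 * ((starRingEnd ℂ) (omg 11) * z) + W = W + 6 * z + 3 * τ by
        linear_combination (τ + 2 * z) * omg_mul_conj]
    rw [mul_add, mul_add, add_comm (_ * z), add_comm (_ * z)]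
  · have h1 := hF.1.weyl (mem_HH2_restr.2 h)
    have h2 := hF.2 _ (mem_HH2_restr.2 h.swap)
    have h3 := hpar h.swap
    rw [restr, restr] at h3
    rw [restr, restr]
    have e : (!![W, (starRingEnd ℂ) (omg 11) * z; omg 11 * z, τ])ᵀ =
        !![W, omg 11 * z; (starRingEnd ℂ) (omg 11) * z, τ] := by
      ext i j; fin_cases i <;> fin_cases j <;> rfl
    have hd : Dom W (-z) τ := ⟨h.swap.1, by simpa using h.swap.2⟩
    have e2 := hF.2 _ (mem_HH2_restr.2 hd)
    have e3 : (!![W, (starRingEnd ℂ) (omg 11) * -z; omg 11 * -z, τ])ᵀ =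
        !![W, -(omg 11 * z); -((starRingEnd ℂ) (omg 11) * z), τ] := by
      ext i j; fin_cases i <;> fin_cases j <;> simp
    rw [e3, h1, h3, ← mul_assoc, ← mul_pow] at e2
    simpa using e2.symm

theorem phiLam_eq {Z : Matrix (Fin 2) (Fin 2) ℂ} :
    phiLam (omg 11) Z = !![Z 0 0, (starRingEnd ℂ) (omg 11) * Z 0 1; omg 11 * Z 0 1, 3 * Z 1 1] := by
  rw [phiLam, omg_mul_conj]

theorem dom_of_symm {Z : Matrix (Fin 2) (Fin 2) ℂ} (h : Z ∈ HH2) (hs : Zᵀ = Z) :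
    Dom (Z 0 0) (Z 0 1) (3 * Z 1 1) := by
  have e : Z 1 0 = Z 0 1 := congrFun (congrFun hs 0) 1
  rw [mem_HH2_iff] at h
  obtain ⟨h1, h2⟩ := h
  rw [e, Complex.sub_conj, Complex.normSq_mul] at h2
  refine ⟨h1, ?_⟩
  simp [Complex.normSq_apply] at h2 ⊢
  nlinarith

/-- Symmetrization of a Hermitian modular form. -/
theorem IsHMF.symmetrize {k : ℕ} {F : Matrix (Fin 2) (Fin 2) ℂ → ℂ} (hF : IsHMF 11 k F) :
    IsSymHMF 11 k fun Z => F Z + (-1) ^ k * F Zᵀ := by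
  have hT : ∀ t z₁ z₂ w : ℂ, (!![t, z₁; z₂, w])ᵀ = !![t, z₂; z₁, w] := by
    intro t z₁ z₂ w; ext i j; fin_cases i <;> fin_cases j <;> rfl
  have hmem : ∀ {t z₁ z₂ w : ℂ}, !![t, z₁; z₂, w] ∈ HH2 → !![t, z₂; z₁, w] ∈ HH2 := by
    intro t z₁ z₂ w h
    rw [← hT]; exact transpose_mem_HH2 h
  refine ⟨isHMF_of_laws ?_ ?_ ?_ ?_ ?_, fun Z hZ => ?_⟩
  · refine hF.1.add (DifferentiableOn.const_mul (hF.1.comp ?_ fun Z => transpose_mem_HH2) _)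
    refine Differentiable.differentiableOn ?_
    refine differentiable_pi.2 fun i => differentiable_pi.2 fun j => ?_
    simp only [Matrix.transpose_apply]
    fun_prop
  · intro p s q hq t z₁ z₂ w h
    have := hF.tr (hmem h) p s (conj_mem_OK11 hq)
    rw [Complex.conj_conj] at this
    rw [hT, hT, hF.tr h p s hq, this]
  · intro a ha t z₁ z₂ w h
    have := hF.lo (hmem h) (conj_mem_OK11 ha)
    rw [Complex.conj_conj] at this
    rw [hT, hT, hF.lo h ha, ← this]
    congr 6
    ring_nf
  · intro t z₁ z₂ w h
    rw [hT, hT, hF.weyl h, ← hF.weyl (hmem h)]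
  · intro t z₁ z₂ w h
    have := hF.inv (hmem h)
    rw [hT, hT, hF.inv h, mul_comm z₁ z₂, this]
    ring
  · beta_reduce
    rw [Matrix.transpose_transpose, mul_add, ← mul_assoc, ← mul_pow]
    simp [add_comm]

section expSums

/-- A locally normally convergent series of holomorphic functions is holomorphic. -/
theorem differentiableOn_tsum_normal {E ι : Type*} [NormedAddCommGroup E] [NormedSpace ℂ E]
    {U : Set E} (hU : IsOpen U) {f : ι → E → ℂ} (hf : ∀ i, DifferentiableOn ℂ (f i) U)
    (hb : ∀ x ∈ U, ∃ u : ι → ℝ, Summable u ∧ ∀ᶠ y in 𝓝 x, ∀ i, ‖f i y‖ ≤ u i) :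
    DifferentiableOn ℂ (fun x => ∑' i, f i x) U := by
  intro x hx
  obtain ⟨u, hu, hev⟩ := hb x hx
  obtain ⟨r, hr, hball⟩ := Metric.mem_nhds_iff.1 (hev.and (hU.mem_nhds hx))
  have hd : ∀ i, DifferentiableOn ℂ (f i) (Metric.ball x r) := fun i =>
    (hf i).mono fun y hy => (hball hy).2
  have hsub : ∀ y ∈ Metric.ball x (r / 2), Metric.ball y (r / 2) ⊆ Metric.ball x r := by
    intro y hy
    refine Metric.ball_subset_ball' ?_
    rw [Metric.mem_ball] at hy
    linarith
  have hxr : x ∈ Metric.ball x (r / 2) := Metric.mem_ball_self (by positivity)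
  refine (hasFDerivAt_tsum_of_isPreconnected (u := fun i => 2 * u i / (r / 2))
    (f' := fun i y => fderiv ℂ (f i) y) (s := Metric.ball x (r / 2)) (x₀ := x) (f := f)
    ((hu.mul_left 2).div_const _) Metric.isOpen_ball (convex_ball x (r / 2)).isPreconnected
    ?_ ?_ hxr ?_ hxr).differentiableAt.differentiableWithinAt
  · intro i y hy
    have hy' : y ∈ Metric.ball x r := Metric.ball_subset_ball (by linarith) hy
    exact ((hd i).differentiableAt (Metric.isOpen_ball.mem_nhds hy')).hasFDerivAt
  · intro i y hy
    refine Complex.norm_fderiv_le_div_of_mapsTo_ball ((hd i).mono (hsub y hy)) ?_ (by positivity)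
    intro z hz
    have h1 := (hball (hsub y hy hz)).1 i
    have h2 := (hball (Metric.ball_subset_ball (by linarith) hy)).1 i
    rw [mem_closedBall_iff_norm]
    exact (norm_sub_le _ _).trans (by linarith)
  · exact hu.of_norm_bounded fun i => hev.self_of_nhds i

theorem hasSum_prod_fin {n : ℕ} (f : Fin n → ℤ → ℂ) (hf : ∀ i, Summable fun m => ‖f i m‖) :
    (Summable fun v : Fin n → ℤ => ‖∏ i, f i (v i)‖) ∧
      ∑' v : Fin n → ℤ, ∏ i, f i (v i) = ∏ i, ∑' m, f i m := by
  induction n with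
  | zero =>
    refine ⟨(hasSum_fintype _).summable, ?_⟩
    simp
  | succ n ih =>
    obtain ⟨h1, h2⟩ := ih (fun i => f i.succ) fun i => hf i.succ
    have e : ∀ p : ℤ × (Fin n → ℤ), ∏ i, f i ((Fin.consEquiv fun _ => ℤ) p i) =
        f 0 p.1 * ∏ i, f (Fin.succ i) (p.2 i) := by
      intro p
      rw [Fin.prod_univ_succ]
      simp [Fin.consEquiv]
    constructor
    · rw [← (Fin.consEquiv fun _ => ℤ).summable_iff]
      refine ((hf 0).mul_norm h1).congr fun p => ?_
      rw [Function.comp_apply, e]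
    · rw [← (Fin.consEquiv fun _ => ℤ).tsum_eq, Fin.prod_univ_succ, ← h2,
        tsum_mul_tsum_of_summable_norm (hf 0) h1]
      exact tsum_congr e

theorem summable_gauss {a : ℝ} (ha : 0 < a) (C : ℝ) (n : ℕ) :
    Summable fun v : Fin n → ℤ => Real.exp (∑ i, (-a * (v i : ℝ) ^ 2 + C * |(v i : ℝ)|)) := by
  have h1 : Summable fun m : ℤ => ‖((Real.exp (-a * (m : ℝ) ^ 2 + C * |(m : ℝ)|) : ℝ) : ℂ)‖ := by
    have := summable_pow_mul_jacobiTheta₂_term_bound (C / (2 * Real.pi))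
      (T := a / Real.pi) (by positivity) 0
    refine this.congr fun m => ?_
    rw [Complex.norm_real, Real.norm_of_nonneg (Real.exp_pos _).le, pow_zero, one_mul]
    congr 1
    have := Real.pi_pos.ne'
    push_cast
    field_simp
    ring
  refine (hasSum_prod_fin (fun _ : Fin n => fun m : ℤ =>
    ((Real.exp (-a * (m : ℝ) ^ 2 + C * |(m : ℝ)|) : ℝ) : ℂ)) fun _ => h1).1.congr fun v => ?_
  rw [← Complex.ofReal_prod, ← Real.exp_sum, Complex.norm_real,
    Real.norm_of_nonneg (Real.exp_pos _).le]

/-- Absolutely convergent exponential sums with arbitrary growth room. -/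
def ExpSummable {ι : Type*} (c l : ι → ℂ) : Prop :=
  ∀ R : ℝ, Summable fun i => ‖c i‖ * Real.exp (R * ‖l i‖)

namespace ExpSummable

variable {ι : Type*} {c l : ι → ℂ}

theorem mul_pow (h : ExpSummable c l) (n : ℕ) : ExpSummable (fun i => c i * l i ^ n) l := by
  intro R
  refine ((h (R + 1)).mul_left (n.factorial : ℝ)).of_nonneg_of_le (fun i => by positivity)
    fun i => ?_
  have := Real.pow_div_factorial_le_exp ‖l i‖ (norm_nonneg _) n
  rw [div_le_iff₀ (by positivity)] at this
  rw [norm_mul, norm_pow, add_mul, one_mul, Real.exp_add]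
  have := mul_le_mul_of_nonneg_left this (mul_nonneg (norm_nonneg (c i))
    (Real.exp_pos (R * ‖l i‖)).le)
  linarith

theorem summable (h : ExpSummable c l) (s : ℂ) : Summable fun i => c i * Complex.exp (s * l i) := by
  refine Summable.of_norm_bounded (h ‖s‖) fun i => ?_
  rw [norm_mul]
  gcongr
  exact (Complex.norm_exp_le_exp_norm _).trans_eq (by rw [norm_mul])

theorem summable_coeff (h : ExpSummable c l) : Summable c := by simpa using h.summable 0

theorem hasDerivAt (h : ExpSummable c l) (s : ℂ) :
    HasDerivAt (fun s => ∑' i, c i * Complex.exp (s * l i))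
      (∑' i, c i * l i ^ 1 * Complex.exp (s * l i)) s := by
  have hu : Summable fun i => ‖c i * l i ^ 1‖ * Real.exp ((‖s‖ + 1) * ‖l i‖) := h.mul_pow 1 _
  refine hasDerivAt_tsum_of_isPreconnected
    (g := fun i (s : ℂ) => c i * Complex.exp (s * l i))
    (g' := fun i (s : ℂ) => c i * l i ^ 1 * Complex.exp (s * l i)) hu Metric.isOpen_ball
    (convex_ball (0 : ℂ) (‖s‖ + 1)).isPreconnected (y₀ := 0) ?_ ?_
    (Metric.mem_ball_self (by positivity)) (h.summable 0) (by simp)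
  · intro i y _
    have := (((hasDerivAt_id y).mul_const (l i)).cexp).const_mul (c i)
    refine this.congr_deriv ?_
    simp; ring
  · intro i y hy
    rw [mem_ball_zero_iff] at hy
    rw [norm_mul]
    gcongr
    refine (Complex.norm_exp_le_exp_norm _).trans ?_
    rw [norm_mul]
    gcongr

theorem iteratedDeriv (h : ExpSummable c l) (n : ℕ) :
    _root_.iteratedDeriv n (fun s => ∑' i, c i * Complex.exp (s * l i)) =
      fun s => ∑' i, c i * l i ^ n * Complex.exp (s * l i) := by
  induction n with
  | zero => simp
  | succ n ih =>
    rw [iteratedDeriv_succ, ih]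
    funext s
    rw [((h.mul_pow n).hasDerivAt s).deriv]
    refine tsum_congr fun i => ?_
    ring

theorem iteratedDeriv_zero (h : ExpSummable c l) (n : ℕ) :
    _root_.iteratedDeriv n (fun s => ∑' i, c i * Complex.exp (s * l i)) 0 =
      ∑' i, c i * l i ^ n := by
  rw [h.iteratedDeriv]; simp

end ExpSummable

end expSums

/-- The one-variable theta functions with half-integral characteristics. -/
def thetaChar (a b : ℤ) (τ z : ℂ) : ℂ :=
  ∑' n : ℤ, ee (b * n / 2 + (τ * (2 * n + a) ^ 2 / 8 + (2 * n + a) * z / 2))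

theorem thetaChar_term (a b n : ℤ) (τ z : ℂ) :
    ee (b * n / 2 + (τ * (2 * n + a) ^ 2 / 8 + (2 * n + a) * z / 2)) =
      ee (τ * a ^ 2 / 8 + a * z / 2) * jacobiTheta₂_term n (z + a * τ / 2 + b / 2) τ := by
  rw [jacobiTheta₂_term, ee, ee, ← Complex.exp_add]
  congr 1
  ring

theorem thetaChar_eq (a b : ℤ) (τ z : ℂ) : thetaChar a b τ z =
    ee (τ * a ^ 2 / 8 + a * z / 2) * jacobiTheta₂ (z + a * τ / 2 + b / 2) τ := by
  rw [thetaChar, jacobiTheta₂, ← tsum_mul_left]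
  exact tsum_congr fun n => thetaChar_term a b n τ z

theorem jacobiTheta₂_sub_int (a : ℤ) (z τ : ℂ) : jacobiTheta₂ (z - a) τ = jacobiTheta₂ z τ := by
  rw [jacobiTheta₂, jacobiTheta₂]
  refine tsum_congr fun n => ?_
  rw [jacobiTheta₂_term, jacobiTheta₂_term, Complex.exp_eq_exp_iff_exists_int]
  exact ⟨-(n * a), by push_cast; ring⟩

theorem thetaChar_inv (a b : ℤ) {τ : ℂ} (hτ : 0 < τ.im) (z : ℂ) :
    thetaChar a b (-1 / τ) (z / τ) = (-Complex.I * τ) ^ (1 / 2 : ℂ) * ee (z ^ 2 / (2 * τ)) *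
      ee (-(a * b) / 4) * thetaChar b a τ z := by
  have h0 := ne_zero_of_im_pos hτ
  have h1 : (-Complex.I * τ) ^ (1 / 2 : ℂ) ≠ 0 := by
    rw [Complex.cpow_def_of_ne_zero (by simp [h0])]
    exact Complex.exp_ne_zero _
  have h := jacobiTheta₂_functional_equation (z + b * τ / 2 - a / 2) τ
  rw [thetaChar_eq, thetaChar_eq, show z + b * τ / 2 + a / 2 = z + b * τ / 2 - a / 2 - (-a : ℤ) by
    push_cast; ring, jacobiTheta₂_sub_int, h]
  rw [show (z + b * τ / 2 - a / 2) / τ = z / τ + a * (-1 / τ) / 2 + b / 2 by field_simp; ring]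
  have e : ee (-1 / τ * a ^ 2 / 8 + a * (z / τ) / 2) = ee (z ^ 2 / (2 * τ)) *
      ee (-(a * b) / 4) * ee (τ * b ^ 2 / 8 + b * z / 2) *
      Complex.exp (-Real.pi * Complex.I * (z + b * τ / 2 - a / 2) ^ 2 / τ) := by
    simp only [ee, ← Complex.exp_add]
    congr 1
    field_simp
    ring
  rw [e]
  field_simp

/-- The `E₈` lattice, in coordinates multiplied by two. -/
def E8 : AddSubgroup (Fin 8 → ℤ) where
  carrier := {v | (∀ i, 2 ∣ v i - v 0) ∧ 4 ∣ ∑ i, v i}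
  zero_mem' := by simp
  add_mem' := by
    rintro v w ⟨h1, h2⟩ ⟨h3, h4⟩
    refine ⟨fun i => ?_, ?_⟩
    · have := dvd_add (h1 i) (h3 i)
      simpa [add_sub_add_comm] using this
    · simpa [Finset.sum_add_distrib] using dvd_add h2 h4
  neg_mem' := by
    rintro v ⟨h1, h2⟩
    refine ⟨fun i => ?_, ?_⟩
    · have := h1 i
      rw [Pi.neg_apply, Pi.neg_apply]
      omega
    · simpa using h2

theorem mem_E8 {v : Fin 8 → ℤ} : v ∈ E8 ↔ (∀ i, 2 ∣ v i - v 0) ∧ 4 ∣ ∑ i, v i := Iff.rfl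

theorem E8.exists_eq {v : Fin 8 → ℤ} (h : v ∈ E8) :
    ∃ n : Fin 8 → ℤ, (∀ i, v i = 2 * n i + v 0) ∧ 2 ∣ ∑ i, n i := by
  obtain ⟨h1, h2⟩ := h
  choose n hn using h1
  have hn' : ∀ i, v i = 2 * n i + v 0 := fun i => by linarith [hn i]
  refine ⟨n, hn', ?_⟩
  have : ∑ i, v i = 2 * ∑ i, n i + 8 * v 0 := by
    rw [Finset.sum_congr rfl fun i _ => hn' i, Finset.sum_add_distrib, ← Finset.mul_sum]
    simp
  omega

theorem E8.four_dvd {v w : Fin 8 → ℤ} (hv : v ∈ E8) (hw : w ∈ E8) : 4 ∣ v ⬝ᵥ w := by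
  obtain ⟨m, hm, hm2⟩ := E8.exists_eq hv
  obtain ⟨n, hn, hn2⟩ := E8.exists_eq hw
  have : v ⬝ᵥ w = 4 * ∑ i, m i * n i + 2 * w 0 * ∑ i, m i + 2 * v 0 * ∑ i, n i +
      8 * (v 0 * w 0) := by
    rw [dotProduct, Finset.sum_congr rfl fun i _ => by rw [hm i, hn i]]
    simp only [Fin.sum_univ_eight]
    ring
  obtain ⟨a, ha⟩ := hm2
  obtain ⟨b, hb⟩ := hn2
  rw [this, ha, hb]
  exact ⟨∑ i, m i * n i + w 0 * a + v 0 * b + 2 * (v 0 * w 0), by ring⟩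

theorem E8.eight_dvd {v : Fin 8 → ℤ} (hv : v ∈ E8) : 8 ∣ v ⬝ᵥ v := by
  obtain ⟨m, hm, hm2⟩ := E8.exists_eq hv
  have : v ⬝ᵥ v = 4 * ∑ i, m i * (m i - 1) + 4 * ∑ i, m i + 4 * v 0 * ∑ i, m i +
      8 * (v 0 * v 0) := by
    rw [dotProduct, Finset.sum_congr rfl fun i _ => by rw [hm i]]
    simp only [Fin.sum_univ_eight]
    ring
  obtain ⟨a, ha⟩ := hm2
  have h2 : (2 : ℤ) ∣ ∑ i, m i * (m i - 1) :=
    Finset.dvd_sum fun i _ => (Int.even_mul_pred_self (m i)).two_dvd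
  obtain ⟨b, hb⟩ := h2
  rw [this, ha, hb]
  exact ⟨b + a + v 0 * a + v 0 * v 0, by ring⟩

/-- The term of the theta series of `E₈`. -/
def thTerm (τ : ℂ) (Z : Fin 8 → ℂ) (v : Fin 8 → ℤ) : ℂ :=
  ee (τ * (∑ i, (v i : ℂ) ^ 2) / 8 + ∑ i, (v i : ℂ) * Z i / 2)

/-- The Jacobi theta series of the `E₈` lattice. -/
def theta8 (τ : ℂ) (Z : Fin 8 → ℂ) : ℂ := ∑' v : E8, thTerm τ Z v

theorem norm_thTerm (τ : ℂ) (Z : Fin 8 → ℂ) (v : Fin 8 → ℤ) : ‖thTerm τ Z v‖ =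
    Real.exp (∑ i, (-(Real.pi * τ.im / 4) * (v i : ℝ) ^ 2 - Real.pi * (Z i).im * v i)) := by
  rw [thTerm, norm_ee]
  congr 1
  have : (τ * (∑ i, (v i : ℂ) ^ 2) / 8 + ∑ i, (v i : ℂ) * Z i / 2).im =
      τ.im * (∑ i, (v i : ℝ) ^ 2) / 8 + ∑ i, (v i : ℝ) * (Z i).im / 2 := by
    have e1 : (∑ i, (v i : ℂ) ^ 2) = ((∑ i, (v i : ℝ) ^ 2 : ℝ) : ℂ) := by push_cast; rfl
    have e2 : ∀ i, ((v i : ℂ) * Z i / 2).im = (v i : ℝ) * (Z i).im / 2 := by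
      intro i; simp
    rw [Complex.add_im, Complex.im_sum, e1, Finset.sum_congr rfl fun i _ => e2 i]
    congr 1
    rw [show τ * ((∑ i, (v i : ℝ) ^ 2 : ℝ) : ℂ) / 8 = τ * (((∑ i, (v i : ℝ) ^ 2) / 8 : ℝ) : ℂ) by
      push_cast; ring, Complex.im_mul_ofReal]
    ring
  rw [this]
  simp only [Fin.sum_univ_eight]
  ring

theorem ExpSummable.comp_injective {ι κ : Type*} {c l : ι → ℂ} (h : ExpSummable c l) {e : κ → ι}
    (he : Function.Injective e) : ExpSummable (fun j => c (e j)) fun j => l (e j) :=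
  fun R => (h R).comp_injective he

theorem expSummable_thTerm {τ : ℂ} (hτ : 0 < τ.im) (Z : Fin 8 → ℂ) (a : Fin 8 → ℂ) :
    ExpSummable (thTerm τ Z) fun v => 2 * Real.pi * Complex.I * (∑ i, (v i : ℂ) * a i / 2) := by
  intro R
  have hp := Real.pi_pos
  set C : ℝ := ∑ i, (Real.pi * |(Z i).im| + |R| * (Real.pi * ‖a i‖)) with hC
  have hCi : ∀ i, Real.pi * |(Z i).im| + |R| * (Real.pi * ‖a i‖) ≤ C := fun i =>
    Finset.single_le_sum (f := fun i => Real.pi * |(Z i).im| + |R| * (Real.pi * ‖a i‖))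
      (fun j _ => by positivity) (Finset.mem_univ i)
  refine (summable_gauss (a := Real.pi * τ.im / 4) (by positivity) C 8).of_nonneg_of_le
    (fun v => by positivity) fun v => ?_
  rw [norm_thTerm, ← Real.exp_add]
  refine Real.exp_le_exp.2 ?_
  have h1 : R * ‖2 * Real.pi * Complex.I * (∑ i, (v i : ℂ) * a i / 2)‖ ≤
      ∑ i, |R| * (Real.pi * ‖a i‖) * |(v i : ℝ)| := by
    have h2 : ‖∑ i, (v i : ℂ) * a i / 2‖ ≤ ∑ i, |(v i : ℝ)| * ‖a i‖ / 2 := by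
      refine (norm_sum_le _ _).trans_eq (Finset.sum_congr rfl fun i _ => ?_)
      simp
    calc _ ≤ |R| * ‖2 * Real.pi * Complex.I * (∑ i, (v i : ℂ) * a i / 2)‖ := by
          gcongr; exact le_abs_self R
      _ = |R| * (2 * Real.pi) * ‖∑ i, (v i : ℂ) * a i / 2‖ := by
          simp [abs_of_pos hp]; ring
      _ ≤ |R| * (2 * Real.pi) * ∑ i, |(v i : ℝ)| * ‖a i‖ / 2 := by gcongr
      _ = _ := by
          rw [Finset.mul_sum]
          exact Finset.sum_congr rfl fun i _ => by ring
  refine (add_le_add_right h1 _).trans ?_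
  rw [← Finset.sum_add_distrib]
  refine Finset.sum_le_sum fun i _ => ?_
  have h3 : -((Z i).im * (v i : ℝ)) ≤ |(Z i).im| * |(v i : ℝ)| := by
    rw [← abs_mul]; exact neg_le_abs _
  have h4 := mul_le_mul_of_nonneg_right (hCi i) (abs_nonneg (v i : ℝ))
  have h5 := mul_le_mul_of_nonneg_left h3 hp.le
  nlinarith

theorem summable_thTerm {τ : ℂ} (hτ : 0 < τ.im) (Z : Fin 8 → ℂ) :
    Summable fun v => ‖thTerm τ Z v‖ := by
  simpa using expSummable_thTerm hτ Z 0 0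

theorem tsum_E8_eq {τ : ℂ} (hτ : 0 < τ.im) (Z : Fin 8 → ℂ) :
    theta8 τ Z = (1 / 2) * ∑ a : Fin 2, ∑ b : Fin 2, ∏ i, thetaChar a b τ (Z i) := by
  have hinj : Function.Injective fun p : Fin 2 × (Fin 8 → ℤ) =>
      fun i => 2 * p.2 i + (p.1 : ℤ) := by
    rintro ⟨a, m⟩ ⟨b, n⟩ h
    have h0 := fun i => congrFun h i
    simp only at h0
    have ha := a.isLt
    have hb := b.isLt
    have hab : a = b := by
      have := h0 0
      ext; omega
    subst hab
    have : m = n := by funext i; have := h0 i; omega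
    rw [this]
  have hs := summable_thTerm hτ Z
  have hH : theta8 τ Z = ∑' v : Fin 8 → ℤ, (E8 : Set (Fin 8 → ℤ)).indicator (thTerm τ Z) v :=
    tsum_subtype _ _
  have hsupp : Function.support ((E8 : Set (Fin 8 → ℤ)).indicator (thTerm τ Z)) ⊆
      Set.range fun p : Fin 2 × (Fin 8 → ℤ) => fun i => 2 * p.2 i + (p.1 : ℤ) := by
    intro v hv
    have hv : v ∈ E8 := Set.mem_of_indicator_ne_zero hv
    have h1 := hv.1
    refine ⟨⟨⟨(v 0 % 2).toNat, by omega⟩, fun i => (v i - v 0 % 2) / 2⟩, ?_⟩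
    funext i
    have := h1 i
    simp only
    omega
  rw [hH, ← hinj.tsum_eq hsupp]
  have hsum : Summable fun p : Fin 2 × (Fin 8 → ℤ) =>
      (E8 : Set (Fin 8 → ℤ)).indicator (thTerm τ Z) fun i => 2 * p.2 i + (p.1 : ℤ) :=
    Summable.comp_injective (f := (E8 : Set (Fin 8 → ℤ)).indicator (thTerm τ Z))
      (hs.of_norm.indicator _) hinj
  rw [hsum.tsum_prod, tsum_fintype, Finset.mul_sum]
  refine Finset.sum_congr rfl fun a _ => ?_
  have key : ∀ b : Fin 2, (Summable fun n : Fin 8 → ℤ =>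
      ‖∏ i, ee ((b : ℤ) * n i / 2 + (τ * (2 * n i + (a : ℤ)) ^ 2 / 8 +
        (2 * n i + (a : ℤ)) * Z i / 2))‖) ∧ _ := fun b =>
    hasSum_prod_fin (fun i (n : ℤ) => ee ((b : ℤ) * n / 2 + (τ * (2 * n + (a : ℤ)) ^ 2 / 8 +
      (2 * n + (a : ℤ)) * Z i / 2))) fun i => by
      refine ((((summable_jacobiTheta₂_term_iff (Z i + (a : ℤ) * τ / 2 + (b : ℤ) / 2) τ).2
        hτ).mul_left (ee (τ * (a : ℤ) ^ 2 / 8 + (a : ℤ) * Z i / 2))).norm).congr fun n => ?_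
      rw [thetaChar_term]
  have hp : ∀ (b : Fin 2) (n : Fin 8 → ℤ), ∏ i, ee ((b : ℤ) * n i / 2 +
      (τ * (2 * n i + (a : ℤ)) ^ 2 / 8 + (2 * n i + (a : ℤ)) * Z i / 2)) =
      ee ((b : ℤ) * (∑ i, n i : ℤ) / 2) * thTerm τ Z fun i => 2 * n i + (a : ℤ) := by
    intro b n
    rw [thTerm, ← ee_add]
    simp only [Fin.prod_univ_eight, ← ee_add, Fin.sum_univ_eight]
    congr 1
    push_cast
    ring
  simp only [thetaChar]
  rw [Finset.sum_congr rfl fun b _ => (key b).2.symm,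
    ← Summable.tsum_finsetSum fun b _ => (key b).1.of_norm, ← tsum_mul_left]
  refine tsum_congr fun n => ?_
  rw [Finset.sum_congr rfl fun b _ => hp b n, ← Finset.sum_mul, Fin.sum_univ_two, ← mul_assoc]
  have hmem : (fun i => 2 * n i + (a : ℤ)) ∈ E8 ↔ Even (∑ i, n i) := by
    rw [mem_E8, Finset.sum_add_distrib, ← Finset.mul_sum, even_iff_two_dvd]
    simp only [Finset.sum_const, Finset.card_univ, Fintype.card_fin]
    constructor
    · rintro ⟨-, h⟩; simp only [nsmul_eq_mul] at h; push_cast at h; omega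
    · intro h
      refine ⟨fun i => by omega, ?_⟩
      simp only [nsmul_eq_mul]; push_cast; omega
  by_cases he : Even (∑ i, n i)
  · rw [Set.indicator_of_mem (hmem.2 he)]
    obtain ⟨c, hc⟩ := he
    rw [hc]
    have : ee (((1 : Fin 2) : ℤ) * ((c + c : ℤ) : ℂ) / 2) = 1 := by
      rw [← ee_int c]; congr 1; push_cast; simp
    rw [this]
    norm_num [ee_zero]
  · rw [Set.indicator_of_notMem fun h => he (hmem.1 h)]
    rw [Int.not_even_iff_odd] at he
    obtain ⟨c, hc⟩ := he
    rw [hc]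
    have : ee (((1 : Fin 2) : ℤ) * ((2 * c + 1 : ℤ) : ℂ) / 2) = -1 := by
      have h2 : (((1 : Fin 2) : ℤ) * ((2 * c + 1 : ℤ) : ℂ) / 2) = 1 / 2 + c := by
        push_cast; simp; ring
      rw [h2, ee_add_int, ee, ← Complex.exp_pi_mul_I]
      congr 1; ring
    rw [this]
    simp [ee_zero]

theorem theta8_inv {τ : ℂ} (hτ : 0 < τ.im) (Z : Fin 8 → ℂ) :
    theta8 (-1 / τ) (fun i => Z i / τ) =
      τ ^ 4 * ee ((∑ i, Z i ^ 2) / (2 * τ)) * theta8 τ Z := by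
  have h0 := ne_zero_of_im_pos hτ
  rw [tsum_E8_eq (im_neg_one_div_pos hτ), tsum_E8_eq hτ]
  have h1 : ((-Complex.I * τ) ^ (1 / 2 : ℂ)) ^ 8 = τ ^ 4 := by
    have : (-Complex.I * τ) ^ (1 / 2 : ℂ) * (-Complex.I * τ) ^ (1 / 2 : ℂ) = -Complex.I * τ := by
      rw [← Complex.cpow_add _ _ (by simp [h0])]; norm_num
    calc _ = ((-Complex.I * τ) ^ (1 / 2 : ℂ) * (-Complex.I * τ) ^ (1 / 2 : ℂ)) ^ 4 := by ring
      _ = (-Complex.I) ^ 4 * τ ^ 4 := by rw [this]; ring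
      _ = _ := by
        rw [show (-Complex.I) ^ 4 = (Complex.I ^ 2) ^ 2 by ring, Complex.I_sq]; norm_num
  have h2 : ∀ a b : Fin 2, ∏ i, thetaChar a b (-1 / τ) (Z i / τ) =
      τ ^ 4 * ee ((∑ i, Z i ^ 2) / (2 * τ)) * ∏ i, thetaChar b a τ (Z i) := by
    intro a b
    rw [Finset.prod_congr rfl fun i _ => thetaChar_inv a b hτ (Z i)]
    simp only [Finset.prod_mul_distrib, Finset.prod_const, Finset.card_univ, Fintype.card_fin]
    rw [h1]
    have h3 : ee (-((a : ℤ) * (b : ℤ)) / 4) ^ 8 = 1 := by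
      rw [← ee_nat_mul, ← ee_int (-2 * a * b)]
      congr 1; push_cast; ring
    have h4 : ∏ i, ee (Z i ^ 2 / (2 * τ)) = ee ((∑ i, Z i ^ 2) / (2 * τ)) := by
      simp only [Fin.prod_univ_eight, ← ee_add, Fin.sum_univ_eight, add_div]
    rw [h3, h4, mul_one]
  simp only [h2]
  rw [Finset.sum_comm]
  simp only [← Finset.mul_sum]
  ring

/-- Left multiplication by the quaternion `i + j + 3k` on pairs of quaternions; it squares
to `-11`. -/
def quatMul {α : Type*} [CommRing α] (v : Fin 8 → α) : Fin 8 → α :=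
  ![-v 1 - v 2 - 3 * v 3, v 0 - 3 * v 2 + v 3, v 0 + 3 * v 1 - v 3, 3 * v 0 - v 1 + v 2,
    -v 5 - v 6 - 3 * v 7, v 4 - 3 * v 6 + v 7, v 4 + 3 * v 5 - v 7, 3 * v 4 - v 5 + v 6]

theorem quatMul_map {α β : Type*} [CommRing α] [CommRing β] (φ : α →+* β) (v : Fin 8 → α) (i) :
    quatMul (fun j => φ (v j)) i = φ (quatMul v i) := by
  have h3 : φ 3 = 3 := map_ofNat φ 3
  fin_cases i <;> simp [quatMul, h3]

theorem quatMul_intCast {β : Type*} [CommRing β] (v : Fin 8 → ℤ) (i) :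
    quatMul (fun j => (v j : β)) i = (quatMul v i : ℤ) :=
  quatMul_map (Int.castRingHom β) v i

section bilinear

variable {α : Type*} [CommRing α] (x y : Fin 8 → α)

theorem dot_quatMul_self : x ⬝ᵥ quatMul x = 0 := by
  simp [dotProduct, Fin.sum_univ_eight, quatMul]; ring

theorem quatMul_dot : quatMul x ⬝ᵥ y = -(x ⬝ᵥ quatMul y) := by
  simp [dotProduct, Fin.sum_univ_eight, quatMul]; ring

theorem quatMul_dot_quatMul : quatMul x ⬝ᵥ quatMul y = 11 * (x ⬝ᵥ y) := by
  simp [dotProduct, Fin.sum_univ_eight, quatMul]; ring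

end bilinear

theorem E8.exists_half {v : Fin 8 → ℤ} (h : v ∈ E8) :
    ∃ u ∈ E8, ∀ i, 2 * u i = v i + quatMul v i := by
  obtain ⟨n, hn, hn2⟩ := E8.exists_eq h
  set a := v 0 with ha
  rw [Fin.sum_univ_eight] at hn2
  have hv : v = fun i => 2 * n i + a := funext hn
  refine ⟨![-2 * a + n 0 - n 1 - n 2 - 3 * n 3, n 1 + n 0 - 3 * n 2 + n 3,
    2 * a + n 2 + n 0 + 3 * n 1 - n 3, 2 * a + n 3 + 3 * n 0 - n 1 + n 2,
    -2 * a + n 4 - n 5 - n 6 - 3 * n 7, n 5 + n 4 - 3 * n 6 + n 7,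
    2 * a + n 6 + n 4 + 3 * n 5 - n 7, 2 * a + n 7 + 3 * n 4 - n 5 + n 6], ⟨?_, ?_⟩, ?_⟩
  · intro i
    fin_cases i <;> simp <;> omega
  · simp [Fin.sum_univ_eight]; omega
  · intro i
    rw [hv]
    fin_cases i <;> simp [quatMul] <;> ring

theorem E8.exists_half_sub {v : Fin 8 → ℤ} (h : v ∈ E8) :
    ∃ u ∈ E8, ∀ i, 2 * u i = v i - quatMul v i := by
  obtain ⟨u, hu, h2⟩ := E8.exists_half h
  refine ⟨v - u, E8.sub_mem h hu, fun i => ?_⟩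
  have := h2 i
  rw [Pi.sub_apply]; linarith

/-- The square root of `-11` in the upper half-plane. -/
def rt : ℂ := 2 * omg 11 - 1

theorem rt_sq : rt * rt = -11 := by
  rw [rt]; linear_combination 4 * omg_sq

theorem rt_ne_zero : rt ≠ 0 := by
  intro h; have := rt_sq; rw [h] at this; norm_num at this

theorem rt_inv : rt⁻¹ = -rt / 11 := by
  field_simp [rt_ne_zero]; linear_combination rt_sq

/-- The first isotropic eigenform of `quatMul` with eigenvalue `√-11`. -/
def eigA (v : Fin 8 → ℂ) : ℂ := -rt * v 0 + v 1 + v 2 + 3 * v 3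
/-- The second isotropic eigenform of `quatMul` with eigenvalue `√-11`. -/
def eigB (v : Fin 8 → ℂ) : ℂ := -v 0 - rt * v 1 + 3 * v 2 - v 3

theorem eigA_quatMul (v) : eigA (quatMul v) = rt * eigA v := by
  simp [eigA, quatMul]; linear_combination v 0 * rt_sq

theorem eigB_quatMul (v) : eigB (quatMul v) = rt * eigB v := by
  simp [eigB, quatMul]; linear_combination v 1 * rt_sq

/-- The alternating form whose powers are the harmonic coefficients of the theta series. -/
def altForm (x y : Fin 8 → ℂ) : ℂ := eigA x * eigB y - eigA y * eigB x

/-- The vector representing `altForm · y`. -/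
def altVec (y : Fin 8 → ℂ) : Fin 8 → ℂ :=
  ![-rt * eigB y + eigA y, eigB y + rt * eigA y, eigB y - 3 * eigA y, 3 * eigB y + eigA y,
    0, 0, 0, 0]

theorem altForm_eq (x y) : altForm x y = x ⬝ᵥ altVec y := by
  simp [altForm, altVec, dotProduct, Fin.sum_univ_eight, eigA, eigB]; ring

theorem altVec_isotropic (y) : altVec y ⬝ᵥ altVec y = 0 := by
  simp [altVec, dotProduct, Fin.sum_univ_eight]
  linear_combination (eigB y ^ 2 + eigA y ^ 2) * rt_sq

theorem dot_altVec (y) : y ⬝ᵥ altVec y = 0 := by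
  rw [← altForm_eq, altForm]; ring

theorem quatMul_dot_altVec (y) : quatMul y ⬝ᵥ altVec y = 0 := by
  rw [← altForm_eq, altForm, eigA_quatMul, eigB_quatMul]; ring

/-- Complexification of a lattice vector. -/
def cx (v : Fin 8 → ℤ) : Fin 8 → ℂ := fun i => v i

theorem cx_quatMul (v) : quatMul (cx v) = cx (quatMul v) := funext fun i => quatMul_intCast v i

theorem cx_dot (v w) : cx v ⬝ᵥ cx w = (v ⬝ᵥ w : ℤ) := by
  simp [cx, dotProduct]

/-- The exponent of the Hermitian theta series. -/
def expo (Z : Matrix (Fin 2) (Fin 2) ℂ) (x y : Fin 8 → ℂ) : ℂ :=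
  (Z 0 0 * (x ⬝ᵥ x) + Z 1 1 * (y ⬝ᵥ y) + Z 0 1 * (x ⬝ᵥ y + (x ⬝ᵥ quatMul y) / rt) +
    Z 1 0 * (x ⬝ᵥ y - (x ⬝ᵥ quatMul y) / rt)) / 8

/-- A term of the Hermitian theta series; the index is `(y, x)`. -/
def hTerm (n : ℕ) (Z : Matrix (Fin 2) (Fin 2) ℂ) (p : E8 × E8) : ℂ :=
  altForm (cx p.2) (cx p.1) ^ n * ee (expo Z (cx p.2) (cx p.1))

/-- The Hermitian theta series of weight `4 + n`. -/
def hTheta (n : ℕ) (Z : Matrix (Fin 2) (Fin 2) ℂ) : ℂ := ∑' p, hTerm n Z p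

theorem hTheta_tr (n : ℕ) (p s : ℤ) {q : ℂ} (hq : q ∈ OK11) (t z₁ z₂ w : ℂ) :
    hTheta n !![t + p, z₁ + q; z₂ + (starRingEnd ℂ) q, w + s] = hTheta n !![t, z₁; z₂, w] := by
  rw [mem_OK11] at hq
  obtain ⟨a, b, rfl⟩ := hq
  refine tsum_congr fun ⟨y, x⟩ => ?_
  rw [hTerm, hTerm]
  congr 1
  obtain ⟨u, hu, hu2⟩ := E8.exists_half y.2
  obtain ⟨c1, h1⟩ := E8.eight_dvd x.2
  obtain ⟨c2, h2⟩ := E8.eight_dvd y.2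
  obtain ⟨c3, h3⟩ := E8.four_dvd x.2 y.2
  obtain ⟨c4, h4⟩ := E8.four_dvd x.2 hu
  have h5 : (x : Fin 8 → ℤ) ⬝ᵥ quatMul (y : Fin 8 → ℤ) = 8 * c4 - 4 * c3 := by
    have : quatMul (y : Fin 8 → ℤ) = (2 : ℤ) • u - y := by
      funext i; have := hu2 i; simp only [Pi.sub_apply, Pi.smul_apply, smul_eq_mul]; linarith
    rw [this, dotProduct_sub, dotProduct_smul, h4, h3, smul_eq_mul]; ring
  symm
  rw [← ee_add_int _ (p * c1 + s * c2 + a * c3 + b * c4)]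
  congr 1
  simp only [expo, cx_quatMul, cx_dot, h1, h2, h3, h5]
  simp only [Matrix.of_apply, Matrix.cons_val', Matrix.cons_val_zero, Matrix.cons_val_one,
    Matrix.cons_val_fin_one]
  rw [div_eq_mul_inv _ rt, rt_inv, map_add, map_mul, conj_omg]
  simp only [map_intCast]
  push_cast
  have : omg 11 = (rt + 1) / 2 := by rw [rt]; ring
  rw [this]
  linear_combination ((b : ℂ) * (8 * c4 - 4 * c3) / 88) * rt_sq

theorem hTheta_lo (n : ℕ) {a : ℂ} (ha : a ∈ OK11) (t z₁ z₂ w : ℂ) :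
    hTheta n !![t, (starRingEnd ℂ) a * t + z₁; a * t + z₂,
      a * (starRingEnd ℂ) a * t + (starRingEnd ℂ) a * z₂ + a * z₁ + w] =
      hTheta n !![t, z₁; z₂, w] := by
  rw [mem_OK11] at ha
  obtain ⟨a, b, rfl⟩ := ha
  choose u hu hu2 using fun y : E8 => E8.exists_half_sub y.2
  let e : E8 × E8 ≃ E8 × E8 :=
    Equiv.prodShear (Equiv.refl E8) fun y => Equiv.addRight (a • y + b • (⟨u y, hu y⟩ : E8))
  rw [hTheta, hTheta, ← e.tsum_eq (hTerm n !![t, z₁; z₂, w])]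
  refine tsum_congr fun ⟨y, x⟩ => ?_
  have e1 : e (y, x) = (y, x + (a • y + b • (⟨u y, hu y⟩ : E8))) := rfl
  rw [e1, hTerm, hTerm]
  dsimp only
  have hrt := rt_ne_zero
  set X := cx x
  set Y := cx y
  have hx : cx ((x + (a • y + b • (⟨u y, hu y⟩ : E8)) : E8) : Fin 8 → ℤ) =
      X + (((2 * a + b) / 2 : ℂ) • Y - (b / 2 : ℂ) • quatMul Y) := by
    funext i
    have := hu2 y i
    have h2 : (2 : ℂ) * (u y i : ℂ) = (y : Fin 8 → ℤ) i - quatMul (y : Fin 8 → ℤ) i := by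
      exact_mod_cast this
    simp only [cx_quatMul, X, Y, Pi.add_apply, Pi.sub_apply, Pi.smul_apply, smul_eq_mul]
    simp only [cx, AddSubgroup.coe_add, AddSubgroup.coe_zsmul, Pi.add_apply, Pi.smul_apply,
      smul_eq_mul]
    push_cast
    linear_combination (b / 2 : ℂ) * h2
  rw [hx]
  have k1 := dot_quatMul_self Y
  have k2 := quatMul_dot_quatMul Y Y
  have k3 : quatMul Y ⬝ᵥ Y = 0 := by rw [dotProduct_comm, k1]
  congr 1
  · congr 1
    rw [altForm_eq, altForm_eq, add_dotProduct, sub_dotProduct, smul_dotProduct, smul_dotProduct,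
      dot_altVec, quatMul_dot_altVec]
    simp
  · congr 1
    have k4 : (quatMul Y) ⬝ᵥ X = X ⬝ᵥ quatMul Y := dotProduct_comm _ _
    have k5 : Y ⬝ᵥ X = X ⬝ᵥ Y := dotProduct_comm _ _
    simp only [expo, Matrix.of_apply, Matrix.cons_val', Matrix.cons_val_zero, Matrix.cons_val_one,
      Matrix.cons_val_fin_one, add_dotProduct, sub_dotProduct, smul_dotProduct, dotProduct_add,
      dotProduct_sub, dotProduct_smul, k1, k2, k3, k4, k5, smul_eq_mul, map_add, map_mul, conj_omg,
      map_intCast]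
    have : omg 11 = (rt + 1) / 2 := by rw [rt]; ring
    rw [this, div_eq_mul_inv _ rt, div_eq_mul_inv _ rt, rt_inv]
    linear_combination (t * b * (X ⬝ᵥ quatMul Y) / 88 - t * b ^ 2 * (Y ⬝ᵥ Y) / 32) * rt_sq

theorem hTheta_w (n : ℕ) (t z₁ z₂ w : ℂ) :
    hTheta n !![w, -z₂; -z₁, t] = hTheta n !![t, z₁; z₂, w] := by
  let e : E8 × E8 ≃ E8 × E8 :=
    (Equiv.prodComm E8 E8).trans ((Equiv.refl E8).prodCongr (Equiv.neg E8))
  rw [hTheta, hTheta, ← e.tsum_eq]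
  refine tsum_congr fun ⟨y, x⟩ => ?_
  have e1 : e (y, x) = (x, -y) := rfl
  rw [e1, hTerm, hTerm]
  dsimp only
  set X := cx x
  set Y := cx y
  have hy : cx ((-y : E8) : Fin 8 → ℤ) = -Y := by
    funext i; simp [cx, Y]
  have hq : Y ⬝ᵥ quatMul X = - (X ⬝ᵥ quatMul Y) := by
    rw [← quatMul_dot, dotProduct_comm]
  have k5 : Y ⬝ᵥ X = X ⬝ᵥ Y := dotProduct_comm _ _
  rw [hy]
  congr 1
  · congr 1
    simp [altForm, eigA, eigB]; ring
  · congr 1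
    simp [expo, hq, k5]
    ring

theorem quatMul_form_nonneg {T W α β : ℝ} (hT : 0 < T) (h : α ^ 2 + 11 * β ^ 2 ≤ 4 * (T * W))
    (x y : Fin 8 → ℝ) :
    0 ≤ T * (x ⬝ᵥ x) + W * (y ⬝ᵥ y) + α * (x ⬝ᵥ y) + β * (x ⬝ᵥ quatMul y) := by
  have hy : 0 ≤ y ⬝ᵥ y := by
    rw [dotProduct]; exact Finset.sum_nonneg fun i _ => mul_self_nonneg _
  have hs : 0 ≤ (T • x + (α / 2) • y + (β / 2) • quatMul y) ⬝ᵥ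
      (T • x + (α / 2) • y + (β / 2) • quatMul y) := by
    rw [dotProduct]; exact Finset.sum_nonneg fun i _ => mul_self_nonneg _
  have k1 := dot_quatMul_self y
  have k2 := quatMul_dot_quatMul y y
  have k3 : quatMul y ⬝ᵥ y = 0 := by rw [dotProduct_comm, k1]
  have k4 : (quatMul y) ⬝ᵥ x = x ⬝ᵥ quatMul y := dotProduct_comm _ _
  have k5 : y ⬝ᵥ x = x ⬝ᵥ y := dotProduct_comm _ _
  simp only [add_dotProduct, smul_dotProduct, dotProduct_add, dotProduct_smul, k1, k2, k3, k4, k5,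
    smul_eq_mul] at hs
  have := mul_nonneg (sub_nonneg.2 h) hy
  refine (mul_nonneg_iff_of_pos_left hT).1 ?_
  linarith

theorem rt_eq : rt = (Real.sqrt 11 : ℝ) * Complex.I := by
  apply Complex.ext
  · simp [rt, omg_re]
  · simp [rt, omg_im]; ring

theorem div_rt_im (z : ℂ) : 11 * (z / rt).im ^ 2 = z.re ^ 2 := by
  have h : z = (z / rt) * rt := by field_simp [rt_ne_zero]
  have h11 : Real.sqrt 11 ^ 2 = 11 := Real.sq_sqrt (by norm_num)
  have h2 : z.re = -(Real.sqrt 11 * (z / rt).im) := by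
    conv_lhs => rw [h]
    rw [Complex.mul_re, rt_eq]
    simp
    ring
  rw [h2, neg_sq, mul_pow, h11]

theorem expo_im_nonneg {Z : Matrix (Fin 2) (Fin 2) ℂ} (hZ : Z ∈ HH2) (x y : Fin 8 → ℤ) :
    0 ≤ (expo Z (cx x) (cx y)).im := by
  obtain ⟨t, z₁, z₂, w, rfl⟩ := eta_two Z
  obtain ⟨ht, h⟩ := mem_HH2_mk.1 hZ
  have h1 : (z₁ + z₂).im ^ 2 + 11 * ((z₁ - z₂) / rt).im ^ 2 ≤ 4 * (t.im * w.im) := by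
    refine le_trans (le_of_eq ?_) h.le
    rw [div_rt_im, Complex.normSq_apply]
    simp
    ring
  have := quatMul_form_nonneg ht h1 (fun i => x i) (fun i => y i)
  have e : expo !![t, z₁; z₂, w] (cx x) (cx y) =
      ((x ⬝ᵥ x : ℤ) : ℝ) * t / 8 + ((y ⬝ᵥ y : ℤ) : ℝ) * w / 8 + ((x ⬝ᵥ y : ℤ) : ℝ) * (z₁ + z₂) / 8
      + ((x ⬝ᵥ quatMul y : ℤ) : ℝ) * ((z₁ - z₂) / rt) / 8 := by
    simp only [expo, cx_quatMul, cx_dot]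
    simp
    ring
  have i1 : ∀ (a : ℝ) (z : ℂ), (a * z / 8).im = a * z.im / 8 := by
    intro a z
    rw [show (a * z / 8 : ℂ) = ((a / 8 : ℝ) : ℂ) * z by push_cast; ring, Complex.im_ofReal_mul]
    ring
  rw [e]
  simp only [Complex.add_im, i1]
  have hR : (fun i => ((quatMul x i : ℤ) : ℝ)) = quatMul fun i => (x i : ℝ) :=
    funext fun i => (quatMul_intCast x i).symm
  have hR' : quatMul (fun i => (y i : ℝ)) = fun i => ((quatMul y i : ℤ) : ℝ) :=
    funext fun i => quatMul_intCast y i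
  rw [hR'] at this
  have e2 : ∀ v w : Fin 8 → ℤ, ((v ⬝ᵥ w : ℤ) : ℝ) = (fun i => (v i : ℝ)) ⬝ᵥ fun i => (w i : ℝ) := by
    intro v w; simp [dotProduct]
  rw [← Complex.add_im, e2, e2, e2, e2]
  linarith

theorem norm_ee_expo_le {Z : Matrix (Fin 2) (Fin 2) ℂ} {δ : ℝ}
    (hZ : Z - (δ * Complex.I) • (1 : Matrix (Fin 2) (Fin 2) ℂ) ∈ HH2) (x y : Fin 8 → ℤ) :
    ‖ee (expo Z (cx x) (cx y))‖ ≤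
      Real.exp (∑ i, -(Real.pi * δ / 4) * (x i : ℝ) ^ 2) *
        Real.exp (∑ i, -(Real.pi * δ / 4) * (y i : ℝ) ^ 2) := by
  have h := expo_im_nonneg hZ x y
  have e : expo (Z - (δ * Complex.I) • (1 : Matrix (Fin 2) (Fin 2) ℂ)) (cx x) (cx y) =
      expo Z (cx x) (cx y) - ((δ * ((x ⬝ᵥ x + y ⬝ᵥ y : ℤ) : ℝ) / 8 : ℝ) : ℂ) * Complex.I := by
    simp only [expo, cx_quatMul, cx_dot]
    simp
    ring
  rw [e, Complex.sub_im, Complex.im_ofReal_mul] at h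
  rw [norm_ee, ← Real.exp_add, Real.exp_le_exp, ← Finset.sum_add_distrib]
  have e3 : ∑ i, (-(Real.pi * δ / 4) * (x i : ℝ) ^ 2 + -(Real.pi * δ / 4) * (y i : ℝ) ^ 2) =
      -(2 * Real.pi * (δ * ((x ⬝ᵥ x + y ⬝ᵥ y : ℤ) : ℝ) / 8)) := by
    simp only [dotProduct, Fin.sum_univ_eight]
    push_cast
    ring
  rw [e3]
  simp only [Complex.I_im, mul_one] at h
  have := mul_le_mul_of_nonneg_left (sub_nonneg.1 h) (mul_nonneg zero_le_two Real.pi_pos.le)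
  linarith

theorem norm_eigA_le (x : Fin 8 → ℤ) : ‖eigA (cx x)‖ ≤ (‖rt‖ + 3) * ∑ i, |(x i : ℝ)| := by
  have n : ∀ m : ℤ, ‖(m : ℂ)‖ = |(m : ℝ)| := fun m => by simp
  have h3 : ‖(3 : ℂ)‖ = 3 := by simp
  have h := norm_add_le (-rt * (x 0 : ℂ) + x 1 + x 2) (3 * x 3)
  have h' := norm_add_le (-rt * (x 0 : ℂ) + x 1) (x 2)
  have h'' := norm_add_le (-rt * (x 0 : ℂ)) (x 1)
  simp only [norm_mul, norm_neg, n, h3] at h h' h''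
  have hr := norm_nonneg rt
  have p := fun i => abs_nonneg (x i : ℝ)
  simp only [eigA, cx, Fin.sum_univ_eight]
  have q := fun i => mul_nonneg hr (p i)
  have := p 0; have := p 1; have := p 2; have := p 3; have := p 4; have := p 5; have := p 6
  have := p 7; have := q 1; have := q 2; have := q 3; have := q 4; have := q 5; have := q 6
  have := q 7
  linarith

theorem norm_eigB_le (x : Fin 8 → ℤ) : ‖eigB (cx x)‖ ≤ (‖rt‖ + 3) * ∑ i, |(x i : ℝ)| := by
  have n : ∀ m : ℤ, ‖(m : ℂ)‖ = |(m : ℝ)| := fun m => by simp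
  have h3 : ‖(3 : ℂ)‖ = 3 := by simp
  have h := norm_sub_le (-(x 0 : ℂ) - rt * x 1 + 3 * x 2) (x 3)
  have h' := norm_add_le (-(x 0 : ℂ) - rt * x 1) (3 * x 2)
  have h'' := norm_sub_le (-(x 0 : ℂ)) (rt * x 1)
  simp only [norm_mul, norm_neg, n, h3] at h h' h''
  have hr := norm_nonneg rt
  have p := fun i => abs_nonneg (x i : ℝ)
  simp only [eigB, cx, Fin.sum_univ_eight]
  have q := fun i => mul_nonneg hr (p i)
  have := p 0; have := p 1; have := p 2; have := p 3; have := p 4; have := p 5; have := p 6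
  have := p 7; have := q 0; have := q 2; have := q 3; have := q 4; have := q 5; have := q 6
  have := q 7
  linarith

theorem norm_altForm_le (x y : Fin 8 → ℤ) : ‖altForm (cx x) (cx y)‖ ≤
    2 * (‖rt‖ + 3) ^ 2 * ((∑ i, |(x i : ℝ)|) * ∑ i, |(y i : ℝ)|) := by
  have h1 := mul_le_mul (norm_eigA_le x) (norm_eigB_le y) (norm_nonneg _) (by positivity)
  have h2 := mul_le_mul (norm_eigA_le y) (norm_eigB_le x) (norm_nonneg _) (by positivity)
  rw [← norm_mul] at h1 h2
  rw [altForm]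
  refine (norm_sub_le _ _).trans ((add_le_add h1 h2).trans_eq ?_)
  ring

/-- A summable majorant for the Hermitian theta series. -/
def hBound (n : ℕ) (δ : ℝ) (p : E8 × E8) : ℝ :=
  (2 * (‖rt‖ + 3) ^ 2) ^ n * (n.factorial : ℝ) ^ 2 *
    (Real.exp (∑ i, (-(Real.pi * δ / 4) * ((p.1 : Fin 8 → ℤ) i : ℝ) ^ 2 +
        1 * |((p.1 : Fin 8 → ℤ) i : ℝ)|)) *
      Real.exp (∑ i, (-(Real.pi * δ / 4) * ((p.2 : Fin 8 → ℤ) i : ℝ) ^ 2 +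
        1 * |((p.2 : Fin 8 → ℤ) i : ℝ)|)))

theorem summable_hBound (n : ℕ) {δ : ℝ} (hδ : 0 < δ) : Summable (hBound n δ) := by
  have hp := Real.pi_pos
  have h := (summable_gauss (a := Real.pi * δ / 4) (by positivity) 1 8).comp_injective
    (Subtype.val_injective (p := fun v => v ∈ E8))
  exact (h.mul_of_nonneg h (fun _ => (Real.exp_pos _).le) fun _ => (Real.exp_pos _).le).mul_left _

theorem norm_hTerm_le (n : ℕ) {Z : Matrix (Fin 2) (Fin 2) ℂ} {δ : ℝ}
    (hZ : Z - (δ * Complex.I) • (1 : Matrix (Fin 2) (Fin 2) ℂ) ∈ HH2) (p : E8 × E8) :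
    ‖hTerm n Z p‖ ≤ hBound n δ p := by
  obtain ⟨⟨y, hy⟩, ⟨x, hx⟩⟩ := p
  have h1 := norm_ee_expo_le hZ x y
  have h2 := pow_le_pow_left₀ (norm_nonneg _) (norm_altForm_le x y) n
  have h3 : ∀ x : Fin 8 → ℤ, (∑ i, |(x i : ℝ)|) ^ n ≤
      (n.factorial : ℝ) * Real.exp (∑ i, |(x i : ℝ)|) := by
    intro x
    have := Real.pow_div_factorial_le_exp (∑ i, |(x i : ℝ)|) (by positivity) n
    rwa [div_le_iff₀' (by positivity)] at this
  rw [hTerm, norm_mul, norm_pow]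
  refine (mul_le_mul h2 h1 (norm_nonneg _) (by positivity)).trans ?_
  rw [mul_pow (2 * (‖rt‖ + 3) ^ 2), mul_pow (∑ i, |(x i : ℝ)|)]
  have h4 := mul_le_mul (h3 x) (h3 y) (by positivity) (by positivity)
  simp only [hBound, one_mul, Finset.sum_add_distrib, Real.exp_add]
  set A := Real.exp (∑ i, -(Real.pi * δ / 4) * (x i : ℝ) ^ 2)
  set B := Real.exp (∑ i, -(Real.pi * δ / 4) * (y i : ℝ) ^ 2)
  have : 0 ≤ (2 * (‖rt‖ + 3) ^ 2) ^ n * (A * B) := by positivity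
  have := mul_le_mul_of_nonneg_left h4 this
  generalize (2 * (‖rt‖ + 3) ^ 2) ^ n = M at this ⊢
  refine le_trans (le_of_eq ?_) (this.trans (le_of_eq ?_)) <;> ring

theorem exists_shift_mem_HH2 {Z : Matrix (Fin 2) (Fin 2) ℂ} (hZ : Z ∈ HH2) : ∃ δ : ℝ, 0 < δ ∧
    ∀ᶠ Y in 𝓝 Z, Y - (δ * Complex.I) • (1 : Matrix (Fin 2) (Fin 2) ℂ) ∈ HH2 := by
  have h : Tendsto (fun δ : ℝ => Z - (δ * Complex.I) • (1 : Matrix (Fin 2) (Fin 2) ℂ))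
      (𝓝[>] 0) (𝓝 Z) := by
    refine Tendsto.mono_left ?_ nhdsWithin_le_nhds
    have : Continuous fun δ : ℝ => Z - (δ * Complex.I) • (1 : Matrix (Fin 2) (Fin 2) ℂ) := by
      fun_prop
    simpa using this.tendsto 0
  obtain ⟨δ, h1, h2⟩ := ((h.eventually (isOpen_HH2.mem_nhds hZ)).and self_mem_nhdsWithin).exists
  refine ⟨δ, h2, ?_⟩
  have : Continuous fun Y : Matrix (Fin 2) (Fin 2) ℂ =>
      Y - (δ * Complex.I) • (1 : Matrix (Fin 2) (Fin 2) ℂ) := by fun_prop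
  exact this.continuousAt.eventually (isOpen_HH2.mem_nhds h1)

theorem summable_hTerm (n : ℕ) {Z : Matrix (Fin 2) (Fin 2) ℂ} (hZ : Z ∈ HH2) :
    Summable (hTerm n Z) := by
  obtain ⟨δ, hδ, h⟩ := exists_shift_mem_HH2 hZ
  exact Summable.of_norm_bounded (summable_hBound n hδ) (norm_hTerm_le n h.self_of_nhds)

theorem differentiable_hTerm (n : ℕ) (p : E8 × E8) : Differentiable ℂ fun Z => hTerm n Z p := by
  have h : ∀ i j, Differentiable ℂ fun Z : Matrix (Fin 2) (Fin 2) ℂ => Z i j := fun i j =>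
    (differentiable_pi.1 (differentiable_pi.1 differentiable_id i) j)
  have h0 := h 0 0
  have h1 := h 0 1
  have h2 := h 1 0
  have h3 := h 1 1
  refine Differentiable.const_mul (differentiable_ee.comp ?_) _
  unfold expo
  exact ((((h0.mul_const _).fun_add (h3.mul_const _)).fun_add (h1.mul_const _)).fun_add
    (h2.mul_const _)).mul_const _

theorem differentiableOn_hTheta (n : ℕ) : DifferentiableOn ℂ (hTheta n) HH2 := by
  refine differentiableOn_tsum_normal isOpen_HH2
    (fun p => (differentiable_hTerm n p).differentiableOn) fun Z hZ => ?_
  obtain ⟨δ, hδ, h⟩ := exists_shift_mem_HH2 hZ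
  exact ⟨_, summable_hBound n hδ, h.mono fun Y hY p => norm_hTerm_le n hY p⟩

theorem ExpSummable.const_mul {ι : Type*} {c l : ι → ℂ} (h : ExpSummable c l) (A : ℂ) :
    ExpSummable (fun i => A * c i) l := fun R => by
  refine ((h R).mul_left ‖A‖).congr fun i => ?_
  rw [norm_mul, mul_assoc]

theorem thTerm_add (τ : ℂ) (Z a : Fin 8 → ℂ) (s : ℂ) (v : Fin 8 → ℤ) :
    thTerm τ (Z + s • a) v =
      thTerm τ Z v * Complex.exp (s * (2 * Real.pi * Complex.I * (∑ i, (v i : ℂ) * a i / 2))) := by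
  have : Complex.exp (s * (2 * Real.pi * Complex.I * (∑ i, (v i : ℂ) * a i / 2))) =
      ee (s * (∑ i, (v i : ℂ) * a i / 2)) := by
    rw [ee]; congr 1; ring
  rw [this, thTerm, thTerm, ← ee_add]
  congr 1
  simp only [Fin.sum_univ_eight, Pi.add_apply, Pi.smul_apply, smul_eq_mul]
  ring

theorem theta8_harmonic_inv {t : ℂ} (ht : 0 < t.im) (U a : Fin 8 → ℂ) (ha : a ⬝ᵥ a = 0)
    (hU : U ⬝ᵥ a = 0) (n : ℕ) :
    ∑' x : E8, (cx x ⬝ᵥ a) ^ n * thTerm (-1 / t) (fun i => U i / t) x =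
      t ^ (4 + n) * ee ((U ⬝ᵥ U) / (2 * t)) * ∑' x : E8, (cx x ⬝ᵥ a) ^ n * thTerm t U x := by
  have ht0 : t ≠ 0 := by rintro rfl; simp at ht
  have ht' : 0 < (-1 / t).im := im_neg_one_div_pos ht
  have h1 := (expSummable_thTerm ht' (fun i => U i / t) a).comp_injective
    (Subtype.val_injective (p := fun v => v ∈ E8))
  have h2 := ((expSummable_thTerm ht U (t • a)).comp_injective
    (Subtype.val_injective (p := fun v => v ∈ E8))).const_mul (t ^ 4 * ee ((U ⬝ᵥ U) / (2 * t)))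
  have key := h1.iteratedDeriv_zero n
  have key2 := h2.iteratedDeriv_zero n
  have e : (fun s => ∑' j : E8, thTerm (-1 / t) (fun i => U i / t) j *
        Complex.exp (s * (2 * Real.pi * Complex.I *
          (∑ i, (((j : Fin 8 → ℤ) i : ℤ) : ℂ) * a i / 2)))) =
      fun s => ∑' j : E8, t ^ 4 * ee ((U ⬝ᵥ U) / (2 * t)) * thTerm t U j *
        Complex.exp (s * (2 * Real.pi * Complex.I *
          (∑ i, (((j : Fin 8 → ℤ) i : ℤ) : ℂ) * (t • a) i / 2))) := by
    funext s
    have h := theta8_inv ht (U + (s * t) • a)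
    have hs : ∑ i, (U + (s * t) • a) i ^ 2 = U ⬝ᵥ U := by
      have : ∑ i, (U + (s * t) • a) i ^ 2 = (U + (s * t) • a) ⬝ᵥ (U + (s * t) • a) := by
        rw [dotProduct]; exact Finset.sum_congr rfl fun i _ => by ring
      rw [this]
      simp only [add_dotProduct, smul_dotProduct, dotProduct_add, dotProduct_smul, hU, ha,
        dotProduct_comm a U, smul_eq_mul]
      ring
    rw [hs, theta8, theta8, ← tsum_mul_left] at h
    have hv : (fun i => (U + (s * t) • a) i / t) = (fun i => U i / t) + s • a := by
      funext i
      simp only [Pi.add_apply, Pi.smul_apply, smul_eq_mul]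
      field_simp
    have hv2 : U + (s * t) • a = U + s • (t • a) := by rw [mul_smul]
    rw [hv, hv2] at h
    simp only [thTerm_add] at h
    rw [h]
    exact tsum_congr fun j => by ring
  rw [e, key2] at key
  have hpi : (Real.pi * Complex.I : ℂ) ^ n ≠ 0 :=
    pow_ne_zero _ (mul_ne_zero (by exact_mod_cast Real.pi_ne_zero) Complex.I_ne_zero)
  apply mul_left_cancel₀ hpi
  rw [← tsum_mul_left, ← tsum_mul_left, ← tsum_mul_left]
  have ea : ∀ j : E8, (2 * Real.pi * Complex.I *
      (∑ i, (((j : Fin 8 → ℤ) i : ℤ) : ℂ) * a i / 2)) =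
      Real.pi * Complex.I * (cx j ⬝ᵥ a) := by
    intro j; simp only [dotProduct, cx, Fin.sum_univ_eight]; ring
  have eb : ∀ j : E8, (2 * Real.pi * Complex.I *
      (∑ i, (((j : Fin 8 → ℤ) i : ℤ) : ℂ) * (t • a) i / 2)) =
      t * (Real.pi * Complex.I * (cx j ⬝ᵥ a)) := by
    intro j; simp only [dotProduct, cx, Fin.sum_univ_eight, Pi.smul_apply, smul_eq_mul]; ring
  simp only [ea, eb] at key
  refine Eq.trans ?_ (key.symm.trans ?_)
  · refine tsum_congr fun j => ?_
    rw [mul_pow]; ring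
  · refine tsum_congr fun j => ?_
    rw [mul_pow, mul_pow, pow_add]; ring

/-- The linear argument of the inner theta series in `hTheta`. -/
def argU (z₁ z₂ : ℂ) (y : Fin 8 → ℂ) : Fin 8 → ℂ :=
  fun i => ((z₁ + z₂) * y i + (z₁ - z₂) / rt * quatMul y i) / 4

theorem argU_eq (z₁ z₂ : ℂ) (y : Fin 8 → ℂ) :
    argU z₁ z₂ y = ((z₁ + z₂) / 4) • y + ((z₁ - z₂) / rt / 4) • quatMul y := by
  funext i; simp [argU]; ring

theorem argU_dot_self (z₁ z₂ : ℂ) (y : Fin 8 → ℂ) :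
    argU z₁ z₂ y ⬝ᵥ argU z₁ z₂ y = z₁ * z₂ * (y ⬝ᵥ y) / 4 := by
  have k1 := dot_quatMul_self y
  have k2 := quatMul_dot_quatMul y y
  have k3 : quatMul y ⬝ᵥ y = 0 := by rw [dotProduct_comm, k1]
  rw [argU_eq]
  simp only [add_dotProduct, smul_dotProduct, dotProduct_add, dotProduct_smul, k1, k2, k3,
    smul_eq_mul]
  rw [div_eq_mul_inv _ rt, rt_inv]
  linear_combination ((z₁ - z₂) ^ 2 * (y ⬝ᵥ y) / 176) * rt_sq

theorem ee_expo (t z₁ z₂ w : ℂ) (x y : Fin 8 → ℤ) :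
    ee (expo !![t, z₁; z₂, w] (cx x) (cx y)) =
      thTerm t (argU z₁ z₂ (cx y)) x * ee (w * (cx y ⬝ᵥ cx y) / 8) := by
  rw [thTerm, ← ee_add]
  congr 1
  simp only [expo, argU, dotProduct, cx, Fin.sum_univ_eight]
  simp
  ring

theorem hTheta_eq (n : ℕ) {t z₁ z₂ w : ℂ} (hZ : !![t, z₁; z₂, w] ∈ HH2) :
    hTheta n !![t, z₁; z₂, w] = ∑' y : E8, ee (w * (cx y ⬝ᵥ cx y) / 8) *
      ∑' x : E8, (cx x ⬝ᵥ altVec (cx y)) ^ n * thTerm t (argU z₁ z₂ (cx y)) x := by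
  rw [hTheta, (summable_hTerm n hZ).tsum_prod]
  refine tsum_congr fun y => ?_
  rw [← tsum_mul_left]
  refine tsum_congr fun x => ?_
  rw [hTerm, ee_expo, altForm_eq]
  ring

theorem hTheta_inv (n : ℕ) {t z₁ z₂ w : ℂ} (hZ : !![t, z₁; z₂, w] ∈ HH2) :
    hTheta n !![-1 / t, z₁ / t; z₂ / t, w - z₁ * z₂ / t] =
      t ^ (4 + n) * hTheta n !![t, z₁; z₂, w] := by
  have ht := (im_pos_of_mem hZ).1
  have ht0 := ne_zero_of_im_pos ht
  rw [hTheta_eq n hZ, hTheta_eq n (mem_HH2_inv hZ), ← tsum_mul_left]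
  refine tsum_congr fun y => ?_
  have e : argU (z₁ / t) (z₂ / t) (cx y) = fun i => argU z₁ z₂ (cx y) i / t := by
    funext i; simp only [argU]; ring
  have hd : argU z₁ z₂ (cx y) ⬝ᵥ altVec (cx y) = 0 := by
    rw [argU_eq, add_dotProduct, smul_dotProduct, smul_dotProduct, dot_altVec,
      quatMul_dot_altVec]
    simp
  rw [e, theta8_harmonic_inv ht _ _ (altVec_isotropic _) hd, argU_dot_self]
  have : ee ((w - z₁ * z₂ / t) * (cx y ⬝ᵥ cx y) / 8) *
      ee (z₁ * z₂ * (cx y ⬝ᵥ cx y) / 4 / (2 * t)) = ee (w * (cx y ⬝ᵥ cx y) / 8) := by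
    rw [← ee_add]; congr 1; field_simp; ring
  rw [← this]
  ring

theorem isHMF_hTheta (n : ℕ) : IsHMF 11 (4 + n) (hTheta n) :=
  isHMF_of_laws (differentiableOn_hTheta n) (fun p s _ hq t z₁ z₂ w _ => hTheta_tr n p s hq t z₁ z₂ w)
    (fun _ ha t z₁ z₂ w _ => hTheta_lo n ha t z₁ z₂ w) (fun t z₁ z₂ w _ => hTheta_w n t z₁ z₂ w)
    fun _ _ _ _ hZ => hTheta_inv n hZ

/-- The quadratic form of signature `(2, 4)` attached to `𝒪_K`. -/
def isoForm {α : Type*} [CommRing α] (x : Fin 6 → α) : α :=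
  x 0 * x 5 - x 1 * x 4 + (x 2 ^ 2 + x 2 * x 3 + 3 * x 3 ^ 2)

/-- The linear form of a vector on the period domain. -/
def linForm (Z : Matrix (Fin 2) (Fin 2) ℂ) (x : Fin 6 → ℂ) : ℂ :=
  x 0 + x 1 * Z 0 0 + (x 2 + x 3 * omg 11) * Z 0 1 + (x 2 + x 3 * (1 - omg 11)) * Z 1 0 +
    x 4 * Z 1 1 + x 5 * (Z 0 0 * Z 1 1 - Z 0 1 * Z 1 0)

/-- Nonzero isotropic integral vectors. -/
abbrev Iso : Type := {v : Fin 6 → ℤ // v ≠ 0 ∧ isoForm v = 0}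

/-- An invertible map preserving the quadratic form permutes the isotropic vectors. -/
def isoEquiv (f g : (Fin 6 → ℤ) → Fin 6 → ℤ) (hfg : ∀ v, f (g v) = v) (hgf : ∀ v, g (f v) = v)
    (hf : ∀ v, isoForm (f v) = isoForm v) (hf0 : f 0 = 0) : Iso ≃ Iso where
  toFun v := ⟨f v.1, fun h => v.2.1 (by
    have h0 := hgf 0
    rw [← hgf v.1, h]
    rwa [hf0] at h0), by rw [hf, v.2.2]⟩
  invFun v := ⟨g v.1, fun h => v.2.1 (by rw [← hfg v.1, h, hf0]), by rw [← hf, hfg, v.2.2]⟩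
  left_inv v := Subtype.ext (hgf _)
  right_inv v := Subtype.ext (hfg _)

/-- The Eisenstein series of weight `6`. -/
def eis (Z : Matrix (Fin 2) (Fin 2) ℂ) : ℂ :=
  ∑' v : Iso, ((linForm Z fun i => (v.1 i : ℂ)) ^ 6)⁻¹

theorem eis_eq_of_equiv {Z W : Matrix (Fin 2) (Fin 2) ℂ} {J : ℂ} (e : Iso ≃ Iso)
    (h : ∀ v : Iso, linForm Z (fun i => (v.1 i : ℂ)) = J⁻¹ * linForm W fun i => ((e v).1 i : ℂ)) :
    eis Z = J ^ 6 * eis W := by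
  rw [eis, eis, ← e.tsum_eq fun v : Iso => ((linForm W fun i => (v.1 i : ℂ)) ^ 6)⁻¹,
    ← tsum_mul_left]
  refine tsum_congr fun v => ?_
  rw [h v, mul_pow, mul_inv, inv_pow, inv_inv]

theorem eis_congr {Z W : Matrix (Fin 2) (Fin 2) ℂ} (e : Iso ≃ Iso)
    (h : ∀ v : Iso, linForm Z (fun i => (v.1 i : ℂ)) = linForm W fun i => ((e v).1 i : ℂ)) :
    eis Z = eis W := by
  have := eis_eq_of_equiv (J := 1) e fun v => by rw [h v, inv_one, one_mul]
  rwa [one_pow, one_mul] at this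

theorem eis_tr (p s : ℤ) {q : ℂ} (hq : q ∈ OK11) (t z₁ z₂ w : ℂ) :
    eis !![t + p, z₁ + q; z₂ + (starRingEnd ℂ) q, w + s] = eis !![t, z₁; z₂, w] := by
  rw [mem_OK11] at hq
  obtain ⟨c, d, rfl⟩ := hq
  let f : ℤ → ℤ → ℤ → ℤ → (Fin 6 → ℤ) → Fin 6 → ℤ := fun p s c d v =>
    ![v 0 + v 1 * p + (2 * v 2 * c + v 2 * d + v 3 * c - 5 * v 3 * d) + v 4 * s +
      v 5 * (p * s - (c ^ 2 + c * d + 3 * d ^ 2)), v 1 + v 5 * s, v 2 - v 5 * (c + d),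
      v 3 + v 5 * d, v 4 + v 5 * p, v 5]
  have hff : ∀ p s c d v, f p s c d (f (-p) (-s) (-c) (-d) v) = v := by
    intro p s c d v
    funext i
    fin_cases i <;> simp [f] <;> ring
  refine eis_congr (isoEquiv (f p s c d) (f (-p) (-s) (-c) (-d)) (hff p s c d)
    (fun v => ?_) (fun v => ?_) ?_) fun v => ?_
  · have := hff (-p) (-s) (-c) (-d) v
    simpa only [neg_neg] using this
  · simp [f, isoForm]; ring
  · funext i; fin_cases i <;> simp [f]
  · simp [isoEquiv, f, linForm, conj_omg]
    linear_combination (v.1 3 * d * (2 : ℂ) + v.1 5 * d ^ 2 : ℂ) * omg_sq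

theorem eis_lo {a : ℂ} (ha : a ∈ OK11) (t z₁ z₂ w : ℂ) :
    eis !![t, (starRingEnd ℂ) a * t + z₁; a * t + z₂,
      a * (starRingEnd ℂ) a * t + (starRingEnd ℂ) a * z₂ + a * z₁ + w] = eis !![t, z₁; z₂, w] := by
  rw [mem_OK11] at ha
  obtain ⟨c, d, rfl⟩ := ha
  let f : ℤ → ℤ → (Fin 6 → ℤ) → Fin 6 → ℤ := fun c d v =>
    ![v 0, v 1 + (2 * v 2 * c + v 2 * d + v 3 * c + 6 * v 3 * d) +
      v 4 * (c ^ 2 + c * d + 3 * d ^ 2), v 2 + v 4 * c, v 3 + v 4 * d, v 4, v 5]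
  have hff : ∀ c d v, f c d (f (-c) (-d) v) = v := by
    intro c d v
    funext i
    fin_cases i <;> simp [f] <;> ring
  refine eis_congr (isoEquiv (f c d) (f (-c) (-d)) (hff c d)
    (fun v => ?_) (fun v => ?_) ?_) fun v => ?_
  · have := hff (-c) (-d) v
    simpa only [neg_neg] using this
  · simp [f, isoForm]; ring
  · funext i; fin_cases i <;> simp [f]
  · simp [isoEquiv, f, linForm, conj_omg]
    linear_combination (-2 * v.1 3 * d * t - v.1 4 * d ^ 2 * t : ℂ) * omg_sq

theorem eis_w (t z₁ z₂ w : ℂ) : eis !![w, -z₂; -z₁, t] = eis !![t, z₁; z₂, w] := by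
  let f : (Fin 6 → ℤ) → Fin 6 → ℤ := fun v =>
    ![v 0, v 4, -(v 2 + v 3), v 3, v 1, v 5]
  have hff : ∀ v, f (f v) = v := by
    intro v
    funext i
    fin_cases i <;> simp [f]
  refine eis_congr (isoEquiv f f hff hff
    (fun v => ?_) ?_) fun v => ?_
  · simp [f, isoForm]; ring
  · funext i; fin_cases i <;> simp [f]
  · simp [isoEquiv, f, linForm]; ring

theorem eis_inv {t : ℂ} (ht : t ≠ 0) (z₁ z₂ w : ℂ) :
    eis !![-1 / t, z₁ / t; z₂ / t, w - z₁ * z₂ / t] = t ^ 6 * eis !![t, z₁; z₂, w] := by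
  let f : (Fin 6 → ℤ) → Fin 6 → ℤ := fun v => ![-v 1, v 0, v 2, v 3, -v 5, v 4]
  let g : (Fin 6 → ℤ) → Fin 6 → ℤ := fun v => ![v 1, -v 0, v 2, v 3, v 5, -v 4]
  refine eis_eq_of_equiv (J := t) (isoEquiv f g (fun v => ?_) (fun v => ?_) (fun v => ?_) ?_)
    fun v => ?_
  · funext i; fin_cases i <;> simp [f, g]
  · funext i; fin_cases i <;> simp [f, g]
  · simp [f, isoForm]; ring
  · funext i; fin_cases i <;> simp [f]
  · simp [isoEquiv, f, linForm]; field_simp; ring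

theorem linForm_ne_zero {Z : Matrix (Fin 2) (Fin 2) ℂ} (hZ : Z ∈ HH2) {x : Fin 6 → ℝ} (hx : x ≠ 0)
    (h : isoForm x = 0) : linForm Z (fun i => (x i : ℂ)) ≠ 0 := by
  obtain ⟨t, z₁, z₂, w, rfl⟩ := eta_two Z
  have hc : ((x 0 : ℂ) * x 5 - x 1 * x 4 + (x 2 ^ 2 + x 2 * x 3 + 3 * x 3 ^ 2)) = 0 := by
    exact_mod_cast h
  by_cases h5 : x 5 = 0
  · by_cases h4 : x 4 = 0
    · have h23 : x 2 ^ 2 + x 2 * x 3 + 3 * x 3 ^ 2 = 0 := by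
        simpa [isoForm, h4, h5] using h
      have h3 : x 3 = 0 := by nlinarith [sq_nonneg (2 * x 2 + x 3), sq_nonneg (x 3)]
      have h2 : x 2 = 0 := by simpa [h3] using h23
      intro h0
      simp [linForm, h2, h3, h4, h5] at h0
      have him := congrArg Complex.im h0
      have ht := (im_pos_of_mem hZ).1
      simp at him
      rcases him with h1 | h1
      · simp [h1] at h0
        exact hx (funext fun i => by fin_cases i <;> simp [h0, h1, h2, h3, h4, h5])
      · exact ht.ne' h1
    · have h4' : (x 4 : ℂ) ≠ 0 := by exact_mod_cast h4
      have hm := (im_pos_of_mem (mem_HH2_lo hZ ((x 2 + x 3 * omg 11) / x 4))).2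
      simp only [map_div₀, map_add, map_mul, Complex.conj_ofReal, conj_omg] at hm
      intro h0
      have h5' : (x 5 : ℂ) = 0 := by exact_mod_cast h5
      rw [h5'] at hc
      simp only [linForm, h5'] at h0
      simp at h0
      set V := (x 2 + x 3 * omg 11) / x 4 * ((x 2 + x 3 * (1 - omg 11)) / x 4) * t +
        (x 2 + x 3 * (1 - omg 11)) / x 4 * z₂ + (x 2 + x 3 * omg 11) / x 4 * z₁ + w with hV
      have hV2 : (x 4 : ℂ) * V = -x 0 := by
        rw [hV]
        field_simp
        linear_combination x 4 * h0 + t * hc - (x 3 ^ 2 * t : ℂ) * omg_sq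
      have := congrArg Complex.im hV2
      simp at this
      rcases this with h | h
      · exact h4 h
      · exact hm.ne' h
  · have h5' : (x 5 : ℂ) ≠ 0 := by exact_mod_cast h5
    have hm : !![t + ((x 4 / x 5 : ℝ) : ℂ), z₁ + -((x 2 + x 3 * (1 - omg 11)) / x 5);
        z₂ + (starRingEnd ℂ) (-((x 2 + x 3 * (1 - omg 11)) / x 5)), w + ((x 1 / x 5 : ℝ) : ℂ)] ∈
        HH2 := by
      rw [mem_HH2_mk] at hZ ⊢
      simpa using hZ
    have h1 := (im_pos_of_mem hm).1
    have h2 := (im_pos_of_mem (mem_HH2_inv hm)).2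
    have h1' := ne_zero_of_im_pos h1
    have h2' := ne_zero_of_im_pos h2
    have := mul_ne_zero h5' (mul_ne_zero h1' h2')
    intro h0
    apply this
    simp [linForm] at h0
    simp only [map_neg, map_div₀, map_add, map_mul, Complex.conj_ofReal, map_sub, map_one,
      conj_omg]
    rw [mul_sub, mul_div_cancel₀ _ h1']
    push_cast
    field_simp
    linear_combination x 5 * h0 - hc + (x 3 ^ 2 : ℂ) * omg_sq

theorem summable_one_add_abs_rpow {b : ℝ} (hb : 1 < b) :
    Summable fun m : ℤ => (1 + |(m : ℝ)|) ^ (-b) := by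
  refine Summable.of_nonneg_of_le (fun m => by positivity) (fun m => ?_)
    ((Real.summable_abs_int_rpow hb).add (summable_of_hasFiniteSupport
      (f := fun m : ℤ => if m = 0 then (1 : ℝ) else 0) ((Set.finite_singleton 0).subset ?_)))
  · by_cases hm : m = 0
    · subst hm
      simp [Real.zero_rpow (by linarith : -b ≠ 0)]
    · have : (0 : ℝ) < |(m : ℝ)| := by positivity
      simp only [hm, if_false, add_zero]
      exact Real.rpow_le_rpow_of_nonpos this (by linarith) (by linarith)
  · intro m hm
    by_contra h
    simp at h
    simp [h] at hm

theorem summable_prod_rpow :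
    Summable fun u : Fin 5 → ℤ => ∏ i, (1 + |(u i : ℝ)|) ^ (-(6 / 5) : ℝ) := by
  have h := (hasSum_prod_fin (n := 5) (fun _ m => (((1 + |(m : ℝ)|) ^ (-(6 / 5) : ℝ) : ℝ) : ℂ))
    fun i => ?_).1
  · refine h.congr fun u => ?_
    rw [← Complex.ofReal_prod, Complex.norm_real, Real.norm_of_nonneg (by positivity)]
  · refine (summable_one_add_abs_rpow (b := 6 / 5) (by norm_num)).congr fun m => ?_
    rw [Complex.norm_real, Real.norm_of_nonneg (by positivity)]

/-- An isotropic vector is determined by five of its coordinates. -/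
def isoCode (v : Iso) : Bool × (Fin 5 → ℤ) :=
  (decide (v.1 0 = 0), fun i => if v.1 0 = 0 then v.1 i.succ else v.1 i.castSucc)

theorem isoCode_injective : Function.Injective isoCode := by
  intro v w h
  simp only [isoCode, Prod.mk.injEq, decide_eq_decide] at h
  obtain ⟨h0, h1⟩ := h
  have hv := v.2.2
  have hw := w.2.2
  refine Subtype.ext (funext fun i => ?_)
  by_cases hp : v.1 0 = 0
  · have hp' := h0.1 hp
    simp only [hp, hp', if_true] at h1
    refine Fin.cases ?_ (fun j => ?_) i
    · rw [hp, hp']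
    · exact congrFun h1 j
  · have hp' : ¬ w.1 0 = 0 := fun h => hp (h0.2 h)
    simp only [hp, hp', if_false] at h1
    have e : ∀ j : Fin 5, v.1 j.castSucc = w.1 j.castSucc := congrFun h1
    refine Fin.lastCases ?_ (fun j => ?_) i
    · have e0 : v.1 0 = w.1 0 := e 0
      have e1 : v.1 1 = w.1 1 := e 1
      have e2 : v.1 2 = w.1 2 := e 2
      have e3 : v.1 3 = w.1 3 := e 3
      have e4 : v.1 4 = w.1 4 := e 4
      simp only [isoForm, e0, e1, e2, e3, e4] at hv hw
      exact mul_left_cancel₀ hp' (by change w.1 0 * v.1 5 = w.1 0 * w.1 5; linarith)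
    · exact e j

/-- The real vector underlying an integral vector. -/
def toReal (v : Fin 6 → ℤ) : Fin 6 → ℝ := fun i => v i

theorem one_le_norm_toReal (v : Iso) : 1 ≤ ‖toReal v.1‖ := by
  obtain ⟨i, hi⟩ := Function.ne_iff.1 v.2.1
  refine le_trans ?_ (norm_le_pi_norm (toReal v.1) i)
  rw [toReal, Real.norm_eq_abs, ← Int.cast_abs]
  exact_mod_cast Int.one_le_abs hi

theorem summable_iso : Summable fun v : Iso => (‖toReal v.1‖ ^ 6)⁻¹ := by
  have h1 : Summable fun x : Bool × (Fin 5 → ℤ) =>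
      (1 : ℝ) * ∏ i, (1 + |(x.2 i : ℝ)|) ^ (-(6 / 5) : ℝ) :=
    Summable.mul_of_nonneg (f := fun _ : Bool => (1 : ℝ))
      (g := fun u : Fin 5 → ℤ => ∏ i, (1 + |(u i : ℝ)|) ^ (-(6 / 5) : ℝ))
      (hasSum_fintype _).summable summable_prod_rpow (Pi.le_def.2 fun _ => zero_le_one)
      (Pi.le_def.2 fun u => Finset.prod_nonneg fun i _ => Real.rpow_nonneg (by positivity) _)
  have h2 : Summable fun v : Iso => (1 : ℝ) *
      ∏ i, (1 + |((isoCode v).2 i : ℝ)|) ^ (-(6 / 5) : ℝ) := h1.comp_injective isoCode_injective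
  refine Summable.of_nonneg_of_le (fun v => by positivity) (fun v => ?_)
    (h2.mul_left 64)
  have hn := one_le_norm_toReal v
  have key : ∀ i, (2 * ‖toReal v.1‖) ^ (-(6 / 5) : ℝ) ≤
      (1 + |((isoCode v).2 i : ℝ)|) ^ (-(6 / 5) : ℝ) := fun i => by
    refine Real.rpow_le_rpow_of_nonpos (by positivity) ?_ (by norm_num)
    have : |((isoCode v).2 i : ℝ)| ≤ ‖toReal v.1‖ := by
      simp only [isoCode]
      split_ifs
      · exact norm_le_pi_norm (toReal v.1) i.succ
      · exact norm_le_pi_norm (toReal v.1) i.castSucc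
    linarith
  have := Finset.prod_le_prod (s := Finset.univ) (fun i _ => by positivity) fun i _ => key i
  rw [Finset.prod_const, Finset.card_univ, Fintype.card_fin, ← Real.rpow_natCast,
    ← Real.rpow_mul (by positivity)] at this
  norm_num at this
  rw [mul_pow, mul_inv] at this
  norm_num at this ⊢
  linarith

theorem linForm_smul (Z : Matrix (Fin 2) (Fin 2) ℂ) (r : ℝ) (x : Fin 6 → ℝ) :
    linForm Z (fun i => ((r • x) i : ℂ)) = r * linForm Z fun i => (x i : ℂ) := by
  simp [linForm]; ring

theorem continuous_norm_linForm :
    Continuous fun p : Matrix (Fin 2) (Fin 2) ℂ × (Fin 6 → ℝ) =>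
      ‖linForm p.1 fun i => (p.2 i : ℂ)‖ := by
  have h1 : ∀ i, Continuous fun p : Matrix (Fin 2) (Fin 2) ℂ × (Fin 6 → ℝ) => (p.2 i : ℂ) :=
    fun i => Complex.continuous_ofReal.comp ((continuous_apply i).comp continuous_snd)
  have h2 : ∀ i j, Continuous fun p : Matrix (Fin 2) (Fin 2) ℂ × (Fin 6 → ℝ) => p.1 i j :=
    fun i j => continuous_fst.matrix_elem i j
  unfold linForm
  refine Continuous.norm ?_
  exact (((((h1 0).add ((h1 1).mul (h2 0 0))).add
    (((h1 2).add ((h1 3).mul continuous_const)).mul (h2 0 1))).add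
    (((h1 2).add ((h1 3).mul continuous_const)).mul (h2 1 0))).add ((h1 4).mul (h2 1 1))).add
    ((h1 5).mul (((h2 0 0).mul (h2 1 1)).sub ((h2 0 1).mul (h2 1 0))))

theorem eventually_le_norm_linForm {Z₀ : Matrix (Fin 2) (Fin 2) ℂ} (hZ : Z₀ ∈ HH2) :
    ∃ c > 0, ∀ᶠ Z in 𝓝 Z₀, ∀ x : Fin 6 → ℝ, isoForm x = 0 →
      c * ‖x‖ ≤ ‖linForm Z fun i => (x i : ℂ)‖ := by
  have hcf := continuous_norm_linForm
  have hK : IsCompact {x : Fin 6 → ℝ | ‖x‖ = 1 ∧ isoForm x = 0} := by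
    refine (isCompact_sphere (0 : Fin 6 → ℝ) 1).of_isClosed_subset ?_ fun x hx => by
      simpa using hx.1
    refine (isClosed_eq continuous_norm continuous_const).inter (isClosed_eq ?_ continuous_const)
    unfold isoForm
    fun_prop
  have hc0 : Continuous fun x : Fin 6 → ℝ => ‖linForm Z₀ fun i => (x i : ℂ)‖ :=
    hcf.comp (continuous_const.prodMk continuous_id)
  have hpos : ∀ x ∈ {x : Fin 6 → ℝ | ‖x‖ = 1 ∧ isoForm x = 0},
      0 < ‖linForm Z₀ fun i => (x i : ℂ)‖ := fun x hx =>
    norm_pos_iff.2 (linForm_ne_zero hZ (norm_ne_zero_iff.1 (by rw [hx.1]; exact one_ne_zero)) hx.2)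
  have hex : ∃ c : ℝ, 0 < c ∧ ∀ x : Fin 6 → ℝ, ‖x‖ = 1 ∧ isoForm x = 0 →
      c ≤ ‖linForm Z₀ fun i => (x i : ℂ)‖ := hK.exists_forall_le' hc0.continuousOn hpos
  obtain ⟨c, hc, hmin⟩ := hex
  refine ⟨c / 2, by positivity, ?_⟩
  have hev := hK.eventually_forall_of_forall_eventually (x₀ := Z₀)
    (P := fun Z x => c / 2 < ‖linForm Z fun i => (x i : ℂ)‖) fun x hx =>
      hcf.continuousAt.eventually_const_lt (by
        have := hmin x hx
        change c / 2 < ‖linForm Z₀ fun i => (x i : ℂ)‖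
        linarith)
  filter_upwards [hev] with Z h x hx
  by_cases h0 : x = 0
  · simp [h0]
  · have hn : 0 < ‖x‖ := norm_pos_iff.2 h0
    have := h (‖x‖⁻¹ • x) ⟨by rw [norm_smul, norm_inv, norm_norm, inv_mul_cancel₀ hn.ne'], by
      have : isoForm (‖x‖⁻¹ • x) = ‖x‖⁻¹ ^ 2 * isoForm x := by simp [isoForm]; ring
      rw [this, hx, mul_zero]⟩
    rw [linForm_smul, norm_mul, Complex.norm_real, norm_inv, norm_norm] at this
    rw [inv_mul_eq_div, lt_div_iff₀ hn] at this
    exact this.le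

theorem differentiableOn_eis : DifferentiableOn ℂ eis HH2 := by
  refine differentiableOn_tsum_normal isOpen_HH2 (fun v => ?_) fun Z₀ hZ₀ => ?_
  · have hd : Differentiable ℂ fun Z : Matrix (Fin 2) (Fin 2) ℂ =>
        linForm Z fun i => (v.1 i : ℂ) := by
      have he : ∀ i j, Differentiable ℂ fun Z : Matrix (Fin 2) (Fin 2) ℂ => Z i j := fun i j =>
        differentiable_pi.1 (differentiable_pi.1 differentiable_id i) j
      unfold linForm
      have := he 0 0; have := he 0 1; have := he 1 0; have := he 1 1
      fun_prop
    refine (hd.differentiableOn.pow 6).inv fun Z hZ => pow_ne_zero 6 ?_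
    have h0 : toReal v.1 ≠ 0 := fun h => by
      have := one_le_norm_toReal v
      rw [h, norm_zero] at this
      linarith
    have := linForm_ne_zero hZ h0 (by
      have := v.2.2
      simp only [isoForm, toReal] at this ⊢
      exact_mod_cast this)
    simpa [toReal] using this
  · obtain ⟨c, hc, hev⟩ := eventually_le_norm_linForm hZ₀
    refine ⟨_, summable_iso.mul_left (c ^ 6)⁻¹, ?_⟩
    filter_upwards [hev] with Z h v
    have := h (toReal v.1) (by
      have := v.2.2
      simp only [isoForm, toReal] at this ⊢
      exact_mod_cast this)
    have hn := one_le_norm_toReal v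
    rw [norm_inv, norm_pow, ← mul_inv, ← mul_pow]
    refine inv_anti₀ (by positivity) (pow_le_pow_left₀ (by positivity) ?_ 6)
    simpa [toReal] using this

theorem isHMF_eis : IsHMF 11 6 eis :=
  isHMF_of_laws differentiableOn_eis (fun p s _ hq t z₁ z₂ w _ => eis_tr p s hq t z₁ z₂ w)
    (fun _ ha t z₁ z₂ w _ => eis_lo ha t z₁ z₂ w) (fun t z₁ z₂ w _ => eis_w t z₁ z₂ w)
    fun _ z₁ z₂ w hZ => eis_inv (ne_zero_of_im_pos (im_pos_of_mem hZ).1) z₁ z₂ w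

theorem tendsto_mul_I_comap :
    Tendsto (fun s : ℝ => (s : ℂ) * Complex.I) atTop (comap Complex.im atTop) := by
  rw [tendsto_comap_iff]
  refine tendsto_id.congr fun s => ?_
  simp

/-- A form whose values on the imaginary axis stay away from zero has nonzero constant term. -/
theorem Laws.exists_constant_ne_zero {k : ℕ} {f : ℂ → ℂ → ℂ → ℂ} (hf : Laws k f)
    {u₀ : ℝ} (h : ∀ u s : ℝ, u₀ ≤ u → u₀ ≤ s →
      1 / 2 ≤ (f (u * Complex.I) 0 (s * Complex.I)).re) :
    ∃ A a, HasLead f 0 0 A ∧ Tendsto A (comap Complex.im atTop) (𝓝 a) ∧ a ≠ 0 := by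
  obtain ⟨φ, h1, -⟩ := hf.exists_phi hf.vanishesTo_zero
  have hlead : HasLead f 0 0 fun τ => φ τ 0 := by
    refine ⟨φ, h1, fun τ hτ => ?_⟩
    have := (hf.phi_differentiable h1 hτ).continuous.continuousAt (x := 0)
    simpa using this.tendsto.mono_left nhdsWithin_le_nhds
  obtain ⟨a, ha⟩ := (hf.levOne hlead).exists_tendsto
  refine ⟨_, a, hlead, ha, ?_⟩
  have h2 : ∀ u : ℝ, 0 < u → u₀ ≤ u → 1 / 2 ≤ (φ (u * Complex.I) 0).re := fun u hu hu0 => by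
    have h3 := (h1 (u * Complex.I) 0 (by simpa using hu)).comp tendsto_mul_I_comap
    refine ge_of_tendsto ((Complex.continuous_re.tendsto _).comp h3) ?_
    filter_upwards [eventually_ge_atTop u₀] with s hs
    simpa [ee_zero] using h u s hu0 hs
  have h4 : 1 / 2 ≤ a.re := by
    refine ge_of_tendsto ((Complex.continuous_re.tendsto _).comp (ha.comp tendsto_mul_I_comap)) ?_
    filter_upwards [eventually_ge_atTop u₀, eventually_gt_atTop 0] with u hu hu0
    exact h2 u hu0 hu
  rintro rfl
  norm_num at h4

theorem diag_mem_HH2 {u s : ℝ} (hu : 0 < u) (hs : 0 < s) :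
    !![(u : ℂ) * Complex.I, 0; 0, s * Complex.I] ∈ HH2 := by
  rw [mem_HH2_mk]
  simp only [map_zero, sub_zero, Complex.mul_im, Complex.ofReal_re, Complex.I_im, mul_one,
    Complex.ofReal_im, Complex.I_re, mul_zero, add_zero]
  exact ⟨hu, by positivity⟩

theorem one_le_hTheta_zero {u s : ℝ} (hu : 0 < u) (hs : 0 < s) :
    1 ≤ (hTheta 0 !![(u : ℂ) * Complex.I, 0; 0, s * Complex.I]).re := by
  have hsum := summable_hTerm 0 (diag_mem_HH2 hu hs)
  have e : ∀ p : E8 × E8, hTerm 0 !![(u : ℂ) * Complex.I, 0; 0, s * Complex.I] p =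
      (Real.exp (-(2 * Real.pi * ((u * (p.2.1 ⬝ᵥ p.2.1 : ℤ) + s * (p.1.1 ⬝ᵥ p.1.1 : ℤ)) / 8))) :
        ℝ) := fun p => by
    simp only [hTerm, expo, cx_dot]
    simp only [ee, pow_zero, one_mul, Complex.ofReal_exp]
    congr 1
    simp
    linear_combination (2 * Real.pi * (u * (p.2.1 ⬝ᵥ p.2.1 : ℤ) + s * (p.1.1 ⬝ᵥ p.1.1 : ℤ)) / 8 : ℂ) *
      Complex.I_mul_I
  rw [hTheta, Complex.re_tsum hsum]
  refine le_trans ?_ ((Complex.hasSum_re hsum.hasSum).summable.le_tsum (0 : E8 × E8) fun p _ => ?_)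
  · rw [e]
    simp
  · rw [e, Complex.ofReal_re]
    positivity

theorem normSq_linForm_diag (u s : ℝ) (v : Iso) :
    ‖linForm !![(u : ℂ) * Complex.I, 0; 0, s * Complex.I] fun i => (v.1 i : ℂ)‖ ^ 2 =
      (v.1 0 : ℝ) ^ 2 + v.1 1 ^ 2 * u ^ 2 + v.1 4 ^ 2 * s ^ 2 + v.1 5 ^ 2 * (u * s) ^ 2 +
        2 * (u * s) * (v.1 2 ^ 2 + v.1 2 * v.1 3 + 3 * v.1 3 ^ 2) := by
  have hv : (v.1 0 : ℝ) * v.1 5 - v.1 1 * v.1 4 +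
      (v.1 2 ^ 2 + v.1 2 * v.1 3 + 3 * v.1 3 ^ 2) = 0 := by
    exact_mod_cast v.2.2
  have e : (linForm !![(u : ℂ) * Complex.I, 0; 0, s * Complex.I] fun i => (v.1 i : ℂ)) =
      ((v.1 0 - v.1 5 * (u * s) : ℝ) : ℂ) + ((v.1 1 * u + v.1 4 * s : ℝ) : ℂ) * Complex.I := by
    simp [linForm]
    linear_combination (v.1 5 * u * s : ℂ) * Complex.I_mul_I
  rw [e, ← Complex.normSq_eq_norm_sq, Complex.normSq_add_mul_I]
  linear_combination (-2 * u * s) * hv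

theorem norm_le_linForm_diag {u s : ℝ} (hu : 1 ≤ u) (hs : 1 ≤ s) (v : Iso) :
    ‖toReal v.1‖ ≤
      ‖linForm !![(u : ℂ) * Complex.I, 0; 0, s * Complex.I] fun i => (v.1 i : ℂ)‖ := by
  refine (pi_norm_le_iff_of_nonneg (norm_nonneg _)).2 fun i => ?_
  refine abs_le_of_sq_le_sq' ?_ (norm_nonneg _) |> fun h => abs_le.2 h
  rw [normSq_linForm_diag]
  have hus : 1 ≤ u * s := one_le_mul_of_one_le_of_one_le hu hs
  have hu2 : 1 ≤ u ^ 2 := one_le_pow₀ hu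
  have hs2 : 1 ≤ s ^ 2 := one_le_pow₀ hs
  have hus2 : 1 ≤ (u * s) ^ 2 := one_le_pow₀ hus
  have k1 := mul_le_mul_of_nonneg_left hu2 (sq_nonneg (v.1 1 : ℝ))
  have k4 := mul_le_mul_of_nonneg_left hs2 (sq_nonneg (v.1 4 : ℝ))
  have k5 := mul_le_mul_of_nonneg_left hus2 (sq_nonneg (v.1 5 : ℝ))
  have hq : 0 ≤ (v.1 2 : ℝ) ^ 2 + v.1 2 * v.1 3 + 3 * v.1 3 ^ 2 := by
    nlinarith [sq_nonneg (2 * (v.1 2 : ℝ) + v.1 3), sq_nonneg (v.1 3 : ℝ)]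
  have k2 := mul_le_mul_of_nonneg_right hus hq
  have q2 : (v.1 2 : ℝ) ^ 2 ≤ 2 * ((v.1 2 : ℝ) ^ 2 + v.1 2 * v.1 3 + 3 * v.1 3 ^ 2) := by
    nlinarith [sq_nonneg ((v.1 2 : ℝ) + v.1 3), sq_nonneg (v.1 3 : ℝ)]
  have q3 : (v.1 3 : ℝ) ^ 2 ≤ 2 * ((v.1 2 : ℝ) ^ 2 + v.1 2 * v.1 3 + 3 * v.1 3 ^ 2) := by
    nlinarith [sq_nonneg (2 * (v.1 2 : ℝ) + v.1 3), sq_nonneg (v.1 3 : ℝ)]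
  have s0 := sq_nonneg (v.1 0 : ℝ)
  have s1 := sq_nonneg (v.1 1 : ℝ)
  have s4 := sq_nonneg (v.1 4 : ℝ)
  have s5 := sq_nonneg (v.1 5 : ℝ)
  fin_cases i <;> simp [toReal] <;> linarith

theorem le_normSq_linForm_diag {u s : ℝ} (hu : 1 ≤ u) (hs : 1 ≤ s) (v : Iso)
    (hv : ¬ (v.1 1 = 0 ∧ v.1 2 = 0 ∧ v.1 3 = 0 ∧ v.1 4 = 0 ∧ v.1 5 = 0)) :
    min u s ≤
      ‖linForm !![(u : ℂ) * Complex.I, 0; 0, s * Complex.I] fun i => (v.1 i : ℂ)‖ ^ 2 := by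
  rw [normSq_linForm_diag]
  have hm : 1 ≤ min u s := le_min hu hs
  have k1 : min u s ≤ u ^ 2 := (min_le_left _ _).trans (by nlinarith)
  have k4 : min u s ≤ s ^ 2 := (min_le_right _ _).trans (by nlinarith)
  have k2 : min u s ≤ u * s := (min_le_left _ _).trans (by nlinarith)
  have k5 : min u s ≤ (u * s) ^ 2 := k2.trans (by nlinarith)
  have hZ : 1 ≤ v.1 1 ^ 2 + v.1 4 ^ 2 + v.1 5 ^ 2 + (v.1 2 ^ 2 + v.1 2 * v.1 3 + 3 * v.1 3 ^ 2) := by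
    by_contra hlt
    have e1 := sq_nonneg (v.1 1)
    have e4 := sq_nonneg (v.1 4)
    have e5 := sq_nonneg (v.1 5)
    have e3 := sq_nonneg (v.1 3)
    have e2 := sq_nonneg (2 * v.1 2 + v.1 3)
    have hq : 4 * (v.1 2 ^ 2 + v.1 2 * v.1 3 + 3 * v.1 3 ^ 2) =
      (2 * v.1 2 + v.1 3) ^ 2 + 11 * v.1 3 ^ 2 := by ring
    have z1 : v.1 1 ^ 2 = 0 := by omega
    have z4 : v.1 4 ^ 2 = 0 := by omega
    have z5 : v.1 5 ^ 2 = 0 := by omega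
    have z3 : v.1 3 ^ 2 = 0 := by omega
    have z3' : v.1 3 = 0 := by simpa using z3
    have z2 : (2 * v.1 2 + v.1 3) ^ 2 = 0 := by omega
    have z2' : 2 * v.1 2 + v.1 3 = 0 := by simpa using z2
    exact hv ⟨by simpa using z1, by omega, z3', by simpa using z4, by simpa using z5⟩
  have hR : (1 : ℝ) ≤ v.1 1 ^ 2 + v.1 4 ^ 2 + v.1 5 ^ 2 +
      (v.1 2 ^ 2 + v.1 2 * v.1 3 + 3 * v.1 3 ^ 2) := by exact_mod_cast hZ
  have hq : 0 ≤ (v.1 2 : ℝ) ^ 2 + v.1 2 * v.1 3 + 3 * v.1 3 ^ 2 := by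
    nlinarith [sq_nonneg (2 * (v.1 2 : ℝ) + v.1 3), sq_nonneg (v.1 3 : ℝ)]
  have m1 := mul_le_mul_of_nonneg_left k1 (sq_nonneg (v.1 1 : ℝ))
  have m4 := mul_le_mul_of_nonneg_left k4 (sq_nonneg (v.1 4 : ℝ))
  have m5 := mul_le_mul_of_nonneg_left k5 (sq_nonneg (v.1 5 : ℝ))
  have m2 := mul_le_mul_of_nonneg_right k2 hq
  have m0 : 0 ≤ min u s * (v.1 2 ^ 2 + v.1 2 * v.1 3 + 3 * v.1 3 ^ 2) := by positivity
  have m := mul_le_mul_of_nonneg_left hR (zero_le_one.trans hm)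
  have s0 := sq_nonneg (v.1 0 : ℝ)
  nlinarith

theorem tendsto_min_atTop : Tendsto (fun p : ℝ × ℝ => min p.1 p.2) (atTop ×ˢ atTop) atTop := by
  refine tendsto_atTop.2 fun b => ?_
  filter_upwards [prod_mem_prod (eventually_ge_atTop b) (eventually_ge_atTop b)] with p hp
  exact le_min hp.1 hp.2

open Classical in
theorem exists_eis_ge : ∃ u₀ : ℝ, ∀ u s : ℝ, u₀ ≤ u → u₀ ≤ s →
    1 / 2 ≤ (eis !![(u : ℂ) * Complex.I, 0; 0, s * Complex.I]).re := by
  set L : Iso → ℝ := fun v =>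
    if v.1 1 = 0 ∧ v.1 2 = 0 ∧ v.1 3 = 0 ∧ v.1 4 = 0 ∧ v.1 5 = 0 then ((v.1 0 : ℝ) ^ 6)⁻¹ else 0
    with hL
  have hev : ∀ᶠ p : ℝ × ℝ in atTop ×ˢ atTop, 1 ≤ p.1 ∧ 1 ≤ p.2 :=
    prod_mem_prod (eventually_ge_atTop 1) (eventually_ge_atTop 1)
  have hbound : ∀ᶠ p : ℝ × ℝ in atTop ×ˢ atTop, ∀ v : Iso,
      ‖((linForm !![(p.1 : ℂ) * Complex.I, 0; 0, p.2 * Complex.I] fun i => (v.1 i : ℂ)) ^ 6)⁻¹‖ ≤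
        (‖toReal v.1‖ ^ 6)⁻¹ := by
    filter_upwards [hev] with p hp v
    have hn := one_le_norm_toReal v
    rw [norm_inv, norm_pow]
    exact inv_anti₀ (by positivity)
      (pow_le_pow_left₀ (by positivity) (norm_le_linForm_diag hp.1 hp.2 v) 6)
  have hlim : ∀ v : Iso, Tendsto (fun p : ℝ × ℝ =>
      ((linForm !![(p.1 : ℂ) * Complex.I, 0; 0, p.2 * Complex.I] fun i => (v.1 i : ℂ)) ^ 6)⁻¹)
        (atTop ×ˢ atTop) (𝓝 ((L v : ℝ) : ℂ)) := fun v => by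
    by_cases hv : v.1 1 = 0 ∧ v.1 2 = 0 ∧ v.1 3 = 0 ∧ v.1 4 = 0 ∧ v.1 5 = 0
    · refine tendsto_const_nhds.congr fun p => ?_
      simp only [hL, if_pos hv]
      obtain ⟨h1, h2, h3, h4, h5⟩ := hv
      simp [linForm, h1, h2, h3, h4, h5]
    · simp only [hL, if_neg hv, Complex.ofReal_zero]
      refine squeeze_zero_norm' ?_ (tendsto_inv_atTop_zero.comp tendsto_min_atTop)
      filter_upwards [hev] with p hp
      have h1 := le_normSq_linForm_diag hp.1 hp.2 v hv
      have hm : 1 ≤ min p.1 p.2 := le_min hp.1 hp.2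
      rw [norm_inv, norm_pow, Function.comp]
      refine inv_anti₀ (by positivity) (h1.trans ?_)
      refine pow_le_pow_right₀ ?_ (by norm_num)
      exact (one_le_norm_toReal v).trans (norm_le_linForm_diag hp.1 hp.2 v)
  have hLb : ∀ v, ‖((L v : ℝ) : ℂ)‖ ≤ (‖toReal v.1‖ ^ 6)⁻¹ := fun v =>
    le_of_tendsto (hlim v).norm (hbound.mono fun p hp => hp v)
  have hLs : Summable fun v => ((L v : ℝ) : ℂ) := Summable.of_norm_bounded summable_iso hLb
  have hT := tendsto_tsum_of_dominated_convergence summable_iso hlim hbound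
  have h1 : 1 ≤ (∑' v, ((L v : ℝ) : ℂ)).re := by
    rw [Complex.re_tsum hLs]
    let v₀ : Iso := ⟨![1, 0, 0, 0, 0, 0], fun h => by simpa using congrFun h 0, by simp [isoForm]⟩
    refine le_trans ?_ ((Complex.hasSum_re hLs.hasSum).summable.le_tsum v₀ fun v _ => ?_)
    · simp [hL, v₀]
    · rw [Complex.ofReal_re]
      simp only [hL]
      split_ifs
      · positivity
      · exact le_rfl
  have h2 := ((Complex.continuous_re.tendsto _).comp hT).eventually_const_lt
    (show (1 / 2 : ℝ) < _ from lt_of_lt_of_le (by norm_num) h1)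
  rw [prod_atTop_atTop_eq, eventually_atTop] at h2
  obtain ⟨⟨a, b⟩, h⟩ := h2
  refine ⟨max a b, fun u s hu hs => (h (u, s) ⟨(le_max_left a b).trans hu,
    (le_max_right a b).trans hs⟩).le⟩

/-- The symmetrization of a Hermitian modular form. -/
def symSum (k : ℕ) (F : Matrix (Fin 2) (Fin 2) ℂ → ℂ) (Z : Matrix (Fin 2) (Fin 2) ℂ) : ℂ :=
  F Z + (-1) ^ k * F Zᵀ

theorem IsHMF.symSum {k : ℕ} {F : Matrix (Fin 2) (Fin 2) ℂ → ℂ} (hF : IsHMF 11 k F) :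
    IsSymHMF 11 k (symSum k F) := hF.symmetrize

theorem restr_symSum_diag {k : ℕ} (hk : Even k) (F : Matrix (Fin 2) (Fin 2) ℂ → ℂ) (τ W : ℂ) :
    restr (symSum k F) τ 0 W = 2 * F !![τ, 0; 0, W] := by
  have : !![τ, (0 : ℂ); 0, W]ᵀ = !![τ, 0; 0, W] := by
    ext i j; fin_cases i <;> fin_cases j <;> rfl
  simp only [restr, symSum, mul_zero, hk.neg_one_pow, one_mul, this]
  ring

theorem exists_constant_ne_zero_of_ge {k : ℕ} (hk : Even k)
    {F : Matrix (Fin 2) (Fin 2) ℂ → ℂ} (hF : IsHMF 11 k F) {u₀ : ℝ}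
    (h : ∀ u s : ℝ, u₀ ≤ u → u₀ ≤ s →
      1 / 2 ≤ (F !![(u : ℂ) * Complex.I, 0; 0, s * Complex.I]).re) :
    ∃ A a, HasLead (restr (symSum k F)) 0 0 A ∧ Tendsto A (comap Complex.im atTop) (𝓝 a) ∧ a ≠ 0 :=
  hF.symSum.laws.exists_constant_ne_zero (u₀ := u₀) fun u s hu hs => by
    rw [restr_symSum_diag hk, Complex.mul_re]
    have := h u s hu hs
    simp
    linarith

theorem exists_constant_hTheta_zero :
    ∃ A a, HasLead (restr (symSum 4 (hTheta 0))) 0 0 A ∧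
      Tendsto A (comap Complex.im atTop) (𝓝 a) ∧ a ≠ 0 :=
  exists_constant_ne_zero_of_ge (by decide) (isHMF_hTheta 0) (u₀ := 1)
    fun u s hu hs => le_trans (by norm_num)
      (one_le_hTheta_zero (zero_lt_one.trans_le hu) (zero_lt_one.trans_le hs))

theorem exists_constant_eis :
    ∃ A a, HasLead (restr (symSum 6 eis)) 0 0 A ∧
      Tendsto A (comap Complex.im atTop) (𝓝 a) ∧ a ≠ 0 := by
  obtain ⟨u₀, h⟩ := exists_eis_ge
  exact exists_constant_ne_zero_of_ge (by decide) isHMF_eis h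

theorem iteratedDeriv_succ_id_mul {g : ℂ → ℂ} (hg : Differentiable ℂ g) (n : ℕ) :
    iteratedDeriv (n + 1) (fun z => z * g z) =
      fun z => z * iteratedDeriv (n + 1) g z + (n + 1) * iteratedDeriv n g z := by
  have hd : ∀ m, Differentiable ℂ (iteratedDeriv m g) := fun m =>
    (hg.contDiff (n := ⊤)).differentiable_iteratedDeriv m (by exact_mod_cast WithTop.coe_lt_top _)
  induction n with
  | zero =>
    funext z
    rw [zero_add, iteratedDeriv_one, iteratedDeriv_one, iteratedDeriv_zero]
    have := (hasDerivAt_id' z).fun_mul (hg z).hasDerivAt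
    rw [this.deriv]
    push_cast
    ring
  | succ n ih =>
    rw [iteratedDeriv_succ, ih]
    funext z
    have := ((hasDerivAt_id' z).fun_mul (hd (n + 1) z).hasDerivAt).fun_add
      ((hd n z).hasDerivAt.const_mul ((n : ℂ) + 1))
    rw [this.deriv, ← iteratedDeriv_succ, ← iteratedDeriv_succ]
    push_cast
    ring

theorem iteratedDeriv_pow_mul {g : ℂ → ℂ} (hg : Differentiable ℂ g) (n : ℕ) :
    iteratedDeriv n (fun z => z ^ n * g z) 0 = n.factorial * g 0 := by
  induction n with
  | zero => simp
  | succ n ih =>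
    have e : (fun z => z ^ (n + 1) * g z) = fun z => z * (z ^ n * g z) := by
      funext z; ring
    rw [e, iteratedDeriv_succ_id_mul (by fun_prop)]
    beta_reduce
    rw [zero_mul, zero_add, ih, Nat.factorial_succ]
    push_cast
    ring

theorem iteratedDeriv_of_tendsto_div_pow {φ : ℂ → ℂ} {ν : ℕ} {c : ℂ} (hd : Differentiable ℂ φ)
    (hc : Tendsto (fun z => φ z / z ^ ν) (𝓝[≠] 0) (𝓝 c)) :
    iteratedDeriv ν φ 0 = ν.factorial * c := by
  obtain ⟨g, hg, h0, hgz⟩ := exists_entire_quotient hd hc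
  have e : φ = fun z => z ^ ν * g z := by
    have hc2 : Continuous fun z => z ^ ν * g z := by
      have := hg.continuous
      fun_prop
    refine hd.continuous.ext_on (dense_compl_singleton (0 : ℂ)) hc2 fun z hz => ?_
    have hz : z ≠ 0 := hz
    rw [hgz z hz, mul_div_cancel₀ _ (pow_ne_zero _ hz)]
  rw [e, iteratedDeriv_pow_mul hg, h0]

theorem LevOne.eq_const_mul_dlt {c : ℂ → ℂ} (h : LevOne 1 12 c) :
    ∃ κ : ℂ, ∀ τ, 0 < τ.im → c τ = κ * dlt τ := by
  have h1 : LevOne 0 0 fun τ => c τ / dlt τ := h.div rfl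
  obtain ⟨a, ha⟩ := h1.exists_tendsto
  refine ⟨a, fun τ hτ => ?_⟩
  have h2 := h1.sub (LevOne.one.const_mul a)
  have h3 := h2.eq_zero_of_lt (by simpa using ha.sub_const a) (by norm_num) hτ
  have := dlt_ne_zero hτ
  rw [mul_one, sub_eq_zero, div_eq_iff this] at h3
  exact h3

/-- Existence of the leading coefficient of order `ν` in index one below weight twelve. -/
theorem Laws.exists_lead_one {k : ℕ} {f : ℂ → ℂ → ℂ → ℂ} (hf : Laws k f) (hv : VanishesTo f 1)
    {ν : ℕ} (hν : k + ν = 12) : ∃ c, HasLead f 1 ν c := by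
  have key : ∀ μ, μ ≤ ν → ∃ c, HasLead f 1 μ c := by
    intro μ
    induction μ with
    | zero => exact fun _ => hf.lead_of_vanishesTo hv
    | succ μ ih =>
      intro hμ
      obtain ⟨c, hc⟩ := ih (by omega)
      have h1 := hf.levOne hc
      exact hf.lead_next hc fun τ hτ =>
        h1.eq_zero_of_lt (h1.tendsto_zero (m := 0)) (by omega) hτ
  exact key ν le_rfl

section expansion

variable {ι : Type*} {a : ι → ℂ} {A B : ι → ℕ} {r : ι → ℝ} {f : ℂ → ℂ → ℂ → ℂ}

/-- The coefficients of the first Fourier-Jacobi coefficient. -/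
def jacCoeff (a : ι → ℂ) (A B : ι → ℕ) (τ : ℂ) (p : ι) : ℂ :=
  if B p = 1 then a p * ee (A p * τ) else 0

theorem expSummable_jacCoeff
    (hs : ∀ τ z W, Dom τ z W → HasSum (fun p => a p * ee (A p * τ + B p * W + r p * z)) (f τ z W))
    {τ : ℂ} (hτ : 0 < τ.im) :
    ExpSummable (jacCoeff a A B τ) fun p => 2 * Real.pi * Complex.I * r p := by
  intro R
  set z₀ : ℂ := R * Complex.I with hz₀
  obtain ⟨W, hW1⟩ := ((eventually_dom hτ z₀).exists)
  have hW2 : Dom τ (-z₀) W := by simpa [Dom] using hW1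
  have hsum := (((hs _ _ _ hW1).summable.norm).add ((hs _ _ _ hW2).summable.norm)).mul_right
    ‖ee (-W)‖
  refine Summable.of_nonneg_of_le (fun p => by positivity) (fun p => ?_) hsum
  rw [jacCoeff]
  split_ifs with h
  · have e1 : ∀ z, a p * ee (A p * τ + B p * W + r p * z) * ee (-W) =
        a p * ee (A p * τ) * ee (r p * z) := fun z => by
      rw [mul_assoc, ← ee_add, mul_assoc, ← ee_add, h]
      congr 2
      push_cast
      ring
    beta_reduce
    rw [add_mul, ← norm_mul, ← norm_mul, e1, e1, norm_mul _ (ee (r p * z₀)),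
      norm_mul _ (ee (r p * -z₀)), ← mul_add]
    refine mul_le_mul_of_nonneg_left ?_ (norm_nonneg _)
    rw [norm_ee, norm_ee, hz₀]
    have i1 : ((r p : ℂ) * (R * Complex.I)).im = r p * R := by simp
    have i2 : ((r p : ℂ) * -(R * Complex.I)).im = -(r p * R) := by simp
    rw [i1, i2]
    have n : ‖(2 * Real.pi * Complex.I * r p : ℂ)‖ = 2 * Real.pi * |r p| := by
      simp [abs_of_pos Real.pi_pos]
    rw [n]
    rcases abs_cases (r p) with ⟨h1, -⟩ | ⟨h1, -⟩
    · refine le_trans (le_of_eq ?_) (le_add_of_nonneg_left (Real.exp_pos _).le)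
      rw [h1]; congr 1; ring
    · refine le_trans (le_of_eq ?_) (le_add_of_nonneg_right (Real.exp_pos _).le)
      rw [h1]; congr 1; ring
  · rw [norm_zero, zero_mul]
    positivity

theorem hasPhi_jacCoeff
    (hs : ∀ τ z W, Dom τ z W → HasSum (fun p => a p * ee (A p * τ + B p * W + r p * z)) (f τ z W))
    (hB : ∀ p, a p ≠ 0 → 1 ≤ B p) :
    HasPhi f 1 fun τ z =>
      ∑' p, jacCoeff a A B τ p * Complex.exp (z * (2 * Real.pi * Complex.I * r p)) := by
  intro τ z hτ
  obtain ⟨W₀, hW₀⟩ := (eventually_dom hτ z).exists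
  have hb := ((hs _ _ _ hW₀).summable.norm).mul_right ‖ee (-W₀)‖
  have hlim := tendsto_tsum_of_dominated_convergence (𝓕 := comap Complex.im atTop)
    (f := fun W p => a p * ee (A p * τ + B p * W + r p * z) * ee (-W))
    (g := fun p => jacCoeff a A B τ p * Complex.exp (z * (2 * Real.pi * Complex.I * r p)))
    hb (fun p => ?_) ?_
  · refine hlim.congr' ?_
    filter_upwards [eventually_dom hτ z] with W hW
    rw [tsum_mul_right, (hs _ _ _ hW).tsum_eq, Nat.cast_one, one_mul]
  · by_cases ha : a p = 0
    · simp [jacCoeff, ha]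
    have e : ∀ W, a p * ee (A p * τ + B p * W + r p * z) * ee (-W) =
        a p * ee (A p * τ) * ee (r p * z) * ee (((B p : ℂ) - 1) * W) := fun W => by
      simp only [mul_assoc, ← ee_add]
      congr 2
      ring
    simp only [e, jacCoeff]
    split_ifs with h
    · simp only [h, Nat.cast_one, sub_self, zero_mul, ee_zero, mul_one]
      refine tendsto_const_nhds.congr fun W => ?_
      rw [ee]
      congr 2
      ring
    · rw [zero_mul]
      have h2 : 2 ≤ B p := by have := hB p ha; omega
      have h3 : (1 : ℝ) ≤ B p - 1 := by
        have : (2 : ℝ) ≤ B p := by exact_mod_cast h2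
        linarith
      have h0 : Tendsto (fun W : ℂ => ee (((B p : ℂ) - 1) * W)) (comap Complex.im atTop) (𝓝 0) := by
        refine squeeze_zero_norm' (a := fun W : ℂ => Real.exp (-W.im)) ?_
          (Real.tendsto_exp_neg_atTop_nhds_zero.comp tendsto_comap)
        filter_upwards [(eventually_ge_atTop 0).comap Complex.im] with W hW
        have hW : 0 ≤ W.im := hW
        rw [norm_ee]
        have : (((B p : ℂ) - 1) * W).im = ((B p : ℝ) - 1) * W.im := by simp
        rw [this, Real.exp_le_exp, neg_le_neg_iff]
        have hp := Real.pi_gt_three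
        nlinarith [mul_le_mul_of_nonneg_right h3 hW]
      simpa using h0.const_mul (a p * ee (A p * τ) * ee (r p * z))
  · filter_upwards [(eventually_ge_atTop W₀.im).comap Complex.im] with W hW p
    have hW : W₀.im ≤ W.im := hW
    by_cases ha : a p = 0
    · simp [ha]
    have h3 : (0 : ℝ) ≤ B p - 1 := by
      have : (1 : ℝ) ≤ B p := by exact_mod_cast hB p ha
      linarith
    rw [norm_mul, norm_mul, norm_mul, mul_assoc, mul_assoc]
    refine mul_le_mul_of_nonneg_left ?_ (norm_nonneg _)
    rw [← norm_mul, ← norm_mul, ← ee_add, ← ee_add, norm_ee, norm_ee, Real.exp_le_exp,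
      neg_le_neg_iff]
    refine mul_le_mul_of_nonneg_left ?_ Real.two_pi_pos.le
    simp
    nlinarith [mul_le_mul_of_nonneg_left hW h3]

theorem exists_lead_dlt {k : ℕ} (hf : Laws k f)
    (hs : ∀ τ z W, Dom τ z W → HasSum (fun p => a p * ee (A p * τ + B p * W + r p * z)) (f τ z W))
    (hA : ∀ p, a p ≠ 0 → 1 ≤ A p) (hB : ∀ p, a p ≠ 0 → 1 ≤ B p)
    {ν : ℕ} (hν : k + ν = 12) (R : Finset ι) (hR : ∀ p, p ∈ R ↔ A p = 1 ∧ B p = 1)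
    (hN : ∑ p ∈ R, a p * r p ^ ν ≠ 0) :
    ∃ κ : ℂ, κ ≠ 0 ∧ HasLead f 1 ν fun τ => κ * dlt τ := by
  classical
  have hphi := hasPhi_jacCoeff hs hB
  obtain ⟨c, hc⟩ := hf.exists_lead_one hphi.vanishesTo hν
  have hlev := hf.levOne hc
  rw [hν] at hlev
  obtain ⟨κ, hκ⟩ := hlev.eq_const_mul_dlt
  refine ⟨κ, ?_, hc.congr_lead hκ⟩
  rintro rfl
  obtain ⟨φ, h1, h2⟩ := hc
  have hzero : ∀ τ : ℂ, 0 < τ.im →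
      ∑' p, jacCoeff a A B τ p * (2 * Real.pi * Complex.I * r p) ^ ν = 0 := fun τ hτ => by
    have hE := expSummable_jacCoeff hs hτ
    rw [← hE.iteratedDeriv_zero ν]
    have e : φ τ = fun z =>
        ∑' p, jacCoeff a A B τ p * Complex.exp (z * (2 * Real.pi * Complex.I * r p)) :=
      funext fun z => h1.unique hphi hτ z
    rw [← e, iteratedDeriv_of_tendsto_div_pow (hf.phi_differentiable h1 hτ) (h2 τ hτ), hκ τ hτ]
    simp
  set X : ι → ℂ := fun p => (2 * Real.pi * Complex.I * r p) ^ ν with hX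
  have hI : (0 : ℝ) < Complex.I.im := by simp
  have hb := ((((expSummable_jacCoeff hs hI).mul_pow ν).summable_coeff.norm)).mul_right
    ‖ee (-Complex.I)‖
  have hlim := tendsto_tsum_of_dominated_convergence (𝓕 := comap Complex.im atTop)
    (f := fun τ p => jacCoeff a A B τ p * X p * ee (-τ))
    (g := fun p => if p ∈ R then a p * X p else 0) hb (fun p => ?_) ?_
  · have hz : Tendsto (fun _ : ℂ => (0 : ℂ)) (comap Complex.im atTop)
        (𝓝 (∑' p, if p ∈ R then a p * X p else 0)) := by
      refine hlim.congr' ?_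
      filter_upwards [(eventually_gt_atTop 0).comap Complex.im] with τ hτ
      rw [tsum_mul_right, hzero τ hτ, zero_mul]
    have h0 := tendsto_nhds_unique hz tendsto_const_nhds
    rw [tsum_eq_sum (s := R) fun p hp => if_neg hp, Finset.sum_congr rfl fun p hp => if_pos hp] at h0
    apply hN
    have h3 : (2 * Real.pi * Complex.I : ℂ) ^ ν * ∑ p ∈ R, a p * r p ^ ν = 0 := by
      rw [← h0, Finset.mul_sum]
      refine Finset.sum_congr rfl fun p _ => ?_
      rw [hX]
      ring
    exact (mul_eq_zero.1 h3).resolve_left (pow_ne_zero _ Complex.two_pi_I_ne_zero)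
  · by_cases ha : a p = 0
    · simp [jacCoeff, ha]
    simp only [jacCoeff]
    by_cases h : B p = 1
    · have e : ∀ τ, a p * ee (A p * τ) * X p * ee (-τ) =
          a p * X p * ee (((A p : ℂ) - 1) * τ) := fun τ => by
        have : ee (((A p : ℂ) - 1) * τ) = ee (A p * τ) * ee (-τ) := by
          rw [← ee_add]; congr 1; ring
        rw [this]; ring
      simp only [if_pos h, e]
      by_cases h' : A p = 1
      · rw [if_pos ((hR p).2 ⟨h', h⟩)]
        simp only [h', Nat.cast_one, sub_self, zero_mul, ee_zero, mul_one]
        exact tendsto_const_nhds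
      · rw [if_neg fun hp => h' ((hR p).1 hp).1]
        have h2 : 2 ≤ A p := by have := hA p ha; omega
        have h3 : (1 : ℝ) ≤ A p - 1 := by
          have : (2 : ℝ) ≤ A p := by exact_mod_cast h2
          linarith
        have h0 : Tendsto (fun W : ℂ => ee (((A p : ℂ) - 1) * W)) (comap Complex.im atTop)
            (𝓝 0) := by
          refine squeeze_zero_norm' (a := fun W : ℂ => Real.exp (-W.im)) ?_
            (Real.tendsto_exp_neg_atTop_nhds_zero.comp tendsto_comap)
          filter_upwards [(eventually_ge_atTop 0).comap Complex.im] with W hW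
          have hW : 0 ≤ W.im := hW
          rw [norm_ee]
          have : (((A p : ℂ) - 1) * W).im = ((A p : ℝ) - 1) * W.im := by simp
          rw [this, Real.exp_le_exp, neg_le_neg_iff]
          have hp := Real.pi_gt_three
          nlinarith [mul_le_mul_of_nonneg_right h3 hW]
        simpa using h0.const_mul (a p * X p)
    · rw [if_neg fun hp => h ((hR p).1 hp).2]
      simp only [if_neg h, zero_mul]
      exact tendsto_const_nhds
  · filter_upwards [(eventually_ge_atTop 1).comap Complex.im] with τ hτ p
    have hτ : 1 ≤ τ.im := hτ
    rw [jacCoeff, jacCoeff]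
    split_ifs with h
    · by_cases ha : a p = 0
      · simp [ha]
      have h3 : (0 : ℝ) ≤ A p - 1 := by
        have : (1 : ℝ) ≤ A p := by exact_mod_cast hA p ha
        linarith
      have e : ∀ τ, ‖a p * ee (A p * τ) * X p‖ * ‖ee (-τ)‖ =
          ‖a p * X p‖ * ‖ee (((A p : ℂ) - 1) * τ)‖ := fun τ => by
        have : ee (((A p : ℂ) - 1) * τ) = ee (A p * τ) * ee (-τ) := by
          rw [← ee_add]; congr 1; ring
        rw [this, ← norm_mul, ← norm_mul]
        congr 1
        ring
      rw [norm_mul, e, e]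
      refine mul_le_mul_of_nonneg_left ?_ (norm_nonneg _)
      rw [norm_ee, norm_ee, Real.exp_le_exp, neg_le_neg_iff]
      refine mul_le_mul_of_nonneg_left ?_ Real.two_pi_pos.le
      simp
      nlinarith
    · simp
end expansion

/-- The lists of length `k` over the alphabet `S` whose squares add up to `b`. -/
def enumVec (S : List ℤ) : ℕ → ℤ → List (List ℤ)
  | 0, b => if b = 0 then [[]] else []
  | k + 1, b => S.flatMap fun c => if c * c ≤ b then (enumVec S k (b - c * c)).map (c :: ·) else []

theorem mem_enumVec {S : List ℤ} (l : List ℤ) : ∀ b, (∀ c ∈ l, c ∈ S) →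
    (l.map fun c => c * c).sum = b → l ∈ enumVec S l.length b := by
  induction l with
  | nil => intro b _ h; simp [enumVec, ← h]
  | cons c l ih =>
    intro b hS hb
    rw [List.map_cons, List.sum_cons] at hb
    have h0 : 0 ≤ (l.map fun c => c * c).sum :=
      List.sum_nonneg fun x hx => by
        obtain ⟨y, -, rfl⟩ := List.mem_map.1 hx
        exact mul_self_nonneg y
    rw [List.length_cons, enumVec, List.mem_flatMap]
    refine ⟨c, hS c List.mem_cons_self, ?_⟩
    rw [if_pos (by linarith)]
    exact List.mem_map.2 ⟨l, ih _ (fun d hd => hS d (List.mem_cons_of_mem _ hd)) (by linarith), rfl⟩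

/-- The first nonzero entry is positive. -/
def leadPos : List ℤ → Bool
  | a :: l => if a = 0 then leadPos l else decide (0 < a)
  | [] => false

theorem leadPos_or {l : List ℤ} (h : ∃ c ∈ l, c ≠ 0) : leadPos l ∨ leadPos (l.map Neg.neg) := by
  induction l with
  | nil => simp at h
  | cons a l ih =>
    by_cases ha : a = 0
    · have : ∃ c ∈ l, c ≠ 0 := by simpa [ha] using h
      simpa [leadPos, ha] using ih this
    · simp [leadPos, ha]
      omega

/-- The positive roots of the lattice `E8`, as lists. -/
def posRoots : List (List ℤ) :=
  (enumVec [-2, 0, 2] 8 8 ++ enumVec [-1, 1] 8 8).filter fun v => v.sum % 4 = 0 ∧ leadPos v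

def toVec (l : List ℤ) : Fin 8 → ℤ := fun i => l.getD i 0

theorem toVec_ofFn (v : Fin 8 → ℤ) : toVec (List.ofFn v) = v := by
  funext i
  fin_cases i <;> simp [toVec]

theorem ofFn_mem_posRoots {v : Fin 8 → ℤ} (hv : v ∈ E8) (h8 : v ⬝ᵥ v = 8)
    (hp : leadPos (List.ofFn v)) : List.ofFn v ∈ posRoots := by
  obtain ⟨h2, h4⟩ := hv
  have hs : ((List.ofFn v).map fun c => c * c).sum = 8 := by
    rw [List.map_ofFn, List.sum_ofFn, ← h8]; rfl
  have hb : ∀ i, v i * v i ≤ 8 := fun i => by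
    rw [← h8]
    exact Finset.single_le_sum (f := fun i => v i * v i) (fun j _ => mul_self_nonneg _)
      (Finset.mem_univ i)
  have hb2 : ∀ i, -2 ≤ v i ∧ v i ≤ 2 := fun i => by
    have := hb i
    constructor <;> nlinarith
  have hl : ∀ S, (∀ i, v i ∈ S) → List.ofFn v ∈ enumVec S 8 8 := fun S hS => by
    have := mem_enumVec (S := S) (List.ofFn v) 8 (fun c hc => by
      obtain ⟨i, rfl⟩ := (List.mem_ofFn' v c).1 hc
      exact hS i) hs
    rwa [List.length_ofFn] at this
  rw [posRoots, List.mem_filter, List.mem_append]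
  refine ⟨?_, ?_⟩
  · rcases Int.even_or_odd' (v 0) with ⟨m, hm | hm⟩
    · refine Or.inl (hl _ fun i => ?_)
      have h1 := h2 i
      have h3 := hb2 i
      simp
      omega
    · refine Or.inr (hl _ fun i => ?_)
      have h1 := h2 i
      have h3 := hb2 i
      simp
      omega
  · rw [List.sum_ofFn]
    simp only [hp, and_true, decide_eq_true_eq]
    omega

/-- The roots of the lattice `E8`. -/
def rootVecs : List (Fin 8 → ℤ) := posRoots.map toVec ++ posRoots.map fun l => -toVec l

set_option maxRecDepth 100000 in
theorem rootVecs_nodup : rootVecs.Nodup := by decide +kernel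

set_option maxRecDepth 100000 in
theorem posRoots_spec : ∀ l ∈ posRoots, ((∀ i, 2 ∣ toVec l i - toVec l 0) ∧ 4 ∣ ∑ i, toVec l i) ∧
    toVec l ⬝ᵥ toVec l = 8 := by decide +kernel

theorem mem_rootVecs {v : Fin 8 → ℤ} : v ∈ rootVecs ↔ v ∈ E8 ∧ v ⬝ᵥ v = 8 := by
  rw [rootVecs, List.mem_append, List.mem_map, List.mem_map]
  constructor
  · rintro (⟨l, hl, rfl⟩ | ⟨l, hl, rfl⟩)
    · exact posRoots_spec l hl
    · obtain ⟨h1, h2⟩ := posRoots_spec l hl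
      exact ⟨E8.neg_mem h1, by rw [neg_dotProduct_neg, h2]⟩
  · rintro ⟨h1, h2⟩
    have hne : ∃ c ∈ List.ofFn v, c ≠ 0 := by
      by_contra! h
      have : v = 0 := funext fun i => h _ ((List.mem_ofFn' v _).2 ⟨i, rfl⟩)
      rw [this] at h2
      simp at h2
    rcases leadPos_or hne with h | h
    · exact Or.inl ⟨_, ofFn_mem_posRoots h1 h2 h, toVec_ofFn v⟩
    · have e : (List.ofFn v).map Neg.neg = List.ofFn (-v) := by rw [List.map_ofFn]; rfl
      rw [e] at h
      refine Or.inr ⟨_, ofFn_mem_posRoots (E8.neg_mem h1) (by rw [neg_dotProduct_neg, h2]) h, ?_⟩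
      rw [toVec_ofFn, neg_neg]

/-- Residues modulo `11` attached to a lattice vector: the values of the two eigenforms and
a coordinate vector. -/
structure ResidueRecord where
  (A B a b c d e f g h : ℕ)

def residue (x : ℤ) : ℕ := (x % 11).toNat

theorem cast_residue (x : ℤ) : (residue x : ZMod 11) = x := by
  have h : ((residue x : ℤ) : ZMod 11) = x := by
    rw [residue, Int.toNat_of_nonneg (Int.emod_nonneg _ (by norm_num))]
    exact (ZMod.intCast_eq_intCast_iff _ _ 11).2 (Int.mod_modEq _ _)
  exact_mod_cast h

def recX (v : Fin 8 → ℤ) : ResidueRecord :=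
  ⟨residue (v 1 + v 2 + 3 * v 3), residue (-v 0 + 3 * v 2 - v 3), residue (v 0), residue (v 1),
    residue (v 2), residue (v 3), residue (v 4), residue (v 5), residue (v 6), residue (v 7)⟩

def recY (v : Fin 8 → ℤ) : ResidueRecord :=
  ⟨residue (v 1 + v 2 + 3 * v 3), residue (-v 0 + 3 * v 2 - v 3),
    residue (v 0 - (-v 1 - v 2 - 3 * v 3)), residue (v 1 - (v 0 - 3 * v 2 + v 3)),
    residue (v 2 - (v 0 + 3 * v 1 - v 3)), residue (v 3 - (3 * v 0 - v 1 + v 2)),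
    residue (v 4 - (-v 5 - v 6 - 3 * v 7)), residue (v 5 - (v 4 - 3 * v 6 + v 7)),
    residue (v 6 - (v 4 + 3 * v 5 - v 7)), residue (v 7 - (3 * v 4 - v 5 + v 6))⟩

/-- The residue of a summand, written so that the kernel evaluates it with its built-in
arithmetic. -/
def recTerm (n ν : ℕ) : ResidueRecord → ResidueRecord → ℕ
  | ⟨A, B, a, b, c, d, e, f, g, h⟩, ⟨A', B', a', b', c', d', e', f', g', h'⟩ =>
    Nat.mul (Nat.pow (Nat.add (Nat.mul A B') (Nat.mul 10 (Nat.mul A' B))) n)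
      (Nat.pow (Nat.add (Nat.mul a a') (Nat.add (Nat.mul b b') (Nat.add (Nat.mul c c')
        (Nat.add (Nat.mul d d') (Nat.add (Nat.mul e e') (Nat.add (Nat.mul f f')
          (Nat.add (Nat.mul g g') (Nat.mul h h')))))))) ν)

def recFold (f : ResidueRecord → ℕ) (l : List ResidueRecord) : ℕ :=
  List.rec 0 (fun a _ ih => Nat.add (f a) ih) l

theorem recFold_eq (f : ResidueRecord → ℕ) (l : List ResidueRecord) :
    recFold f l = (l.map f).sum := by
  induction l with
  | nil => rfl
  | cons a l ih => rw [List.map_cons, List.sum_cons, ← ih]; rfl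

def recSum (n ν : ℕ) : ℕ :=
  recFold (fun x => recFold (fun y => recTerm n ν x y) ((posRoots.map toVec).map recY))
    ((posRoots.map toVec).map recX)

/-- The image modulo `√-11` of a summand. -/
def zTerm (n ν : ℕ) (x y : Fin 8 → ℤ) : ZMod 11 :=
  (((x 1 + x 2 + 3 * x 3) * (-y 0 + 3 * y 2 - y 3) -
    (y 1 + y 2 + 3 * y 3) * (-x 0 + 3 * x 2 - x 3) : ℤ) : ZMod 11) ^ n *
    ((x ⬝ᵥ y - x ⬝ᵥ quatMul y : ℤ) : ZMod 11) ^ ν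

theorem cast_recTerm (n ν : ℕ) (x y : Fin 8 → ℤ) :
    (recTerm n ν (recX x) (recY y) : ZMod 11) = zTerm n ν x y := by
  have h10 : (10 : ZMod 11) = -1 := by decide
  simp only [recTerm, recX, recY, Nat.mul_eq, Nat.add_eq, Nat.pow_eq, Nat.cast_mul, Nat.cast_pow,
    Nat.cast_add, cast_residue, zTerm, ← dotProduct_sub, Nat.cast_ofNat, h10]
  congr 2
  · push_cast
    ring
  · simp [dotProduct, Fin.sum_univ_eight, quatMul]
    ring

theorem cast_recSum (n ν : ℕ) : (recSum n ν : ZMod 11) =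
    ((posRoots.map toVec).map fun x =>
      ((posRoots.map toVec).map fun y => zTerm n ν x y).sum).sum := by
  rw [recSum, recFold_eq, ← Nat.coe_castRingHom, map_list_sum, List.map_map, List.map_map]
  refine congrArg List.sum (List.map_congr_left fun x _ => ?_)
  simp only [Function.comp_apply, recFold_eq]
  rw [map_list_sum, List.map_map, List.map_map]
  exact congrArg List.sum (List.map_congr_left fun y _ => cast_recTerm n ν x y)

theorem zTerm_neg_left {n ν : ℕ} (h : Even (n + ν)) (x y : Fin 8 → ℤ) :
    zTerm n ν (-x) y = zTerm n ν x y := by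
  have e1 : (((-x) 1 + (-x) 2 + 3 * (-x) 3) * (-y 0 + 3 * y 2 - y 3) -
    (y 1 + y 2 + 3 * y 3) * (-(-x) 0 + 3 * (-x) 2 - (-x) 3) : ℤ) =
    -((x 1 + x 2 + 3 * x 3) * (-y 0 + 3 * y 2 - y 3) -
    (y 1 + y 2 + 3 * y 3) * (-x 0 + 3 * x 2 - x 3)) := by
    simp only [Pi.neg_apply]; ring
  have e2 : (-x) ⬝ᵥ y - (-x) ⬝ᵥ quatMul y = -(x ⬝ᵥ y - x ⬝ᵥ quatMul y) := by
    rw [neg_dotProduct, neg_dotProduct]; ring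
  rw [zTerm, zTerm, e1, e2, Int.cast_neg, Int.cast_neg, neg_pow, neg_pow (Int.cast (_ - _ ⬝ᵥ _)),
    mul_mul_mul_comm, ← pow_add, h.neg_one_pow, one_mul]

theorem zTerm_neg_right {n ν : ℕ} (h : Even (n + ν)) (x y : Fin 8 → ℤ) :
    zTerm n ν x (-y) = zTerm n ν x y := by
  have e1 : ((x 1 + x 2 + 3 * x 3) * (-(-y) 0 + 3 * (-y) 2 - (-y) 3) -
    ((-y) 1 + (-y) 2 + 3 * (-y) 3) * (-x 0 + 3 * x 2 - x 3) : ℤ) =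
    -((x 1 + x 2 + 3 * x 3) * (-y 0 + 3 * y 2 - y 3) -
    (y 1 + y 2 + 3 * y 3) * (-x 0 + 3 * x 2 - x 3)) := by
    simp only [Pi.neg_apply]; ring
  have e2 : x ⬝ᵥ (-y) - x ⬝ᵥ quatMul (-y) = -(x ⬝ᵥ y - x ⬝ᵥ quatMul y) := by
    simp [dotProduct, Fin.sum_univ_eight, quatMul]; ring
  rw [zTerm, zTerm, e1, e2, Int.cast_neg, Int.cast_neg, neg_pow, neg_pow (Int.cast (_ - _ ⬝ᵥ _)),
    mul_mul_mul_comm, ← pow_add, h.neg_one_pow, one_mul]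

theorem sum_rootVecs_zTerm {n ν : ℕ} (h : Even (n + ν)) :
    (rootVecs.map fun x => (rootVecs.map fun y => zTerm n ν x y).sum).sum = 4 * recSum n ν := by
  have h1 : ∀ x, (rootVecs.map fun y => zTerm n ν x y).sum =
      2 * ((posRoots.map toVec).map fun y => zTerm n ν x y).sum := fun x => by
    rw [rootVecs, List.map_append, List.sum_append, List.map_map, List.map_map, two_mul]
    congr 2
    exact List.map_congr_left fun y _ => zTerm_neg_right h x _
  have h2 : ∀ f : (Fin 8 → ℤ) → ZMod 11, (∀ x, f (-x) = f x) →
      (rootVecs.map f).sum = 2 * ((posRoots.map toVec).map f).sum := fun f hf => by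
    rw [rootVecs, List.map_append, List.sum_append, List.map_map, List.map_map, two_mul]
    congr 2
    exact List.map_congr_left fun y _ => hf _
  rw [h2 _ fun x => by simp only [zTerm_neg_left h], cast_recSum]
  simp only [h1, List.sum_map_mul_left]
  ring

set_option maxRecDepth 100000 in
theorem recSum_ne_zero : ∀ n ∈ ({2, 4, 5, 6, 7, 8} : Finset ℕ),
    Nat.beq (Nat.mod (recSum n (8 - n)) 11) 0 = false := by
  intro n hn
  fin_cases hn <;> decide +kernel

theorem sum_zTerm_ne_zero {n : ℕ} (hn : n ∈ ({2, 4, 5, 6, 7, 8} : Finset ℕ)) :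
    ∑ x ∈ rootVecs.toFinset, ∑ y ∈ rootVecs.toFinset, zTerm n (8 - n) x y ≠ 0 := by
  simp only [List.sum_toFinset _ rootVecs_nodup]
  have h8 : n + (8 - n) = 8 := by fin_cases hn <;> rfl
  rw [sum_rootVecs_zTerm (by rw [h8]; decide)]
  have h4 : (4 : ZMod 11) ≠ 0 := by decide
  have : Fact (Nat.Prime 11) := ⟨by norm_num⟩
  refine mul_ne_zero h4 fun h => ?_
  rw [ZMod.natCast_eq_zero_iff] at h
  have := recSum_ne_zero n hn
  rw [show Nat.mod (recSum n (8 - n)) 11 = 0 from Nat.mod_eq_zero_of_dvd h] at this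
  exact absurd this (by decide)

/-- Half the norm of a lattice vector, normalized so that roots have value one. -/
def latNorm (v : E8) : ℕ := ((v : Fin 8 → ℤ) ⬝ᵥ v / 8).toNat

theorem dotProduct_eq_latNorm (v : E8) : (v : Fin 8 → ℤ) ⬝ᵥ v = 8 * latNorm v := by
  have h0 : (0 : ℤ) ≤ (v : Fin 8 → ℤ) ⬝ᵥ v := Finset.sum_nonneg fun _ _ => mul_self_nonneg _
  rw [latNorm, Int.toNat_of_nonneg (by positivity), Int.mul_ediv_cancel' (E8.eight_dvd v.2)]

theorem latNorm_eq_one {v : E8} : latNorm v = 1 ↔ (v : Fin 8 → ℤ) ∈ rootVecs := by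
  rw [mem_rootVecs, dotProduct_eq_latNorm]
  have := v.2
  constructor
  · intro h; exact ⟨this, by rw [h]; rfl⟩
  · rintro ⟨-, h⟩; omega

theorem one_le_latNorm {v : E8} (hv : cx v ≠ 0) : 1 ≤ latNorm v := by
  by_contra! h
  have h0 := dotProduct_eq_latNorm v
  rw [Nat.lt_one_iff.1 h, Nat.cast_zero, mul_zero] at h0
  apply hv
  funext i
  have := (Finset.sum_eq_zero_iff_of_nonneg fun _ _ => mul_self_nonneg _).1 h0 i (Finset.mem_univ i)
  simpa [cx] using this

theorem altForm_zero_left (y) : altForm 0 y = 0 := by simp [altForm, eigA, eigB]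

theorem altForm_zero_right (y) : altForm y 0 = 0 := by simp [altForm, eigA, eigB]

theorem altForm_swap (x y) : altForm y x = -altForm x y := by rw [altForm, altForm]; ring

theorem hTerm_restr (n : ℕ) (τ z W : ℂ) (p : E8 × E8) :
    hTerm n !![τ, (starRingEnd ℂ) (omg 11) * z; omg 11 * z, W] p =
      altForm (cx p.2) (cx p.1) ^ n * ee (latNorm p.2 * τ + latNorm p.1 * W +
        ((((p.2 : Fin 8 → ℤ) ⬝ᵥ p.1 - (p.2 : Fin 8 → ℤ) ⬝ᵥ quatMul p.1 : ℤ) / 8 : ℝ) : ℂ) * z) := by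
  rw [hTerm, expo]
  congr 2
  have h := rt_ne_zero
  have h1 := dotProduct_eq_latNorm p.1
  have h2 := dotProduct_eq_latNorm p.2
  simp only [cx_quatMul, cx_dot, h1, h2, conj_omg]
  have ho : omg 11 = (rt + 1) / 2 := by rw [rt]; ring
  simp [ho]
  field_simp
  ring

theorem hTerm_restr_transpose (n : ℕ) (τ z W : ℂ) (p : E8 × E8) :
    hTerm n !![τ, (starRingEnd ℂ) (omg 11) * z; omg 11 * z, W]ᵀ p =
      altForm (cx p.2) (cx p.1) ^ n * ee (latNorm p.2 * τ + latNorm p.1 * W +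
        ((((p.2 : Fin 8 → ℤ) ⬝ᵥ p.1 + (p.2 : Fin 8 → ℤ) ⬝ᵥ quatMul p.1 : ℤ) / 8 : ℝ) : ℂ) * z) := by
  rw [hTerm, expo]
  congr 2
  have h := rt_ne_zero
  have h1 := dotProduct_eq_latNorm p.1
  have h2 := dotProduct_eq_latNorm p.2
  simp only [cx_quatMul, cx_dot, h1, h2, conj_omg, transpose_apply]
  have ho : omg 11 = (rt + 1) / 2 := by rw [rt]; ring
  simp [ho]
  field_simp
  ring

/-- The form `altForm` on integral vectors, with values in `ℤ[√-11]`. -/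
def altZ (x y : Fin 8 → ℤ) : ℤ√(-11) :=
  ⟨x 1 + x 2 + 3 * x 3, -x 0⟩ * ⟨-y 0 + 3 * y 2 - y 3, -y 1⟩ -
    ⟨y 1 + y 2 + 3 * y 3, -y 0⟩ * ⟨-x 0 + 3 * x 2 - x 3, -x 1⟩

theorem sum_altForm_ne_zero {n : ℕ} (hn : n ∈ ({2, 4, 5, 6, 7, 8} : Finset ℕ)) :
    ∑ x ∈ rootVecs.toFinset, ∑ y ∈ rootVecs.toFinset, altForm (cx x) (cx y) ^ n *
      ((x ⬝ᵥ y - x ⬝ᵥ quatMul y : ℤ) : ℂ) ^ (8 - n) ≠ 0 := by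
  set N : ℤ√(-11) := ∑ x ∈ rootVecs.toFinset, ∑ y ∈ rootVecs.toFinset, altZ x y ^ n *
    ((x ⬝ᵥ y - x ⬝ᵥ quatMul y : ℤ) : ℤ√(-11)) ^ (8 - n) with hN
  let φ : {r : ℂ // r * r = ((-11 : ℤ) : ℂ)} := ⟨rt, by rw [rt_sq]; norm_num⟩
  let ψ : {r : ZMod 11 // r * r = ((-11 : ℤ) : ZMod 11)} := ⟨0, by decide⟩
  have hφ : ∀ x y, Zsqrtd.lift φ (altZ x y) = altForm (cx x) (cx y) := fun x y => by
    rw [altZ, map_sub, map_mul, map_mul]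
    simp [φ, altForm, eigA, eigB, cx]
    ring
  have hψ : ∀ x y, Zsqrtd.lift ψ (altZ x y) =
      (((x 1 + x 2 + 3 * x 3) * (-y 0 + 3 * y 2 - y 3) -
        (y 1 + y 2 + 3 * y 3) * (-x 0 + 3 * x 2 - x 3) : ℤ) : ZMod 11) := fun x y => by
    rw [altZ, map_sub, map_mul, map_mul]
    simp [ψ]
  have h1 : Zsqrtd.lift φ N = ∑ x ∈ rootVecs.toFinset, ∑ y ∈ rootVecs.toFinset,
      altForm (cx x) (cx y) ^ n * ((x ⬝ᵥ y - x ⬝ᵥ quatMul y : ℤ) : ℂ) ^ (8 - n) := by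
    simp only [hN, map_sum, map_mul, map_pow, hφ, map_intCast]
  have h2 : Zsqrtd.lift ψ N ≠ 0 := by
    have := sum_zTerm_ne_zero hn
    simpa only [hN, map_sum, map_mul, map_pow, hψ, map_intCast, zTerm] using this
  rw [← h1]
  intro h
  have hsq : ∀ m : ℤ, (-11 : ℤ) ≠ m * m := fun m => by nlinarith [mul_self_nonneg m]
  have h3 : N = 0 := Zsqrtd.lift_injective φ hsq (by rw [h, map_zero])
  exact h2 (by rw [h3, map_zero])

theorem exists_lead_hTheta {n : ℕ} (hn : n ∈ ({2, 4, 5, 6, 7, 8} : Finset ℕ)) :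
    ∃ κ : ℂ, κ ≠ 0 ∧
      HasLead (restr (symSum (4 + n) (hTheta n))) 1 (8 - n) fun τ => κ * dlt τ := by
  classical
  have h0 : n ≠ 0 := by rintro rfl; revert hn; decide
  have h8 : n + (8 - n) = 8 := by fin_cases hn <;> rfl
  set S : Finset E8 := rootVecs.toFinset.subtype (· ∈ E8) with hS
  have hmemS : ∀ v, v ∈ S ↔ latNorm v = 1 := fun v => by
    rw [latNorm_eq_one, hS, Finset.mem_subtype, List.mem_toFinset]
  have hsumS : ∀ f : (Fin 8 → ℤ) → ℂ, ∑ v ∈ S, f v = ∑ v ∈ rootVecs.toFinset, f v := fun f =>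
    Finset.sum_subtype_of_mem f fun v hv => (mem_rootVecs.1 (List.mem_toFinset.1 hv)).1
  let L : E8 × E8 → ℂ := fun p => altForm (cx p.2) (cx p.1) ^ n
  let r₁ : E8 × E8 → ℤ := fun p => (p.2 : Fin 8 → ℤ) ⬝ᵥ p.1 - (p.2 : Fin 8 → ℤ) ⬝ᵥ quatMul p.1
  let r₂ : E8 × E8 → ℤ := fun p => (p.2 : Fin 8 → ℤ) ⬝ᵥ p.1 + (p.2 : Fin 8 → ℤ) ⬝ᵥ quatMul p.1
  have hL : ∀ p, L p ≠ 0 → 1 ≤ latNorm p.2 ∧ 1 ≤ latNorm p.1 := fun p hp => by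
    refine ⟨one_le_latNorm fun h => hp ?_, one_le_latNorm fun h => hp ?_⟩
    · simp only [L, h, altForm_zero_left, zero_pow h0]
    · simp only [L, h, altForm_zero_right, zero_pow h0]
  have hz : (-1 : ℂ) ^ (4 + n) ≠ 0 := pow_ne_zero _ (by norm_num)
  refine exists_lead_dlt (ι := (E8 × E8) ⊕ (E8 × E8))
    (a := Sum.elim L fun p => (-1) ^ (4 + n) * L p)
    (A := Sum.elim (fun p => latNorm p.2) fun p => latNorm p.2)
    (B := Sum.elim (fun p => latNorm p.1) fun p => latNorm p.1)
    (r := Sum.elim (fun p => (r₁ p : ℝ) / 8) fun p => (r₂ p : ℝ) / 8)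
    (isHMF_hTheta n).symSum.laws (fun τ z W h => ?_) ?_ ?_ (by omega)
    ((S ×ˢ S).disjSum (S ×ˢ S)) ?_ ?_
  · have hZ := mem_HH2_restr.2 h
    refine HasSum.sum ?_ ?_
    · convert (summable_hTerm n hZ).hasSum using 1
      · funext p
        exact (hTerm_restr n τ z W p).symm
      · rfl
    · convert! (summable_hTerm n (transpose_mem_HH2 hZ)).hasSum.mul_left ((-1 : ℂ) ^ (4 + n)) using 1
      funext p
      rw [hTerm_restr_transpose, ← mul_assoc]
      rfl
  · rintro (p | p) hp
    · exact (hL p hp).1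
    · exact (hL p (right_ne_zero_of_mul hp)).1
  · rintro (p | p) hp
    · exact (hL p hp).2
    · exact (hL p (right_ne_zero_of_mul hp)).2
  · rintro (p | p)
    · simp only [Finset.inl_mem_disjSum, Finset.mem_product, hmemS, Sum.elim_inl]
      exact and_comm
    · simp only [Finset.inr_mem_disjSum, Finset.mem_product, hmemS, Sum.elim_inr]
      exact and_comm
  · have hr : ∀ x y, r₂ (y, x) = r₁ (x, y) := fun x y => by
      simp only [r₁, r₂]
      rw [dotProduct_comm (y : Fin 8 → ℤ) x, dotProduct_comm (y : Fin 8 → ℤ) (quatMul _), quatMul_dot]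
      ring
    have hLs : ∀ x y, (-1) ^ (4 + n) * L (y, x) = L (x, y) := fun x y => by
      simp only [L]
      rw [altForm_swap, neg_pow (altForm _ _), ← mul_assoc, ← pow_add, Even.neg_one_pow ⟨2 + n, by ring⟩, one_mul]
    have key : ∑ x ∈ S, ∑ y ∈ S, L (x, y) * (((r₁ (x, y) : ℝ) / 8 : ℝ) : ℂ) ^ (8 - n) ≠ 0 := by
      have e : ∑ x ∈ S, ∑ y ∈ S, L (x, y) * (((r₁ (x, y) : ℝ) / 8 : ℝ) : ℂ) ^ (8 - n) =
          (∑ x ∈ rootVecs.toFinset, ∑ y ∈ rootVecs.toFinset, altForm (cx x) (cx y) ^ n *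
            ((x ⬝ᵥ y - x ⬝ᵥ quatMul y : ℤ) : ℂ) ^ (8 - n)) / 8 ^ (8 - n) := by
        rw [Finset.sum_comm, ← hsumS, Finset.sum_div]
        refine Finset.sum_congr rfl fun x _ => ?_
        rw [← hsumS, Finset.sum_div]
        refine Finset.sum_congr rfl fun y _ => ?_
        rw [mul_div_assoc, ← div_pow]
        simp only [L, r₁]
        push_cast
        rfl
      rw [e]
      exact div_ne_zero (sum_altForm_ne_zero hn) (pow_ne_zero _ (by norm_num))
    rw [Finset.sum_disjSum, Finset.sum_product, Finset.sum_product_right]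
    simp only [Sum.elim_inl, Sum.elim_inr, hr, hLs]
    rw [← two_mul]
    exact mul_ne_zero two_ne_zero key

/-- The eight generators. -/
def gens : Fin 8 → Matrix (Fin 2) (Fin 2) ℂ → ℂ :=
  ![symSum 4 (hTheta 0), symSum 6 eis, symSum 6 (hTheta 2), symSum 8 (hTheta 4),
    symSum 9 (hTheta 5), symSum 10 (hTheta 6), symSum 11 (hTheta 7), symSum 12 (hTheta 8)]

theorem genSystem_gens : GenSystem fun i => restr (gens i) where
  four := by
    obtain ⟨A, a, h1, h2, h3⟩ := exists_constant_hTheta_zero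
    exact ⟨0, A, a, (isHMF_hTheta 0).symSum.laws, h1, h2, h3⟩
  six := by
    obtain ⟨A, a, h1, h2, h3⟩ := exists_constant_eis
    exact ⟨1, A, a, isHMF_eis.symSum.laws, h1, h2, h3⟩
  cusp := by
    have key : ∀ n ∈ ({2, 4, 5, 6, 7, 8} : Finset ℕ), ∀ i, gens i = symSum (4 + n) (hTheta n) →
        ∃ i, ∃ κ : ℂ, κ ≠ 0 ∧ Laws (4 + n) (restr (gens i)) ∧
          HasLead (restr (gens i)) 1 (8 - n) fun τ => κ * dlt τ := by
      intro n hn i hi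
      obtain ⟨κ, h1, h2⟩ := exists_lead_hTheta hn
      exact ⟨i, κ, h1, hi ▸ (isHMF_hTheta n).symSum.laws, hi ▸ h2⟩
    intro ν hν
    fin_cases hν
    · exact key 8 (by decide) 7 rfl
    · exact key 7 (by decide) 6 rfl
    · exact key 6 (by decide) 5 rfl
    · exact key 5 (by decide) 4 rfl
    · exact key 4 (by decide) 3 rfl
    · exact key 2 (by decide) 2 rfl

/-- For K = ℚ(√-11) and λ = (1+√-11)/2 (of norm 3), there are symmetric
Hermitian modular forms of weights 4, 6, 6, 8, 9, 10, 11, 12 such that every symmetric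
Hermitian modular form, minus a suitable polynomial in them, vanishes on the Heegner
divisor ℋ₃. -/
theorem reduction_against_H3_eleven :
    ∃ g : Fin 8 → (Matrix (Fin 2) (Fin 2) ℂ → ℂ),
      IsSymHMF 11 4 (g 0) ∧ IsSymHMF 11 6 (g 1) ∧ IsSymHMF 11 6 (g 2) ∧
      IsSymHMF 11 8 (g 3) ∧ IsSymHMF 11 9 (g 4) ∧ IsSymHMF 11 10 (g 5) ∧
      IsSymHMF 11 11 (g 6) ∧ IsSymHMF 11 12 (g 7) ∧
      ∀ k : ℕ, ∀ F : Matrix (Fin 2) (Fin 2) ℂ → ℂ, IsSymHMF 11 k F →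
        ∃ P : MvPolynomial (Fin 8) ℂ,
          ∀ τ ∈ HH2, τᵀ = τ →
            F (phiLam (omg 11) τ)
              = MvPolynomial.eval (fun i => g i (phiLam (omg 11) τ)) P := by
  refine ⟨gens, (isHMF_hTheta 0).symSum, isHMF_eis.symSum, (isHMF_hTheta 2).symSum,
    (isHMF_hTheta 4).symSum, (isHMF_hTheta 5).symSum, (isHMF_hTheta 6).symSum,
    (isHMF_hTheta 7).symSum, (isHMF_hTheta 8).symSum, fun k F hF => ?_⟩
  obtain ⟨P, hP⟩ := genSystem_gens.exists_polynomial hF.laws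
  refine ⟨P, fun Z hZ hs => ?_⟩
  rw [phiLam_eq]
  exact hP _ _ _ (dom_of_symm hZ hs)

end
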